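/- arXiv:2510.19718 — 2 statements merged into one kernel-verified Lean document; each statement's English description precedes it below -/
import Mathlib

section
/- For every real ε > 0 there exists n₀ = n₀(ε) such that for every integer n ≥ n₀ there exists a triangle-free simple graph G on n vertices with independence number α(G) < (1+ε)·√(n·log n). -/
namespace TwoBites
open Finset

/-- The average of a real function over a finite type. -/
noncomputable def avg {Ω : Type*} [Fintype Ω] (f : Ω → ℝ) : ℝ :=
  (∑ ω, f ω) / Fintype.card Ω

open Classical in
/-- The probability of an event under the uniform distribution on a finite type. -/
noncomputable def pr {Ω : Type*} [Fintype Ω] (A : Ω → Prop) : ℝ :=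
  avg fun ω => if A ω then 1 else 0

section avg
variable {Ω Ω' : Type*} [Fintype Ω] [Fintype Ω']

lemma avg_mono {f g : Ω → ℝ} (h : ∀ ω, f ω ≤ g ω) : avg f ≤ avg g := by
  unfold avg
  gcongr
  exact h _

lemma avg_nonneg {f : Ω → ℝ} (h : ∀ ω, 0 ≤ f ω) : 0 ≤ avg f :=
  div_nonneg (sum_nonneg fun i _ => h i) (by positivity)

lemma avg_sum {ι : Type*} (s : Finset ι) (f : ι → Ω → ℝ) :
    avg (fun ω => ∑ i ∈ s, f i ω) = ∑ i ∈ s, avg (f i) := by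
  unfold avg
  rw [sum_comm, sum_div]

lemma avg_mul_const (f : Ω → ℝ) (c : ℝ) : avg (fun ω => f ω * c) = avg f * c := by
  unfold avg
  rw [← sum_mul]; ring

lemma avg_const_le {c : ℝ} (hc : 0 ≤ c) : avg (fun _ : Ω => c) ≤ c := by
  unfold avg
  rw [sum_const, card_univ, nsmul_eq_mul]
  rcases eq_or_ne (Fintype.card Ω : ℝ) 0 with h | h
  · simp [h, hc]
  · rw [mul_div_cancel_left₀ _ h]

lemma avg_prod (f : Ω × Ω' → ℝ) : avg f = avg fun ω => avg fun ω' => f (ω, ω') := by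
  unfold avg
  rw [Fintype.sum_prod_type, Fintype.card_prod, ← sum_div, div_div, mul_comm]
  push_cast
  ring

lemma pr_nonneg (A : Ω → Prop) : 0 ≤ pr A := avg_nonneg fun ω => by split_ifs <;> norm_num

lemma pr_mono {A B : Ω → Prop} (h : ∀ ω, A ω → B ω) : pr A ≤ pr B :=
  avg_mono fun ω => by
    by_cases hA : A ω
    · simp [hA, h ω hA]
    · simp only [hA, if_false]; split_ifs <;> norm_num

lemma pr_le_one (A : Ω → Prop) : pr A ≤ 1 := by
  refine le_trans (avg_mono fun ω => ?_) (avg_const_le (Ω := Ω) zero_le_one)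
  split_ifs <;> norm_num

open Classical in
lemma pr_exists_le {ι : Type*} (s : Finset ι) (A : ι → Ω → Prop) :
    pr (fun ω => ∃ i ∈ s, A i ω) ≤ ∑ i ∈ s, pr (A i) := by
  unfold pr
  rw [← avg_sum]
  refine avg_mono fun ω => ?_
  have h0 : ∀ i ∈ s, (0 : ℝ) ≤ if A i ω then 1 else 0 := fun i _ => by split_ifs <;> norm_num
  split_ifs with h
  · obtain ⟨i, hi, hA⟩ := h
    refine le_trans ?_ (single_le_sum h0 hi)
    simp [hA]
  · exact sum_nonneg h0

lemma pr_or_le (A B : Ω → Prop) : pr (fun ω => A ω ∨ B ω) ≤ pr A + pr B := by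
  have := pr_exists_le (Finset.univ : Finset Bool) (fun b => cond b A B)
  simp only [Fintype.sum_bool, cond_true, cond_false] at this
  refine le_trans (pr_mono fun ω h => ?_) this
  rcases h with h | h
  · exact ⟨true, by simp, h⟩
  · exact ⟨false, by simp, h⟩

lemma pr_le_avg_div {A : Ω → Prop} {f : Ω → ℝ} {t : ℝ} (ht : 0 < t) (hf : ∀ ω, 0 ≤ f ω)
    (h : ∀ ω, A ω → t ≤ f ω) : pr A ≤ avg f / t := by
  rw [div_eq_mul_inv, ← avg_mul_const]
  refine avg_mono fun ω => ?_
  split_ifs with hA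
  · rw [← div_eq_mul_inv, le_div_iff₀ ht]; linarith [h ω hA]
  · have := hf ω; positivity

lemma pr_prod_le {A : Ω × Ω' → Prop} {c : ℝ} (hc : 0 ≤ c)
    (h : ∀ ω, pr (fun ω' => A (ω, ω')) ≤ c) : pr A ≤ c := by
  unfold pr at *
  rw [avg_prod]
  exact le_trans (avg_mono h) (avg_const_le hc)

lemma pr_and_prod (A : Ω → Prop) (B : Ω' → Prop) :
    pr (fun ω : Ω × Ω' => A ω.1 ∧ B ω.2) = pr A * pr B := by
  unfold pr
  rw [avg_prod, ← avg_mul_const]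
  congr 1; ext ω
  by_cases hA : A ω
  · rw [if_pos hA, one_mul]
    refine congrArg avg (funext fun ω' => ?_)
    by_cases hB : B ω' <;> simp [hA, hB]
  · simp [hA, avg]

lemma pr_fst_le (A : Ω → Prop) : pr (fun ω : Ω × Ω' => A ω.1) ≤ pr A := by
  have := pr_and_prod A (fun _ : Ω' => True)
  simp only [and_true] at this
  rw [this]
  exact mul_le_of_le_one_right (pr_nonneg _) (pr_le_one _)

lemma pr_snd_le (A : Ω' → Prop) : pr (fun ω : Ω × Ω' => A ω.2) ≤ pr A :=
  pr_prod_le (pr_nonneg _) fun _ => le_rfl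

lemma exists_not_of_pr_lt_one [Nonempty Ω] {A : Ω → Prop} (h : pr A < 1) : ∃ ω, ¬ A ω := by
  by_contra! hA
  have : pr A = 1 := by simp [pr, avg, hA]
  linarith

end avg

section product
variable {ι κ : Type*} [Fintype ι] [DecidableEq ι] [Fintype κ]

lemma avg_pi (φ : ι → κ → ℝ) :
    avg (fun g : ι → κ => ∏ i, φ i (g i)) = ∏ i, avg (φ i) := by
  unfold avg
  rw [prod_div_distrib, prod_univ_sum, Fintype.piFinset_univ]
  simp

variable [DecidableEq κ]

lemma avg_pow_card_filter [Nonempty κ] (A : Finset ι) (v : κ) (x : ℝ) :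
    avg (fun g : ι → κ => x ^ #{i ∈ A | g i = v}) =
      (1 + (x - 1) / Fintype.card κ) ^ #A := by
  have hκ : (Fintype.card κ : ℝ) ≠ 0 := by simp
  have h1 : ∀ g : ι → κ, x ^ #{i ∈ A | g i = v} =
      ∏ i, if i ∈ A then (if g i = v then x else 1) else 1 := by
    intro g
    rw [prod_ite_mem, univ_inter, prod_ite]
    simp
  simp_rw [h1]
  rw [avg_pi (fun i y => if i ∈ A then (if y = v then x else 1) else 1)]
  have h2 : ∀ i, avg (fun y : κ => if i ∈ A then (if y = v then x else 1) else 1) =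
      if i ∈ A then 1 + (x - 1) / Fintype.card κ else 1 := by
    intro i
    split_ifs with hi
    · unfold avg
      have : ∀ y : κ, (if y = v then x else 1) = 1 + if y = v then x - 1 else 0 := by
        intro y; split_ifs <;> ring
      simp_rw [this, sum_add_distrib]
      simp [add_div, hκ]
    · simp [avg, hκ]
  simp_rw [h2]
  rw [prod_ite_mem, univ_inter, prod_const]

lemma pr_upper_tail [Nonempty κ] (A : Finset ι) (v : κ) {x t : ℝ} (hx : 1 ≤ x) :
    pr (fun g : ι → κ => t ≤ #{i ∈ A | g i = v}) ≤
      Real.exp ((x - 1) * #A / Fintype.card κ - t * Real.log x) := by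
  have hx0 : 0 < x := by linarith
  have h := pr_le_avg_div (A := fun g : ι → κ => t ≤ #{i ∈ A | g i = v})
    (f := fun g => x ^ #{i ∈ A | g i = v}) (t := x ^ t) (by positivity)
    (fun g => by positivity) (fun g hg => by
      rw [← Real.rpow_natCast]; exact Real.rpow_le_rpow_of_exponent_le hx hg)
  rw [avg_pow_card_filter] at h
  refine h.trans ?_
  rw [Real.exp_sub, mul_comm t, ← Real.rpow_def_of_pos hx0]
  gcongr
  rw [mul_div_right_comm, mul_comm, Real.exp_nat_mul]
  have : 0 ≤ (x - 1) / Fintype.card κ := div_nonneg (by linarith) (by positivity)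
  gcongr
  linarith [Real.add_one_le_exp ((x - 1) / Fintype.card κ)]

lemma pr_lower_tail [Nonempty κ] (A : Finset ι) (v : κ) {x t : ℝ} (hx0 : 0 < x) (hx : x ≤ 1) :
    pr (fun g : ι → κ => #{i ∈ A | g i = v} ≤ t) ≤
      Real.exp (t * Real.log x⁻¹ - (1 - x) * #A / Fintype.card κ) := by
  have h := pr_le_avg_div (A := fun g : ι → κ => #{i ∈ A | g i = v} ≤ t)
    (f := fun g => x ^ #{i ∈ A | g i = v}) (t := x ^ t) (by positivity)
    (fun g => by positivity) (fun g hg => by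
      rw [← Real.rpow_natCast]; exact Real.rpow_le_rpow_of_exponent_ge hx0 hx hg)
  rw [avg_pow_card_filter] at h
  refine h.trans ?_
  have hκ : (1 : ℝ) ≤ Fintype.card κ := by exact_mod_cast Fintype.card_pos
  have e : t * Real.log x⁻¹ - (1 - x) * #A / Fintype.card κ =
      #A * ((x - 1) / Fintype.card κ) - Real.log x * t := by
    rw [Real.log_inv]; ring
  rw [e, Real.exp_sub, ← Real.rpow_def_of_pos hx0, Real.exp_nat_mul]
  have : -1 ≤ (x - 1) / Fintype.card κ := by
    rw [le_div_iff₀ (by linarith)]; nlinarith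
  gcongr
  · linarith
  · linarith [Real.add_one_le_exp ((x - 1) / Fintype.card κ)]

lemma pr_forall_mem [Nonempty κ] (A : Finset ι) (T : Finset κ) :
    pr (fun g : ι → κ => ∀ i ∈ A, g i ∈ T) = ((#T : ℝ) / Fintype.card κ) ^ #A := by
  have hκ : (Fintype.card κ : ℝ) ≠ 0 := by simp
  have h1 : ∀ g : ι → κ, (if ∀ i ∈ A, g i ∈ T then (1 : ℝ) else 0) =
      ∏ i, if i ∈ A then (if g i ∈ T then 1 else 0) else 1 := by
    intro g
    rw [prod_ite_mem, univ_inter, prod_ite_zero]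
    simp
  unfold pr
  have h3 : (fun g : ι → κ => (@ite _ (∀ i ∈ A, g i ∈ T) (Classical.propDecidable _) (1 : ℝ) 0)) =
      fun g => ∏ i, if i ∈ A then (if g i ∈ T then (1 : ℝ) else 0) else 1 := by
    ext g
    rw [← h1 g]
    congr
  rw [h3, avg_pi (fun i y => if i ∈ A then (if y ∈ T then (1 : ℝ) else 0) else 1)]
  have h2 : ∀ i, avg (fun y : κ => if i ∈ A then (if y ∈ T then (1 : ℝ) else 0) else 1) =
      if i ∈ A then (#T : ℝ) / Fintype.card κ else 1 := by
    intro i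
    split_ifs with hi
    · simp [avg]
    · simp [avg, hκ]
  simp_rw [h2]
  rw [prod_ite_mem, univ_inter, prod_const]

lemma pr_forall_eq [Nonempty κ] (A : Finset ι) (v : κ) :
    pr (fun g : ι → κ => ∀ i ∈ A, g i = v) = (1 / (Fintype.card κ : ℝ)) ^ #A := by
  have := pr_forall_mem A ({v} : Finset κ)
  simpa using this

end product

lemma choose_le_exp_mul_div_pow (a u : ℕ) :
    (a.choose u : ℝ) ≤ (Real.exp 1 * a / u) ^ u := by
  rcases Nat.eq_zero_or_pos u with rfl | hu
  · simp
  have h1 := Nat.choose_le_pow_div (α := ℝ) u a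
  have h2 := Real.pow_div_factorial_le_exp (u : ℝ) (by positivity) u
  refine h1.trans ?_
  have hu' : (0 : ℝ) < u := by exact_mod_cast hu
  have hf : (0 : ℝ) < u.factorial := by exact_mod_cast u.factorial_pos
  rw [div_pow, mul_pow, ← Real.exp_nat_mul, mul_one, div_le_div_iff₀ hf (by positivity)]
  rw [div_le_iff₀ hf] at h2
  have : (0 : ℝ) ≤ (a : ℝ) ^ u := by positivity
  nlinarith

/-- The image of a `k`-set under a random function is rarely small. -/
lemma pr_card_image_eq_le {ι V : Type*} [Fintype ι] [DecidableEq ι] [Fintype V] [DecidableEq V]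
    [Nonempty V] (I : Finset ι) {y : ℕ} (hy : y ≤ #I) :
    pr (fun b : ι → V => #(I.image b) = y) ≤
      Real.exp #I * ((#I : ℝ) / Fintype.card V) ^ (#I - y) := by
  have hV : (0 : ℝ) < Fintype.card V := by exact_mod_cast Fintype.card_pos
  have h1 : pr (fun b : ι → V => #(I.image b) = y) ≤
      pr (fun b : ι → V => ∃ T ∈ powersetCard y (univ : Finset V), ∀ i ∈ I, b i ∈ T) := by
    refine pr_mono fun b hb => ⟨I.image b, ?_, fun i hi => mem_image_of_mem b hi⟩
    simp [mem_powersetCard, hb]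
  refine h1.trans ((pr_exists_le _ _).trans ?_)
  have h2 : ∀ T ∈ powersetCard y (univ : Finset V),
      pr (fun b : ι → V => ∀ i ∈ I, b i ∈ T) = ((y : ℝ) / Fintype.card V) ^ #I := by
    intro T hT
    rw [pr_forall_mem, (mem_powersetCard.1 hT).2]
  rw [sum_congr rfl h2, sum_const, card_powersetCard, card_univ, nsmul_eq_mul]
  rcases Nat.eq_zero_or_pos y with rfl | hy0
  · rcases Nat.eq_zero_or_pos #I with h | h
    · simp [h]
    · have : ((0 : ℕ) : ℝ) / Fintype.card V = 0 := by simp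
      rw [this, zero_pow h.ne', mul_zero]
      positivity
  have hy' : (0 : ℝ) < y := by exact_mod_cast hy0
  have h3 := choose_le_exp_mul_div_pow (Fintype.card V) y
  have hsplit : ((y : ℝ) / Fintype.card V) ^ #I =
      ((y : ℝ) / Fintype.card V) ^ y * ((y : ℝ) / Fintype.card V) ^ (#I - y) := by
    rw [← pow_add]; congr 1; omega
  calc ((Fintype.card V).choose y : ℝ) * ((y : ℝ) / Fintype.card V) ^ #I
      ≤ (Real.exp 1 * Fintype.card V / y) ^ y *
        (((y : ℝ) / Fintype.card V) ^ y * ((y : ℝ) / Fintype.card V) ^ (#I - y)) := by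
        rw [hsplit]; gcongr
    _ = Real.exp y * ((y : ℝ) / Fintype.card V) ^ (#I - y) := by
        rw [← mul_assoc, ← mul_pow]
        have : Real.exp 1 * Fintype.card V / y * (y / Fintype.card V) = Real.exp 1 := by
          field_simp
        rw [this, ← Real.exp_nat_mul, mul_one]
    _ ≤ _ := by gcongr

section deterministic
open scoped Classical
variable {ι V : Type*} [Fintype ι] [Fintype V]

/-- The number of indices of `I` whose image under `b` is adjacent to `w`. -/
noncomputable def hits (H : SimpleGraph V) (b : ι → V) (I : Finset ι) (w : V) : ℕ :=
  #{i ∈ I | H.Adj w (b i)}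

/-- Few vertices see many elements of a set of size at most `k`. -/
def HeavyBound (H : SimpleGraph V) (k : ℕ) (h C : ℝ) : Prop :=
  ∀ A W : Finset V, #A ≤ k → (∀ w ∈ W, h ≤ #{v ∈ A | H.Adj w v}) →
    ∑ w ∈ W, (#{v ∈ A | H.Adj w v} : ℝ) ≤ C * #A

/-- The vertices outside `A ∪ B` adjacent to two distinct vertices, one in `A` and one in `B`. -/
noncomputable def linkers (H : SimpleGraph V) (A B : Finset V) : Finset V :=
  {w | w ∉ A ∧ w ∉ B ∧ ∃ x ∈ A, ∃ y ∈ B, x ≠ y ∧ H.Adj w x ∧ H.Adj w y}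

/-- Few vertices link two given sets of size at most `k`. -/
def LinkBound (H : SimpleGraph V) (k : ℕ) (u σ : ℝ) : Prop :=
  ∀ A B : Finset V, #A ≤ k → #B ≤ k → (#(linkers H A B) : ℝ) ≤ u * (#A + σ) * (#B + σ)

lemma sum_sum_pair_weight (F : ℕ) (h u σ : ℝ) (f : Fin F → ℝ) :
    ∑ θ, ∑ θ', h ^ 2 * ((f θ + f θ') + u * (f θ + σ) * (f θ' + σ)) =
      h ^ 2 * (2 * F * ∑ θ, f θ + u * (∑ θ, (f θ + σ)) ^ 2) := by
  have h1 : ∀ θ, ∑ θ', h ^ 2 * ((f θ + f θ') + u * (f θ + σ) * (f θ' + σ)) =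
      h ^ 2 * (F * f θ + ∑ θ', f θ' + u * (f θ + σ) * ∑ θ', (f θ' + σ)) := by
    intro θ
    rw [← mul_sum, sum_add_distrib, sum_add_distrib, ← mul_sum]
    simp
  simp_rw [h1]
  rw [← mul_sum, sum_add_distrib, sum_add_distrib, ← mul_sum, ← sum_mul, ← mul_sum]
  simp only [sum_const, card_univ, Fintype.card_fin, nsmul_eq_mul]
  ring

omit [Fintype V] in
lemma exists_rank (b : ι → V) (F : ℕ) (hF : ∀ v, #{i | b i = v} ≤ F) :
    ∃ ρ : ι → Fin F, ∀ i j, b i = b j → ρ i = ρ j → i = j := by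
  have h : ∀ v, Nonempty ({i // b i = v} ↪ Fin F) := by
    intro v
    rw [Function.Embedding.nonempty_iff_card_le, Fintype.card_subtype, Fintype.card_fin]
    exact hF v
  have e := fun v => Classical.choice (h v)
  refine ⟨fun i => e (b i) ⟨i, rfl⟩, fun i j hij hρ => ?_⟩
  have key : ∀ v (hi : b i = v) (hj : b j = v), e v ⟨i, hi⟩ = e v ⟨j, hj⟩ → i = j := by
    intro v hi hj hh
    simpa using (e v).injective hh
  refine key (b j) hij rfl ?_
  have : ∀ v (hi : b i = v), e (b i) ⟨i, rfl⟩ = e v ⟨i, hi⟩ := by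
    rintro v rfl; rfl
  rw [← this]; exact hρ

/-- Ordered pairs in `I` with distinct images having a common neighbour that sees fewer than `t`
indices of `I`. -/
noncomputable def lightPairs (H : SimpleGraph V) (b : ι → V) (I : Finset ι) (t : ℝ) :
    Finset (ι × ι) :=
  {p ∈ I ×ˢ I | b p.1 ≠ b p.2 ∧
    ∃ w, (hits H b I w : ℝ) < t ∧ H.Adj w (b p.1) ∧ H.Adj w (b p.2)}

set_option maxHeartbeats 400000 in
lemma card_lightPairs_le (H : SimpleGraph V) (b : ι → V) (I : Finset ι) {k F : ℕ}
    {h C u σ t : ℝ} (hI : #I ≤ k) (hF : ∀ v, #{i | b i = v} ≤ F) (hh : 0 ≤ h) (hC : 0 ≤ C)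
    (hu : 0 ≤ u) (hσ : 0 ≤ σ) (ht : 0 ≤ t)
    (hheavy : HeavyBound H k h C) (hlink : LinkBound H k u σ) :
    (#(lightPairs H b I t) : ℝ) ≤
      2 * (t * C * k) + h ^ 2 * (2 * F * k + u * (k + F * σ) ^ 2) := by
  obtain ⟨ρ, hρ⟩ := exists_rank b F hF
  set L : Fin F → Finset ι := fun θ => {i ∈ I | ρ i = θ} with hL
  set A : Fin F → Finset V := fun θ => (L θ).image b with hA
  set d : Fin F → V → ℕ := fun θ w => #{i ∈ L θ | H.Adj w (b i)} with hd
  have hinj : ∀ θ, Set.InjOn b (L θ) := by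
    intro θ i hi j hj hij
    exact hρ i j hij ((mem_filter.1 hi).2.trans (mem_filter.1 hj).2.symm)
  have hAcard : ∀ θ, #(A θ) = #(L θ) := fun θ => card_image_of_injOn (hinj θ)
  have hAk : ∀ θ, #(A θ) ≤ k := fun θ =>
    (hAcard θ).le.trans ((card_le_card (filter_subset _ _)).trans hI)
  have hdA : ∀ θ w, #{v ∈ A θ | H.Adj w v} = d θ w := by
    intro θ w
    simp only [hA, hd]
    rw [filter_image, card_image_of_injOn]
    exact (hinj θ).mono fun x hx => (mem_filter.1 hx).1
  have hLsum : ∑ θ, (#(L θ) : ℝ) ≤ k := by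
    rw [← Nat.cast_sum]
    have : ∑ θ, #(L θ) = #I := by
      rw [← card_eq_sum_card_fiberwise (f := ρ) (t := univ) (by simp)]
    rw [this]; exact_mod_cast hI
  set small : Finset V := {w | (hits H b I w : ℝ) < t} with hsmall
  set heavyIdx : V → Finset ι := fun w => {i ∈ I | H.Adj w (b i) ∧ h ≤ d (ρ i) w} with hhI
  set nbr : V → Finset ι := fun w => {i ∈ I | H.Adj w (b i)} with hnbr
  set rest : V → Finset (ι × ι) := fun w => {p ∈ I ×ˢ I | b p.1 ≠ b p.2 ∧ H.Adj w (b p.1) ∧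
    H.Adj w (b p.2) ∧ (d (ρ p.1) w : ℝ) < h ∧ (d (ρ p.2) w : ℝ) < h} with hrest
  have hcover : lightPairs H b I t ⊆ small.biUnion fun w =>
      (heavyIdx w ×ˢ nbr w) ∪ (nbr w ×ˢ heavyIdx w) ∪ rest w := by
    rintro ⟨i, j⟩ hp
    simp only [lightPairs, mem_filter, mem_product] at hp
    obtain ⟨⟨hi, hj⟩, hne, w, hw, hwi, hwj⟩ := hp
    simp only [mem_biUnion]
    refine ⟨w, by simpa [hsmall] using hw, ?_⟩
    simp only [mem_union, mem_product, hhI, hnbr, hrest, mem_filter]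
    by_cases h1 : h ≤ d (ρ i) w
    · exact Or.inl (Or.inl ⟨⟨hi, hwi, h1⟩, hj, hwj⟩)
    · by_cases h2 : h ≤ d (ρ j) w
      · exact Or.inl (Or.inr ⟨⟨hi, hwi⟩, hj, hwj, h2⟩)
      · exact Or.inr ⟨⟨hi, hj⟩, hne, hwi, hwj, not_le.1 h1, not_le.1 h2⟩
  have hcard : (#(lightPairs H b I t) : ℝ) ≤
      ∑ w ∈ small, (2 * ((#(heavyIdx w) : ℝ) * #(nbr w)) + #(rest w)) := by
    have h1 := (card_le_card hcover).trans card_biUnion_le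
    have h2 : ((∑ w ∈ small, #((heavyIdx w ×ˢ nbr w) ∪ (nbr w ×ˢ heavyIdx w) ∪ rest w) : ℕ) : ℝ)
        ≤ ∑ w ∈ small, (2 * ((#(heavyIdx w) : ℝ) * #(nbr w)) + #(rest w)) := by
      push_cast
      refine sum_le_sum fun w _ => ?_
      have h3 := (card_union_le ((heavyIdx w ×ˢ nbr w) ∪ (nbr w ×ˢ heavyIdx w)) (rest w))
      have h4 := card_union_le (heavyIdx w ×ˢ nbr w) (nbr w ×ˢ heavyIdx w)
      simp only [card_product] at h4
      have h5 : #((heavyIdx w ×ˢ nbr w) ∪ (nbr w ×ˢ heavyIdx w) ∪ rest w) ≤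
          2 * (#(heavyIdx w) * #(nbr w)) + #(rest w) := by
        rw [mul_comm #(nbr w)] at h4; omega
      exact_mod_cast h5
    exact le_trans (by exact_mod_cast h1) h2
  refine hcard.trans ?_
  rw [sum_add_distrib, ← mul_sum]
  have hpart1 : ∑ w ∈ small, ((#(heavyIdx w) : ℝ) * #(nbr w)) ≤ t * C * k := by
    have h1 : ∀ w ∈ small, ((#(heavyIdx w) : ℝ) * #(nbr w)) ≤ #(heavyIdx w) * t := by
      intro w hw
      have : (#(nbr w) : ℝ) < t := (mem_filter.1 hw).2
      gcongr
    have h2 : ∀ w, (#(heavyIdx w) : ℝ) = ∑ θ, if h ≤ d θ w then (d θ w : ℝ) else 0 := by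
      intro w
      rw [card_eq_sum_card_fiberwise (f := ρ) (t := univ) (by simp)]
      push_cast
      refine sum_congr rfl fun θ _ => ?_
      have : (filter (fun i => ρ i = θ) (heavyIdx w)) =
          if h ≤ d θ w then {i ∈ L θ | H.Adj w (b i)} else ∅ := by
        ext i
        split_ifs with hθ
        · simp only [hhI, hL, mem_filter]
          constructor
          · rintro ⟨⟨a1, a2, -⟩, a4⟩; exact ⟨⟨a1, a4⟩, a2⟩
          · rintro ⟨⟨a1, a4⟩, a2⟩; exact ⟨⟨a1, a2, by rw [a4]; exact hθ⟩, a4⟩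
        · simp only [hhI, mem_filter, notMem_empty, iff_false]
          rintro ⟨⟨-, -, a3⟩, a4⟩
          rw [a4] at a3; exact hθ a3
      rw [this]
      split_ifs <;> simp [hd]
    calc ∑ w ∈ small, ((#(heavyIdx w) : ℝ) * #(nbr w))
        ≤ ∑ w ∈ small, #(heavyIdx w) * t := sum_le_sum h1
      _ ≤ ∑ w, (#(heavyIdx w) : ℝ) * t :=
          sum_le_sum_of_subset_of_nonneg (subset_univ _) fun _ _ _ => by positivity
      _ = (∑ θ, ∑ w, if h ≤ d θ w then (d θ w : ℝ) else 0) * t := by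
          rw [← sum_mul, sum_comm]; simp_rw [h2]
      _ ≤ (∑ θ, C * #(L θ)) * t := by
          gcongr with θ
          rw [← sum_filter]
          have := hheavy (A θ) {w | h ≤ d θ w} (hAk θ) (by
            intro w hw
            rw [hdA]; simpa using hw)
          simp_rw [hdA, hAcard] at this
          exact this
      _ ≤ (C * k) * t := by
          rw [← mul_sum]; gcongr
      _ = _ := by ring
  have hpart2 : ∑ w ∈ small, (#(rest w) : ℝ) ≤ h ^ 2 * (2 * F * k + u * (k + F * σ) ^ 2) := by
    set M : Fin F → Fin F → Finset V := fun θ θ' => {w | ∃ x ∈ A θ, ∃ y ∈ A θ', x ≠ y ∧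
      H.Adj w x ∧ H.Adj w y} with hM
    have hMcard : ∀ θ θ', (#(M θ θ') : ℝ) ≤ (#(L θ) + #(L θ')) + u * (#(L θ) + σ) * (#(L θ') + σ) := by
      intro θ θ'
      have h1 : M θ θ' ⊆ (A θ ∪ A θ') ∪ linkers H (A θ) (A θ') := by
        intro w hw
        simp only [hM, mem_filter, mem_univ, true_and] at hw
        simp only [mem_union, linkers, mem_filter, mem_univ, true_and]
        tauto
      have h2 := hlink (A θ) (A θ') (hAk θ) (hAk θ')
      have h3 := (card_le_card h1).trans (card_union_le _ _)
      have h4 := card_union_le (A θ) (A θ')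
      rw [hAcard, hAcard] at h2 h4
      have h5 : (#(M θ θ') : ℝ) ≤ (#(L θ) + #(L θ')) + #(linkers H (A θ) (A θ')) := by
        exact_mod_cast h3.trans (by omega)
      linarith
    have h1 : ∀ w, (#(rest w) : ℝ) ≤ ∑ θ, ∑ θ', if w ∈ M θ θ' then h ^ 2 else 0 := by
      intro w
      rw [card_eq_sum_card_fiberwise (f := fun p : ι × ι => (ρ p.1, ρ p.2)) (t := univ) (by simp)]
      rw [Fintype.sum_prod_type]
      push_cast
      refine sum_le_sum fun θ _ => sum_le_sum fun θ' _ => ?_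
      rcases (filter (fun p : ι × ι => (ρ p.1, ρ p.2) = (θ, θ')) (rest w)).eq_empty_or_nonempty
        with he | ⟨⟨i, j⟩, hij⟩
      · rw [he]; simp only [card_empty, Nat.cast_zero]; split_ifs <;> positivity
      · simp only [hrest, mem_filter, mem_product, Prod.mk.injEq] at hij
        obtain ⟨⟨⟨hi, hj⟩, hne, hwi, hwj, hdi, hdj⟩, rfl, rfl⟩ := hij
        have hmem : w ∈ M (ρ i) (ρ j) := by
          simp only [hM, mem_filter, mem_univ, true_and]
          exact ⟨b i, mem_image_of_mem b (by simp [hL, hi]), b j,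
            mem_image_of_mem b (by simp [hL, hj]), hne, hwi, hwj⟩
        rw [if_pos hmem]
        have hsub : filter (fun p : ι × ι => (ρ p.1, ρ p.2) = (ρ i, ρ j)) (rest w) ⊆
            {a ∈ L (ρ i) | H.Adj w (b a)} ×ˢ {a ∈ L (ρ j) | H.Adj w (b a)} := by
          rintro ⟨x, y⟩ hxy
          simp only [hrest, mem_filter, mem_product, Prod.mk.injEq] at hxy
          simp only [hL, mem_product, mem_filter]
          tauto
        have hc := card_le_card hsub
        rw [card_product] at hc
        have hc' : (#(filter (fun p : ι × ι => (ρ p.1, ρ p.2) = (ρ i, ρ j)) (rest w)) : ℝ) ≤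
            d (ρ i) w * d (ρ j) w := by exact_mod_cast hc
        refine hc'.trans ?_
        rw [sq]
        gcongr
    have hLσ : ∑ θ, ((#(L θ) : ℝ) + σ) ≤ k + F * σ := by
      rw [sum_add_distrib, sum_const, card_univ, Fintype.card_fin, nsmul_eq_mul]
      linarith
    calc ∑ w ∈ small, (#(rest w) : ℝ) ≤ ∑ w, (#(rest w) : ℝ) :=
          sum_le_sum_of_subset_of_nonneg (subset_univ _) fun _ _ _ => by positivity
      _ ≤ ∑ w, ∑ θ, ∑ θ', if w ∈ M θ θ' then h ^ 2 else 0 := sum_le_sum fun w _ => h1 w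
      _ = ∑ θ, ∑ θ', h ^ 2 * #(M θ θ') := by
          rw [sum_comm]
          refine sum_congr rfl fun θ _ => ?_
          rw [sum_comm]
          refine sum_congr rfl fun θ' _ => ?_
          rw [← sum_filter, sum_const, nsmul_eq_mul, mul_comm]
          simp
      _ ≤ ∑ θ, ∑ θ', h ^ 2 * ((#(L θ) + #(L θ')) + u * (#(L θ) + σ) * (#(L θ') + σ)) := by
          gcongr with θ _ θ' _
          exact hMcard θ θ'
      _ = h ^ 2 * (2 * F * ∑ θ, (#(L θ) : ℝ) + u * (∑ θ, ((#(L θ) : ℝ) + σ)) ^ 2) := by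
          exact sum_sum_pair_weight F h u σ fun θ => (#(L θ) : ℝ)
      _ ≤ _ := by
          have hS0 : 0 ≤ ∑ θ, ((#(L θ) : ℝ) + σ) :=
            sum_nonneg fun θ _ => add_nonneg (Nat.cast_nonneg _) hσ
          exact mul_le_mul_of_nonneg_left (add_le_add
            (mul_le_mul_of_nonneg_left hLsum (by positivity))
            (mul_le_mul_of_nonneg_left (pow_le_pow_left₀ hS0 hLσ 2) hu)) (sq_nonneg h)
  linarith

end deterministic

section deterministic
open scoped Classical
variable {ι V : Type*} [Fintype ι] [Fintype V]

/-- Distinct vertices have at most `C` common neighbours. -/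
def CodegreeBound (H : SimpleGraph V) (C : ℕ) : Prop :=
  ∀ v v', v ≠ v' → #{w | H.Adj w v ∧ H.Adj w v'} ≤ C

lemma card_common_hits_le {H : SimpleGraph V} {b : ι → V} {C F : ℕ}
    (hC : CodegreeBound H C) (hF : ∀ v, #{i | b i = v} ≤ F) (I : Finset ι) {w w' : V}
    (hw : w ≠ w') : #{i ∈ I | H.Adj w (b i) ∧ H.Adj w' (b i)} ≤ C * F := by
  have h1 : ({i ∈ I | H.Adj w (b i) ∧ H.Adj w' (b i)} : Finset ι) ⊆
      ({x | H.Adj x w ∧ H.Adj x w'} : Finset V).biUnion fun x => {i | b i = x} := by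
    intro i hi
    simp only [mem_filter] at hi
    simp only [mem_biUnion, mem_filter, mem_univ, true_and]
    exact ⟨b i, ⟨hi.2.1.symm, hi.2.2.symm⟩, rfl⟩
  refine (card_le_card h1).trans ((card_biUnion_le_card_mul _ _ F fun x _ => hF x).trans ?_)
  exact Nat.mul_le_mul_right _ (hC w w' hw)

/-- The vertices seeing at least `t` indices of `I`. -/
noncomputable def bigVertices (H : SimpleGraph V) (b : ι → V) (I : Finset ι) (t : ℝ) : Finset V :=
  {w | t ≤ hits H b I w}

lemma card_bigVertices_lt {H : SimpleGraph V} {b : ι → V} {C F L k : ℕ} {t : ℝ}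
    (hC : CodegreeBound H C) (hF : ∀ v, #{i | b i = v} ≤ F) (I : Finset ι) (hI : #I ≤ k)
    (hL : (k : ℝ) + L ^ 2 * (C * F) < L * t) : #(bigVertices H b I t) < L := by
  by_contra! hlt
  obtain ⟨W, hW, hWL⟩ := exists_subset_card_eq hlt
  have h1 : (L : ℝ) * t ≤ ∑ w ∈ W, (hits H b I w : ℝ) := by
    rw [← hWL, ← nsmul_eq_mul, ← sum_const]
    exact sum_le_sum fun w hw => (mem_filter.1 (hW hw)).2
  have h2 : ∑ w ∈ W, hits H b I w = ∑ i ∈ I, #{w ∈ W | H.Adj w (b i)} := by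
    simp only [hits, card_filter]
    exact sum_comm
  have h3 : ∀ i, #{w ∈ W | H.Adj w (b i)} ≤
      1 + #{p ∈ W.offDiag | H.Adj p.1 (b i) ∧ H.Adj p.2 (b i)} := by
    intro i
    have : ({p ∈ W.offDiag | H.Adj p.1 (b i) ∧ H.Adj p.2 (b i)} : Finset (V × V)) =
        ({w ∈ W | H.Adj w (b i)} : Finset V).offDiag := by
      ext ⟨x, y⟩
      simp only [mem_filter, mem_offDiag]
      tauto
    rw [this, offDiag_card]
    rcases Nat.lt_or_ge (#{w ∈ W | H.Adj w (b i)}) 2 with h | h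
    · omega
    · have : 2 * #{w ∈ W | H.Adj w (b i)} ≤
        #{w ∈ W | H.Adj w (b i)} * #{w ∈ W | H.Adj w (b i)} := Nat.mul_le_mul_right _ h
      omega
  have h4 : ∑ i ∈ I, #{p ∈ W.offDiag | H.Adj p.1 (b i) ∧ H.Adj p.2 (b i)} =
      ∑ p ∈ W.offDiag, #{i ∈ I | H.Adj p.1 (b i) ∧ H.Adj p.2 (b i)} := by
    simp only [card_filter]
    exact sum_comm
  have h5 : ∑ p ∈ W.offDiag, #{i ∈ I | H.Adj p.1 (b i) ∧ H.Adj p.2 (b i)} ≤ L ^ 2 * (C * F) := by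
    refine (sum_le_card_nsmul _ _ (C * F) fun p hp => ?_).trans ?_
    · exact card_common_hits_le hC hF I (mem_offDiag.1 hp).2.2
    · rw [smul_eq_mul, offDiag_card, hWL, sq]
      exact Nat.mul_le_mul_right _ (Nat.sub_le _ _)
  have h6 : ∑ w ∈ W, hits H b I w ≤ k + L ^ 2 * (C * F) := by
    rw [h2]
    refine (sum_le_sum fun i _ => h3 i).trans ?_
    rw [sum_add_distrib, h4]
    simp only [sum_const, smul_eq_mul, mul_one]
    omega
  have h7 : ∑ w ∈ W, (hits H b I w : ℝ) ≤ k + L ^ 2 * (C * F) := by exact_mod_cast h6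
  linarith

/-- Two indices carry the same actual colour. -/
def SameColour {α : Type*} (c : ι → Option α) (i j : ι) : Prop := c i = c j ∧ c i ≠ none

/-- Ordered pairs of `I` that are not monochromatic and whose images coincide or have a common
neighbour. -/
noncomputable def closedPairs {α : Type*} (H : SimpleGraph V) (b : ι → V) (I : Finset ι)
    (c : ι → Option α) : Finset (ι × ι) :=
  {p ∈ I ×ˢ I | ¬ SameColour c p.1 p.2 ∧
    (b p.1 = b p.2 ∨ ∃ w, H.Adj w (b p.1) ∧ H.Adj w (b p.2))}

lemma exists_colouring {H : SimpleGraph V} {b : ι → V} {C F L k : ℕ} {t : ℝ}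
    (hC : CodegreeBound H C) (hF : ∀ v, #{i | b i = v} ≤ F) (I : Finset ι) (hI : #I ≤ k)
    (hL : (k : ℝ) + L ^ 2 * (C * F) < L * t) :
    ∃ c : ι → Option (Fin L),
      (∀ l, (∀ i ∈ I, c i ≠ some l) ∨ ∃ w, ∀ i ∈ I, c i = some l → H.Adj w (b i)) ∧
      #(closedPairs H b I c) ≤ #(lightPairs H b I t) + k * F + 2 * (L ^ 2 * (C * F) * k) := by
  set big := bigVertices H b I t with hbig
  have hlt : #big < L := card_bigVertices_lt hC hF I hI hL
  obtain ⟨e⟩ : Nonempty (big ↪ Fin L) := by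
    rw [Function.Embedding.nonempty_iff_card_le]
    simpa using hlt.le
  set P : ι → Prop := fun i => ∃ w ∈ big, H.Adj w (b i) with hP
  set c : ι → Option (Fin L) := fun i =>
    if h : P i then some (e ⟨h.choose, h.choose_spec.1⟩) else none with hc
  have hcP : ∀ i (h : P i), c i = some (e ⟨h.choose, h.choose_spec.1⟩) := fun i h => dif_pos h
  have hcN : ∀ i, ¬ P i → c i = none := fun i h => dif_neg h
  refine ⟨c, fun l => ?_, ?_⟩
  · by_cases hl : ∃ i ∈ I, c i = some l
    · obtain ⟨i, hi, hil⟩ := hl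
      have hPi : P i := by
        by_contra h
        rw [hcN i h] at hil
        simp at hil
      refine Or.inr ⟨hPi.choose, fun j hj hjl => ?_⟩
      have hPj : P j := by
        by_contra h
        rw [hcN j h] at hjl
        simp at hjl
      rw [hcP i hPi, Option.some.injEq] at hil
      rw [hcP j hPj, Option.some.injEq, ← hil] at hjl
      have := congrArg Subtype.val (e.injective hjl)
      simp only at this
      rw [← this]
      exact hPj.choose_spec.2
    · push Not at hl
      exact Or.inl hl
  · set O : Finset ι := {i ∈ I | ∃ p ∈ big.offDiag, H.Adj p.1 (b i) ∧ H.Adj p.2 (b i)} with hO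
    have hOcard : #O ≤ L ^ 2 * (C * F) := by
      have h1 : O ⊆ big.offDiag.biUnion fun p => {i ∈ I | H.Adj p.1 (b i) ∧ H.Adj p.2 (b i)} := by
        intro i hi
        obtain ⟨hiI, p, hp, hpi⟩ := mem_filter.1 hi
        exact mem_biUnion.2 ⟨p, hp, mem_filter.2 ⟨hiI, hpi⟩⟩
      refine (card_le_card h1).trans ((card_biUnion_le_card_mul _ _ (C * F) fun p hp =>
        card_common_hits_le hC hF I (mem_offDiag.1 hp).2.2).trans ?_)
      refine Nat.mul_le_mul_right _ ?_
      rw [offDiag_card, sq]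
      exact (Nat.sub_le _ _).trans (Nat.mul_le_mul hlt.le hlt.le)
    have hcover : closedPairs H b I c ⊆ lightPairs H b I t ∪
        (I.biUnion fun i => ({i} : Finset ι) ×ˢ ({j | b j = b i} : Finset ι)) ∪ (O ×ˢ I ∪ I ×ˢ O) := by
      rintro ⟨i, j⟩ hp
      simp only [closedPairs, mem_filter, mem_product] at hp
      obtain ⟨⟨hi, hj⟩, hcol, hcl⟩ := hp
      by_cases hbij : b i = b j
      · refine mem_union_left _ (mem_union_right _ (mem_biUnion.2 ⟨i, hi, ?_⟩))
        simp [hbij]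
      · obtain ⟨w, hwi, hwj⟩ := hcl.resolve_left hbij
        by_cases hw : w ∈ big
        · refine mem_union_right _ ?_
          have hPi : P i := ⟨w, hw, hwi⟩
          have hPj : P j := ⟨w, hw, hwj⟩
          by_cases hwi' : hPi.choose = w
          · by_cases hwj' : hPj.choose = w
            · exfalso
              refine hcol ⟨?_, ?_⟩
              · rw [hcP i hPi, hcP j hPj]
                congr 3
                rw [hwi', hwj']
              · rw [hcP i hPi]; simp
            · refine mem_union_right _ (mem_product.2 ⟨hi, mem_filter.2 ⟨hj, ⟨hPj.choose, w⟩, ?_, ?_⟩⟩)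
              · exact mem_offDiag.2 ⟨hPj.choose_spec.1, hw, hwj'⟩
              · exact ⟨hPj.choose_spec.2, hwj⟩
          · refine mem_union_left _ (mem_product.2 ⟨mem_filter.2 ⟨hi, ⟨hPi.choose, w⟩, ?_, ?_⟩, hj⟩)
            · exact mem_offDiag.2 ⟨hPi.choose_spec.1, hw, hwi'⟩
            · exact ⟨hPi.choose_spec.2, hwi⟩
        · refine mem_union_left _ (mem_union_left _ ?_)
          refine mem_filter.2 ⟨mem_product.2 ⟨hi, hj⟩, hbij, w, ?_, hwi, hwj⟩
          by_contra hge
          exact hw (mem_filter.2 ⟨mem_univ _, not_lt.1 hge⟩)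
    have h1 := card_le_card hcover
    have h2 := card_union_le (lightPairs H b I t ∪
        (I.biUnion fun i => ({i} : Finset ι) ×ˢ ({j | b j = b i} : Finset ι))) (O ×ˢ I ∪ I ×ˢ O)
    have h3 := card_union_le (lightPairs H b I t) (I.biUnion fun i => ({i} : Finset ι) ×ˢ ({j | b j = b i} : Finset ι))
    have h4 := card_union_le (O ×ˢ I) (I ×ˢ O)
    have h5 : #(I.biUnion fun i => ({i} : Finset ι) ×ˢ ({j | b j = b i} : Finset ι)) ≤ k * F := by
      refine (card_biUnion_le_card_mul _ _ F fun i _ => ?_).trans (Nat.mul_le_mul_right _ hI)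
      rw [card_product, card_singleton, one_mul]
      exact hF _
    have h6 : #(O ×ˢ I) ≤ L ^ 2 * (C * F) * k := by
      rw [card_product]; exact Nat.mul_le_mul hOcard hI
    have h7 : #(I ×ˢ O) ≤ L ^ 2 * (C * F) * k := by
      rw [card_product, mul_comm]; exact Nat.mul_le_mul hOcard hI
    omega

end deterministic

section randomGraph
open scoped Classical
variable {V κ : Type*} [Fintype V] [Fintype κ]

/-- The graph of the pairs coloured `v₀`. -/
def edgeGraph (v₀ : κ) (g : Sym2 V → κ) : SimpleGraph V where
  Adj x y := x ≠ y ∧ g s(x, y) = v₀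
  symm := ⟨fun x y h => ⟨h.1.symm, by rw [Sym2.eq_swap]; exact h.2⟩⟩
  loopless := ⟨fun _ h => h.1 rfl⟩

lemma sum_exists_pair_le {β : ℝ} (hβ : 0 ≤ β) (hβm : β * Fintype.card V ≤ 1)
    {Ω : Type*} [Fintype Ω] (bad : Finset V → Finset V → Ω → Prop)
    (h : ∀ A B, B.Nonempty → pr (bad A B) ≤ β ^ #A * β ^ #B) :
    pr (fun ω => ∃ A B, B.Nonempty ∧ bad A B ω) ≤ 6 * (β * Fintype.card V) := by
  set S : Finset (Finset V × Finset V) := univ ×ˢ (univ.erase ∅) with hS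
  have h1 : pr (fun ω => ∃ A B, B.Nonempty ∧ bad A B ω) ≤ ∑ p ∈ S, pr (bad p.1 p.2) := by
    refine le_trans (pr_mono fun ω hω => ?_) (pr_exists_le S fun p => bad p.1 p.2)
    obtain ⟨A, B, hB, hbad⟩ := hω
    exact ⟨(A, B), by simp [hS, nonempty_iff_ne_empty.1 hB], hbad⟩
  have hpow : ∑ A : Finset V, β ^ #A = (1 + β) ^ Fintype.card V := by
    have := Fintype.sum_pow_mul_eq_add_pow V β 1
    simpa [add_comm] using this
  have h2 : ∑ p ∈ S, pr (bad p.1 p.2) ≤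
      (1 + β) ^ Fintype.card V * ((1 + β) ^ Fintype.card V - 1) := by
    calc ∑ p ∈ S, pr (bad p.1 p.2) ≤ ∑ p ∈ S, β ^ #p.1 * β ^ #p.2 := by
          refine sum_le_sum fun p hp => h _ _ (nonempty_iff_ne_empty.2 ?_)
          simpa [hS] using hp
      _ = (∑ A : Finset V, β ^ #A) * ∑ B ∈ (univ : Finset (Finset V)).erase ∅, β ^ #B := by
          rw [hS, sum_product, sum_mul_sum]
      _ = _ := by
          have := add_sum_erase (univ : Finset (Finset V)) (fun B => β ^ #B) (mem_univ ∅)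
          rw [hpow] at this
          simp only [card_empty, pow_zero] at this
          rw [hpow, ← this]; ring
  set y := β * Fintype.card V with hy
  have hy0 : 0 ≤ y := by positivity
  have h3 : (1 + β) ^ Fintype.card V ≤ Real.exp y := by
    have : 1 + β ≤ Real.exp β := by linarith [Real.add_one_le_exp β]
    calc (1 + β) ^ Fintype.card V ≤ (Real.exp β) ^ Fintype.card V := by gcongr
      _ = Real.exp y := by rw [← Real.exp_nat_mul, mul_comm]
  have h4 : Real.exp y - 1 ≤ 2 * y := by
    have := Real.abs_exp_sub_one_le (x := y) (by rw [abs_of_nonneg hy0]; exact hβm)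
    rw [abs_of_nonneg hy0] at this
    exact (le_abs_self _).trans this
  have h5 : Real.exp y ≤ 3 := by linarith
  have h6 : (1 : ℝ) ≤ (1 + β) ^ Fintype.card V := one_le_pow₀ (by linarith)
  calc _ ≤ _ := h1.trans h2
    _ ≤ 3 * (2 * y) := by
      apply mul_le_mul (h3.trans h5) (by linarith) (by linarith) (by norm_num)
    _ = 6 * y := by ring

variable [Nonempty κ]

lemma pr_le_card_linkers (v₀ : κ) (A B : Finset V) (u : ℕ) :
    pr (fun g : Sym2 V → κ => u ≤ #(linkers (edgeGraph v₀ g) A B)) ≤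
      (Fintype.card V).choose u * ((#A : ℝ) * #B / (Fintype.card κ : ℝ) ^ 2) ^ u := by
  set P : V → Finset (V × V) := fun w =>
    if w ∉ A ∧ w ∉ B then {p ∈ A ×ˢ B | p.1 ≠ p.2} else ∅ with hP
  set Φ : Finset V → Finset (V → V × V) := fun U =>
    Fintype.piFinset fun w => if w ∈ U then P w else {(w, w)} with hΦ
  set E : Finset V → (V → V × V) → Finset (Sym2 V) := fun U f =>
    U.biUnion fun w => {s(w, (f w).1), s(w, (f w).2)} with hE
  have hq : (0 : ℝ) < Fintype.card κ := by exact_mod_cast Fintype.card_pos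
  have hfix : ∀ U, #U = u →
      pr (fun g : Sym2 V → κ => U ⊆ linkers (edgeGraph v₀ g) A B) ≤
        ((#A : ℝ) * #B / (Fintype.card κ : ℝ) ^ 2) ^ u := by
    intro U hU
    have h1 : pr (fun g : Sym2 V → κ => U ⊆ linkers (edgeGraph v₀ g) A B) ≤
        pr (fun g : Sym2 V → κ => ∃ f ∈ Φ U, ∀ e ∈ E U f, g e = v₀) := by
      refine pr_mono fun g hg => ?_
      have : ∀ w, ∃ p : V × V, (w ∈ U → p ∈ P w ∧ g s(w, p.1) = v₀ ∧ g s(w, p.2) = v₀) ∧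
          (w ∉ U → p = (w, w)) := by
        intro w
        by_cases hw : w ∈ U
        · obtain ⟨-, h1, h2, x, hx, y, hy, hxy, hwx, hwy⟩ := mem_filter.1 (hg hw)
          refine ⟨(x, y), fun _ => ⟨?_, hwx.2, hwy.2⟩, fun h => absurd hw h⟩
          simp only [hP, h1, h2, not_false_eq_true, and_self, if_true, mem_filter, mem_product]
          exact ⟨⟨hx, hy⟩, hxy⟩
        · exact ⟨(w, w), fun h => absurd h hw, fun _ => rfl⟩
      choose f hf1 hf2 using this
      refine ⟨f, Fintype.mem_piFinset.2 fun w => ?_, ?_⟩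
      · split_ifs with hw
        · exact (hf1 w hw).1
        · simp [hf2 w hw]
      · intro e he
        obtain ⟨w, hw, he⟩ := mem_biUnion.1 he
        rcases mem_insert.1 he with rfl | he
        · exact (hf1 w hw).2.1
        · rw [mem_singleton.1 he]; exact (hf1 w hw).2.2
    refine h1.trans ((pr_exists_le _ _).trans ?_)
    have h2 : ∀ f ∈ Φ U, pr (fun g : Sym2 V → κ => ∀ e ∈ E U f, g e = v₀) =
        (1 / (Fintype.card κ : ℝ)) ^ (2 * u) := by
      intro f hf
      rw [pr_forall_eq]
      congr 1
      have hfP : ∀ w ∈ U, f w ∈ P w := fun w hw => by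
        have := Fintype.mem_piFinset.1 hf w
        rwa [if_pos hw] at this
      have hP' : ∀ w ∈ U, w ∉ A ∧ w ∉ B ∧ (f w).1 ∈ A ∧ (f w).2 ∈ B ∧ (f w).1 ≠ (f w).2 := by
        intro w hw
        have := hfP w hw
        simp only [hP] at this
        split_ifs at this with h
        · simp only [mem_filter, mem_product] at this
          exact ⟨h.1, h.2, this.1.1, this.1.2, this.2⟩
        · simp at this
      rw [hE]
      simp only
      rw [card_biUnion]
      · rw [sum_congr rfl (g := fun _ => 2), sum_const, hU, smul_eq_mul, mul_comm]
        intro w hw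
        rw [card_pair]
        intro h
        obtain ⟨a1, a2, a3, a4, a5⟩ := hP' w hw
        rw [Sym2.eq_iff] at h
        rcases h with h | h
        · exact a5 h.2
        · exact a5 (h.2.trans h.1)
      · intro w hw w' hw' hne
        obtain ⟨a1, a2, a3, a4, -⟩ := hP' w hw
        obtain ⟨b1, b2, b3, b4, -⟩ := hP' w' hw'
        rw [Function.onFun, disjoint_left]
        intro e he he'
        simp only [mem_insert, mem_singleton] at he he'
        have key : w ∈ e ∧ w' ∈ e := by
          constructor
          · rcases he with rfl | rfl <;> simp
          · rcases he' with rfl | rfl <;> simp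
        rcases he with rfl | rfl
        · rcases Sym2.mem_iff.1 key.2 with h | h
          · exact hne h.symm
          · exact b1 (h ▸ a3)
        · rcases Sym2.mem_iff.1 key.2 with h | h
          · exact hne h.symm
          · exact b2 (h ▸ a4)
    rw [sum_congr rfl h2, sum_const, nsmul_eq_mul]
    have h3 : (#(Φ U) : ℝ) ≤ ((#A : ℝ) * #B) ^ u := by
      have : #(Φ U) ≤ (#A * #B) ^ u := by
        rw [hΦ, Fintype.card_piFinset]
        have : ∀ w, #(if w ∈ U then P w else {(w, w)}) = if w ∈ U then #(P w) else 1 := by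
          intro w; split_ifs <;> simp
        rw [prod_congr rfl fun w _ => this w, prod_ite_mem, univ_inter, ← hU, ← prod_const]
        refine prod_le_prod' fun w _ => ?_
        rw [hP]
        simp only
        split_ifs
        · exact (card_filter_le _ _).trans (card_product _ _).le
        · simp
      exact_mod_cast this
    calc (#(Φ U) : ℝ) * (1 / (Fintype.card κ : ℝ)) ^ (2 * u)
        ≤ ((#A : ℝ) * #B) ^ u * (1 / (Fintype.card κ : ℝ)) ^ (2 * u) := by gcongr
      _ = _ := by rw [pow_mul, ← mul_pow]; congr 1; field_simp
  have h1 : pr (fun g : Sym2 V → κ => u ≤ #(linkers (edgeGraph v₀ g) A B)) ≤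
      pr (fun g : Sym2 V → κ => ∃ U ∈ powersetCard u (univ : Finset V),
        U ⊆ linkers (edgeGraph v₀ g) A B) := by
    refine pr_mono fun g hg => ?_
    obtain ⟨U, hU, hUc⟩ := exists_subset_card_eq hg
    exact ⟨U, by simp [hUc], hU⟩
  refine h1.trans ((pr_exists_le _ _).trans ((sum_le_card_nsmul _ _ _ fun U hU =>
    hfix U (mem_powersetCard.1 hU).2).trans ?_))
  rw [card_powersetCard, card_univ, nsmul_eq_mul]

lemma pr_not_linkBound_le (v₀ : κ) (k : ℕ) {u σ Y β : ℝ} (hu : 0 < u) (hσ : 0 < σ) (hY : 0 ≤ Y)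
    (hm : Real.exp 1 * Fintype.card V ≤ u * (Fintype.card κ : ℝ) ^ 2 * Real.exp (-Y))
    (hβ : Real.exp (-(Y * u * σ)) ≤ β) (hβm : β * Fintype.card V ≤ 1) :
    pr (fun g : Sym2 V → κ => ¬ LinkBound (edgeGraph v₀ g) k u σ) ≤
      6 * (β * Fintype.card V) := by
  have hβ0 : 0 < β := (Real.exp_pos _).trans_le hβ
  have hq : (0 : ℝ) < Fintype.card κ := by exact_mod_cast Fintype.card_pos
  refine le_trans (pr_mono fun g hg => ?_) (sum_exists_pair_le hβ0.le hβm
    (fun A B (g : Sym2 V → κ) =>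
      ⌈u * (#A + σ) * (#B + σ)⌉₊ ≤ #(linkers (edgeGraph v₀ g) A B)) ?_)
  · simp only [LinkBound] at hg
    push Not at hg
    obtain ⟨A, B, -, -, h⟩ := hg
    refine ⟨A, B, ?_, Nat.ceil_le.2 h.le⟩
    rw [nonempty_iff_ne_empty]
    rintro rfl
    have : linkers (edgeGraph v₀ g) A ∅ = ∅ := by simp [linkers]
    rw [this, card_empty, Nat.cast_zero] at h
    exact absurd h (not_lt.2 (by positivity))
  · intro A B _
    set u₀ := ⌈u * (#A + σ) * (#B + σ)⌉₊ with hu₀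
    have hle : u * (#A + σ) * (#B + σ) ≤ u₀ := Nat.le_ceil _
    have hpos : (0 : ℝ) < u₀ := lt_of_lt_of_le (by positivity) hle
    refine (pr_le_card_linkers v₀ A B u₀).trans ?_
    calc ((Fintype.card V).choose u₀ : ℝ) * ((#A : ℝ) * #B / (Fintype.card κ : ℝ) ^ 2) ^ u₀
        ≤ (Real.exp 1 * Fintype.card V / u₀) ^ u₀ *
            ((#A : ℝ) * #B / (Fintype.card κ : ℝ) ^ 2) ^ u₀ := by
          gcongr; exact choose_le_exp_mul_div_pow _ _
      _ = (Real.exp 1 * Fintype.card V / u₀ * ((#A : ℝ) * #B / (Fintype.card κ : ℝ) ^ 2)) ^ u₀ :=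
          (mul_pow _ _ _).symm
      _ ≤ (Real.exp (-Y)) ^ u₀ := by
          refine pow_le_pow_left₀ (by positivity) ?_ _
          rw [div_mul_div_comm, div_le_iff₀ (by positivity)]
          have h1 : u * (#A * #B) ≤ u₀ := by
            refine le_trans ?_ hle
            have hA : (0 : ℝ) ≤ #A := by positivity
            have hB : (0 : ℝ) ≤ #B := by positivity
            rw [mul_assoc]
            gcongr <;> linarith
          calc Real.exp 1 * Fintype.card V * (#A * #B)
              ≤ u * (Fintype.card κ : ℝ) ^ 2 * Real.exp (-Y) * (#A * #B) := by gcongr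
            _ = Real.exp (-Y) * (u * (#A * #B) * (Fintype.card κ : ℝ) ^ 2) := by ring
            _ ≤ _ := by gcongr
      _ = Real.exp (-(Y * u₀)) := by rw [← Real.exp_nat_mul]; congr 1; ring
      _ ≤ Real.exp (-(Y * u * σ) * (#A + #B : ℕ)) := by
          rw [Real.exp_le_exp]
          have : u * σ * (#A + #B) ≤ u₀ := by
            refine le_trans ?_ hle
            have : (0 : ℝ) ≤ u * (#A * #B + σ * σ) := by positivity
            nlinarith
          push_cast
          nlinarith [mul_le_mul_of_nonneg_left this hY]
      _ = (Real.exp (-(Y * u * σ))) ^ (#A + #B) := by rw [← Real.exp_nat_mul]; congr 1; ring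
      _ ≤ β ^ (#A + #B) := by gcongr
      _ = _ := pow_add _ _ _

lemma pr_not_codegreeBound_le (v₀ : κ) (C : ℕ) :
    pr (fun g : Sym2 V → κ => ¬ CodegreeBound (edgeGraph v₀ g) C) ≤
      (Fintype.card V : ℝ) ^ 2 *
        ((Fintype.card V : ℝ) / (Fintype.card κ : ℝ) ^ 2) ^ (C + 1) := by
  have h1 : pr (fun g : Sym2 V → κ => ¬ CodegreeBound (edgeGraph v₀ g) C) ≤
      pr (fun g : Sym2 V → κ => ∃ p ∈ (univ : Finset (V × V)),
        C + 1 ≤ #(linkers (edgeGraph v₀ g) {p.1} {p.2})) := by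
    refine pr_mono fun g hg => ?_
    simp only [CodegreeBound] at hg
    push Not at hg
    obtain ⟨v, v', hne, h⟩ := hg
    refine ⟨(v, v'), mem_univ _, Nat.succ_le_of_lt (h.trans_le (card_le_card fun w hw => ?_))⟩
    obtain ⟨-, hw1, hw2⟩ := mem_filter.1 hw
    simp only [linkers, mem_filter, mem_univ, true_and, mem_singleton]
    exact ⟨hw1.1, hw2.1, v, rfl, v', rfl, hne, hw1, hw2⟩
  have h2 : ∀ p : V × V, pr (fun g : Sym2 V → κ =>
      C + 1 ≤ #(linkers (edgeGraph v₀ g) {p.1} {p.2})) ≤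
      ((Fintype.card V : ℝ) / (Fintype.card κ : ℝ) ^ 2) ^ (C + 1) := by
    intro p
    refine (pr_le_card_linkers v₀ {p.1} {p.2} (C + 1)).trans ?_
    rw [card_singleton, card_singleton, Nat.cast_one, one_mul, div_pow, div_pow, one_pow,
      mul_one_div]
    gcongr
    exact_mod_cast Nat.choose_le_pow _ _
  refine h1.trans ((pr_exists_le _ _).trans ((sum_le_card_nsmul _ _ _ fun p _ => h2 p).trans ?_))
  rw [card_univ, Fintype.card_prod, nsmul_eq_mul, Nat.cast_mul, ← sq]

end randomGraph

section randomGraph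
open scoped Classical
variable {V κ : Type*} [Fintype V] [Fintype κ]

omit [Fintype V] in
lemma card_le_two_mul_card_image_mk (S : Finset (V × V)) :
    #S ≤ 2 * #(S.image fun p => s(p.1, p.2)) := by
  refine card_le_mul_card_image _ 2 fun e he => ?_
  obtain ⟨⟨x, y⟩, -, rfl⟩ := mem_image.1 he
  refine (card_le_card (t := {(x, y), (y, x)}) ?_).trans card_le_two
  rintro ⟨a, b⟩ hab
  have := (mem_filter.1 hab).2
  simp only [Sym2.eq_iff] at this
  rcases this with ⟨rfl, rfl⟩ | ⟨rfl, rfl⟩ <;> simp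

variable [Nonempty κ]

lemma pr_not_heavyBound_le (v₀ : κ) (k : ℕ) {h C x β : ℝ} (hC : 0 ≤ C) (hx : 1 ≤ x)
    (hk : x * k ≤ Fintype.card κ * (h * Real.log x / 8))
    (hβ₁ : Real.exp (-(C * Real.log x / 4)) ≤ β) (hβ₂ : Real.exp (-(h * Real.log x / 8)) ≤ β)
    (hβm : β * Fintype.card V ≤ 1) :
    pr (fun g : Sym2 V → κ => ¬ HeavyBound (edgeGraph v₀ g) k h C) ≤
      6 * (β * Fintype.card V) := by
  have hβ0 : 0 < β := (Real.exp_pos _).trans_le hβ₁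
  have hq : (0 : ℝ) < Fintype.card κ := by exact_mod_cast Fintype.card_pos
  have hlog : 0 ≤ Real.log x := Real.log_nonneg hx
  set E : Finset V → Finset V → Finset (Sym2 V) := fun A W =>
    (W ×ˢ A).image fun p => s(p.1, p.2) with hE
  refine le_trans (pr_mono fun g hg => ?_) (sum_exists_pair_le hβ0.le hβm
    (fun A W (g : Sym2 V → κ) => #A ≤ k ∧
      (C * #A + h * #W) / 4 ≤ #{e ∈ E A W | g e = v₀}) ?_)
  · simp only [HeavyBound] at hg
    push Not at hg
    obtain ⟨A, W, hA, hW, hlt⟩ := hg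
    refine ⟨A, W, ?_, hA, ?_⟩
    · rw [nonempty_iff_ne_empty]
      rintro rfl
      rw [sum_empty] at hlt
      exact absurd hlt (not_lt.2 (by positivity))
    · have h1 : ∑ w ∈ W, #{v ∈ A | (edgeGraph v₀ g).Adj w v} ≤ 2 * #{e ∈ E A W | g e = v₀} := by
        have h2 : ∑ w ∈ W, #{v ∈ A | (edgeGraph v₀ g).Adj w v} =
            #{p ∈ W ×ˢ A | (edgeGraph v₀ g).Adj p.1 p.2} := by
          rw [card_filter, sum_product]
          simp only [card_filter]
        rw [h2]
        refine (card_le_two_mul_card_image_mk _).trans (Nat.mul_le_mul_left _ (card_le_card ?_))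
        intro e he
        obtain ⟨p, hp, rfl⟩ := mem_image.1 he
        obtain ⟨hp1, hp2⟩ := mem_filter.1 hp
        exact mem_filter.2 ⟨mem_image_of_mem _ hp1, hp2.2⟩
      have h1' : ∑ w ∈ W, (#{v ∈ A | (edgeGraph v₀ g).Adj w v} : ℝ) ≤
          2 * #{e ∈ E A W | g e = v₀} := by exact_mod_cast h1
      have h3 : h * #W ≤ ∑ w ∈ W, (#{v ∈ A | (edgeGraph v₀ g).Adj w v} : ℝ) := by
        have := sum_le_sum hW
        rw [sum_const, nsmul_eq_mul] at this
        linarith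
      linarith
  · intro A W _
    by_cases hA : #A ≤ k
    swap
    · have : pr (fun g : Sym2 V → κ => #A ≤ k ∧
          (C * #A + h * #W) / 4 ≤ #{e ∈ E A W | g e = v₀}) = 0 := by
        simp [pr, avg, hA]
      rw [this]; positivity
    refine (pr_mono fun g hg => hg.2).trans ((pr_upper_tail (E A W) v₀ hx).trans ?_)
    have hcard : (#(E A W) : ℝ) ≤ #W * k := by
      have : #(E A W) ≤ #W * k :=
        card_image_le.trans ((card_product _ _).le.trans (Nat.mul_le_mul_left _ hA))
      exact_mod_cast this
    calc Real.exp ((x - 1) * #(E A W) / Fintype.card κ - (C * #A + h * #W) / 4 * Real.log x)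
        ≤ Real.exp (#A * (-(C * Real.log x / 4)) + #W * (-(h * Real.log x / 8))) := by
          rw [Real.exp_le_exp]
          have h1 : (x - 1) * #(E A W) / Fintype.card κ ≤ #W * (h * Real.log x / 8) := by
            rw [div_le_iff₀ hq]
            calc (x - 1) * #(E A W) ≤ x * (#W * k) := by
                  gcongr; linarith
              _ = #W * (x * k) := by ring
              _ ≤ #W * (Fintype.card κ * (h * Real.log x / 8)) := by gcongr
              _ = _ := by ring
          linarith
      _ = Real.exp (-(C * Real.log x / 4)) ^ #A * Real.exp (-(h * Real.log x / 8)) ^ #W := by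
          rw [Real.exp_add, ← Real.exp_nat_mul, ← Real.exp_nat_mul]
      _ ≤ _ := by gcongr

lemma pr_exists_lt_degree_le (v₀ : κ) {x D : ℝ} (hx : 1 ≤ x) :
    pr (fun g : Sym2 V → κ => ∃ w, D < #{v | (edgeGraph v₀ g).Adj w v}) ≤
      Fintype.card V * Real.exp ((x - 1) * Fintype.card V / Fintype.card κ - D * Real.log x) := by
  have hq : (0 : ℝ) < Fintype.card κ := by exact_mod_cast Fintype.card_pos
  set E : V → Finset (Sym2 V) := fun w => univ.image fun v => s(w, v) with hE
  have h1 : pr (fun g : Sym2 V → κ => ∃ w, D < #{v | (edgeGraph v₀ g).Adj w v}) ≤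
      pr (fun g : Sym2 V → κ => ∃ w ∈ (univ : Finset V), D ≤ #{e ∈ E w | g e = v₀}) := by
    refine pr_mono fun g ⟨w, hw⟩ => ⟨w, mem_univ _, hw.le.trans ?_⟩
    rw [← card_image_of_injective (f := fun v => s(w, v)) _ fun a b => Sym2.congr_right.1]
    refine Nat.cast_le.2 (card_le_card fun e he => ?_)
    obtain ⟨v, hv, rfl⟩ := mem_image.1 he
    exact mem_filter.2 ⟨mem_image_of_mem _ (mem_univ _), (mem_filter.1 hv).2.2⟩
  refine h1.trans ((pr_exists_le _ _).trans ((sum_le_card_nsmul _ _ _ fun w _ =>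
    (pr_upper_tail (E w) v₀ hx).trans ?_).trans (nsmul_eq_mul _ _).le))
  have : (#(E w) : ℝ) ≤ Fintype.card V := by exact_mod_cast card_image_le
  have hx' : 0 ≤ x - 1 := by linarith
  gcongr

lemma pr_exists_lt_fiber_le {ι : Type*} [Fintype ι] [Nonempty V] {x F : ℝ} (hx : 1 ≤ x) :
    pr (fun b : ι → V => ∃ v, F < #{i | b i = v}) ≤
      Fintype.card V * Real.exp ((x - 1) * Fintype.card ι / Fintype.card V - F * Real.log x) := by
  have h1 : pr (fun b : ι → V => ∃ v, F < #{i | b i = v}) ≤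
      pr (fun b : ι → V => ∃ v ∈ (univ : Finset V), F ≤ #{i | b i = v}) :=
    pr_mono fun g ⟨w, hw⟩ => ⟨w, mem_univ _, hw.le⟩
  refine h1.trans ((pr_exists_le _ _).trans ((sum_le_card_nsmul _ _ _ fun w _ =>
    (pr_upper_tail univ w hx)).trans (nsmul_eq_mul _ _).le))

/-- The edges inside `S` that lie in a triangle of `H`. -/
noncomputable def triEdges (H : SimpleGraph V) (S : Finset V) : Finset (Sym2 V) :=
  {e | ∃ x ∈ S, ∃ y ∈ S, ∃ w, e = s(x, y) ∧ H.Adj x y ∧ H.Adj w x ∧ H.Adj w y}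

/-- Sets of size at most `k` span at most `J` edges lying in triangles. -/
def TriBound (H : SimpleGraph V) (k J : ℕ) : Prop :=
  ∀ S : Finset V, #S ≤ k → #(triEdges H S) ≤ J

/-- The three pairs of a triple. -/
noncomputable def sides (p : V × V × V) : Finset (Sym2 V) := {s(p.1, p.2.1), s(p.2.2, p.1), s(p.2.2, p.2.1)}

omit [Nonempty κ] in
lemma card_triangle_nbrs_le {H : SimpleGraph V} {C : ℕ} (hC : CodegreeBound H C) (f : Sym2 V) :
    #{e | ∃ p : V × V × V, (∀ d ∈ sides p, d ∈ H.edgeSet) ∧ e ∈ sides p ∧ f ∈ sides p} ≤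
      1 + 2 * C := by
  induction f with
  | _ a b =>
  by_cases hab : a = b
  · refine (card_eq_zero.2 ?_).trans_le (Nat.zero_le _)
    rw [filter_eq_empty_iff]
    rintro e - ⟨p, hp, -, hf⟩
    have := hp _ hf
    rw [hab] at this
    exact H.loopless.irrefl b this
  set N : Finset V := {w | H.Adj w a ∧ H.Adj w b} with hN
  have hNC : #N ≤ C := hC a b hab
  have hsub : ({e | ∃ p : V × V × V, (∀ d ∈ sides p, d ∈ H.edgeSet) ∧ e ∈ sides p ∧
      s(a, b) ∈ sides p} : Finset (Sym2 V)) ⊆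
      {s(a, b)} ∪ (N.image (fun w => s(w, a)) ∪ N.image fun w => s(w, b)) := by
    intro e he
    obtain ⟨⟨x, y, w⟩, hp, hep, hfp⟩ := (mem_filter.1 he).2
    simp only [sides, mem_insert, mem_singleton] at hp hep hfp
    have h1 : H.Adj x y := hp _ (Or.inl rfl)
    have h2 : H.Adj w x := hp _ (Or.inr (Or.inl rfl))
    have h3 : H.Adj w y := hp _ (Or.inr (Or.inr rfl))
    have key : ∃ z, H.Adj z a ∧ H.Adj z b ∧ (e = s(a, b) ∨ e = s(z, a) ∨ e = s(z, b)) := by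
      simp only [Sym2.eq_iff] at hfp
      rcases hfp with (⟨rfl, rfl⟩ | ⟨rfl, rfl⟩) | (⟨rfl, rfl⟩ | ⟨rfl, rfl⟩) |
        (⟨rfl, rfl⟩ | ⟨rfl, rfl⟩)
      · exact ⟨w, h2, h3, hep⟩
      · exact ⟨w, h3, h2, by rw [Sym2.eq_swap (a := a)]; tauto⟩
      · exact ⟨y, h3.symm, h1.symm, by
          rw [Sym2.eq_swap (a := y) (b := b), Sym2.eq_swap (a := y) (b := a)]; tauto⟩
      · exact ⟨y, h1.symm, h3.symm, by
          rw [Sym2.eq_swap (a := y) (b := b), Sym2.eq_swap (a := y) (b := a),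
            Sym2.eq_swap (a := a) (b := b)]; tauto⟩
      · exact ⟨x, h2.symm, h1, by
          rw [Sym2.eq_swap (a := x) (b := a)]; tauto⟩
      · exact ⟨x, h1, h2.symm, by
          rw [Sym2.eq_swap (a := x) (b := b), Sym2.eq_swap (a := a) (b := b)]; tauto⟩
    obtain ⟨z, hza, hzb, hz⟩ := key
    have hzN : z ∈ N := mem_filter.2 ⟨mem_univ _, hza, hzb⟩
    simp only [mem_union, mem_singleton, mem_image]
    rcases hz with h | h | h
    · exact Or.inl h
    · exact Or.inr (Or.inl ⟨z, hzN, h.symm⟩)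
    · exact Or.inr (Or.inr ⟨z, hzN, h.symm⟩)
  refine (card_le_card hsub).trans ((card_union_le _ _).trans ?_)
  rw [card_singleton]
  have := card_union_le (N.image (fun w => s(w, a))) (N.image fun w => s(w, b))
  have h1 : #(N.image fun w => s(w, a)) ≤ C := card_image_le.trans hNC
  have h2 : #(N.image fun w => s(w, b)) ≤ C := card_image_le.trans hNC
  omega

/-- A family of triples from `S` with pairwise disjoint sides, all of them edges of `H`. -/
def IsPacking (H : SimpleGraph V) (S : Finset V) (P : Finset (V × V × V)) : Prop :=
  P ⊆ S ×ˢ S ×ˢ univ ∧ (P : Set (V × V × V)).PairwiseDisjoint sides ∧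
    ∀ p ∈ P, ∀ d ∈ sides p, d ∈ H.edgeSet

omit [Nonempty κ] in
lemma exists_packing {H : SimpleGraph V} {C : ℕ} (hC : CodegreeBound H C) (S : Finset V) :
    ∃ P, IsPacking H S P ∧ #(triEdges H S) ≤ #P * (3 * (1 + 2 * C)) := by
  have hne : ({P | IsPacking H S P} : Finset (Finset (V × V × V))).Nonempty :=
    ⟨∅, mem_filter.2 ⟨mem_univ _, by simp [IsPacking]⟩⟩
  obtain ⟨P, hP, hmax⟩ := exists_max_image _ card hne
  have hPk : IsPacking H S P := (mem_filter.1 hP).2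
  refine ⟨P, hPk, ?_⟩
  have hsub : triEdges H S ⊆ P.biUnion fun p' => (sides p').biUnion fun f =>
      {e | ∃ p : V × V × V, (∀ d ∈ sides p, d ∈ H.edgeSet) ∧ e ∈ sides p ∧ f ∈ sides p} := by
    intro e he
    obtain ⟨x, hx, y, hy, w, rfl, h1, h2, h3⟩ := (mem_filter.1 he).2
    have hside : ∀ d ∈ sides (x, y, w), d ∈ H.edgeSet := by
      intro d hd
      simp only [sides, mem_insert, mem_singleton] at hd
      rcases hd with rfl | rfl | rfl
      · exact h1
      · exact h2
      · exact h3
    have hex : ∃ p' ∈ P, ¬ Disjoint (sides (x, y, w)) (sides p') := by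
      by_contra! hdis
      have hnot : (x, y, w) ∉ P := by
        intro hmem
        have := hdis _ hmem
        rw [disjoint_self] at this
        simp [sides] at this
      have hpack : IsPacking H S (insert (x, y, w) P) := by
        refine ⟨?_, ?_, ?_⟩
        · refine insert_subset ?_ hPk.1
          simp [hx, hy]
        · rw [coe_insert]
          exact hPk.2.1.insert fun p hp _ => hdis p hp
        · intro p hp
          rcases mem_insert.1 hp with rfl | hp
          · exact hside
          · exact hPk.2.2 p hp
      have := hmax _ (mem_filter.2 ⟨mem_univ _, hpack⟩)
      rw [card_insert_of_notMem hnot] at this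
      omega
    obtain ⟨p', hp', hdis⟩ := hex
    obtain ⟨f, hf, hf'⟩ := not_disjoint_iff.1 hdis
    refine mem_biUnion.2 ⟨p', hp', mem_biUnion.2 ⟨f, hf', mem_filter.2 ⟨mem_univ _, _, hside, ?_, hf⟩⟩⟩
    simp [sides]
  refine (card_le_card hsub).trans (card_biUnion_le_card_mul _ _ _ fun p' _ => ?_)
  refine (card_biUnion_le_card_mul _ _ _ fun f _ => card_triangle_nbrs_le hC f).trans ?_
  exact Nat.mul_le_mul_right _ card_le_three

lemma pr_exists_packing_le (v₀ : κ) (S : Finset V) (t : ℕ) :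
    pr (fun g : Sym2 V → κ => ∃ P, IsPacking (edgeGraph v₀ g) S P ∧ t ≤ #P) ≤
      (Real.exp 1 * (#S ^ 2 * Fintype.card V : ℕ) / t * (1 / (Fintype.card κ : ℝ)) ^ 3) ^ t := by
  set T : Finset (Finset (V × V × V)) := {P ∈ powersetCard t (S ×ˢ S ×ˢ univ) |
    (P : Set (V × V × V)).PairwiseDisjoint sides ∧ ∀ p ∈ P, #(sides p) = 3} with hT
  have h1 : pr (fun g : Sym2 V → κ => ∃ P, IsPacking (edgeGraph v₀ g) S P ∧ t ≤ #P) ≤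
      pr (fun g : Sym2 V → κ => ∃ P ∈ T, ∀ e ∈ P.biUnion sides, g e = v₀) := by
    refine pr_mono fun g ⟨P, ⟨hP1, hP2, hP3⟩, hPt⟩ => ?_
    obtain ⟨Q, hQP, hQ⟩ := exists_subset_card_eq hPt
    refine ⟨Q, mem_filter.2 ⟨mem_powersetCard.2 ⟨hQP.trans hP1, hQ⟩,
      hP2.subset (coe_subset.2 hQP), ?_⟩, ?_⟩
    · rintro ⟨x, y, w⟩ hp
      have h := hP3 _ (hQP hp)
      simp only [sides, mem_insert, mem_singleton, forall_eq_or_imp, forall_eq,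
        SimpleGraph.mem_edgeSet] at h
      have hxy := h.1.ne
      have hwx := h.2.1.ne
      have hwy := h.2.2.ne
      simp only [sides]
      rw [card_eq_three]
      refine ⟨_, _, _, ?_, ?_, ?_, rfl⟩
      all_goals
        simp only [ne_eq, Sym2.eq_iff]
        tauto
    · intro e he
      obtain ⟨p, hp, hep⟩ := mem_biUnion.1 he
      have h := hP3 p (hQP hp) e hep
      induction e with
      | _ x y => exact h.2
  refine h1.trans ((pr_exists_le _ _).trans ?_)
  have h2 : ∀ P ∈ T, pr (fun g : Sym2 V → κ => ∀ e ∈ P.biUnion sides, g e = v₀) =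
      ((1 / (Fintype.card κ : ℝ)) ^ 3) ^ t := by
    intro P hP
    obtain ⟨hP1, hP2, hP3⟩ := mem_filter.1 hP
    rw [pr_forall_eq, card_biUnion hP2, sum_congr rfl hP3, sum_const, (mem_powersetCard.1 hP1).2,
      smul_eq_mul, mul_comm, pow_mul]
  rw [sum_congr rfl h2, sum_const, nsmul_eq_mul, mul_pow]
  gcongr
  refine le_trans ?_ (choose_le_exp_mul_div_pow _ _)
  rw [Nat.cast_le]
  refine (card_filter_le _ _).trans (le_of_eq ?_)
  rw [card_powersetCard, card_product, card_product, card_univ, sq, mul_assoc]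

lemma pr_codegreeBound_and_not_triBound_le (v₀ : κ) {k t C J : ℕ} (hkm : k ≤ Fintype.card V)
    (hJ : t * (3 * (1 + 2 * C)) ≤ J) :
    pr (fun g : Sym2 V → κ => CodegreeBound (edgeGraph v₀ g) C ∧
      ¬ TriBound (edgeGraph v₀ g) k J) ≤
      (Fintype.card V : ℝ) ^ k *
        (Real.exp 1 * (k ^ 2 * Fintype.card V : ℕ) / t * (1 / (Fintype.card κ : ℝ)) ^ 3) ^ t := by
  have h1 : pr (fun g : Sym2 V → κ => CodegreeBound (edgeGraph v₀ g) C ∧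
      ¬ TriBound (edgeGraph v₀ g) k J) ≤
      pr (fun g : Sym2 V → κ => ∃ S ∈ powersetCard k (univ : Finset V),
        ∃ P, IsPacking (edgeGraph v₀ g) S P ∧ t ≤ #P) := by
    refine pr_mono fun g ⟨hC, hT⟩ => ?_
    simp only [TriBound] at hT
    push Not at hT
    obtain ⟨S, hS, hlt⟩ := hT
    obtain ⟨S', hSS', hS'⟩ := exists_superset_card_eq hS hkm
    refine ⟨S', by simp [hS'], ?_⟩
    obtain ⟨P, hP, hPc⟩ := exists_packing hC S'
    refine ⟨P, hP, ?_⟩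
    by_contra! hPt
    have h2 : #(triEdges (edgeGraph v₀ g) S) ≤ #(triEdges (edgeGraph v₀ g) S') := by
      refine card_le_card fun e he => ?_
      obtain ⟨x, hx, y, hy, h⟩ := (mem_filter.1 he).2
      exact mem_filter.2 ⟨mem_univ _, x, hSS' hx, y, hSS' hy, h⟩
    have h3 : #P * (3 * (1 + 2 * C)) ≤ t * (3 * (1 + 2 * C)) := Nat.mul_le_mul_right _ hPt.le
    omega
  refine h1.trans ((pr_exists_le _ _).trans ((sum_le_card_nsmul _ _ _ fun S hS =>
    (?_ : _ ≤ (Real.exp 1 * (k ^ 2 * Fintype.card V : ℕ) / t *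
      (1 / (Fintype.card κ : ℝ)) ^ 3) ^ t)).trans ?_))
  · rw [← (mem_powersetCard.1 hS).2]
    exact pr_exists_packing_le v₀ S t
  · rw [card_powersetCard, card_univ, nsmul_eq_mul]
    gcongr
    exact_mod_cast Nat.choose_le_pow _ _

end randomGraph

section twoBites
open scoped Classical
variable {ι V : Type*} [Fintype ι] [Fintype V]

/-- The union of the pullbacks of a red and a blue graph, without the pairs having a common
neighbour of either colour. -/
def biteGraph (HR HB : SimpleGraph V) (r b : ι → V) : SimpleGraph ι where
  Adj i j := (HR.Adj (r i) (r j) ∨ HB.Adj (b i) (b j)) ∧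
    (¬ ∃ w, HR.Adj w (r i) ∧ HR.Adj w (r j)) ∧ ¬ ∃ w, HB.Adj w (b i) ∧ HB.Adj w (b j)
  symm := ⟨fun _ _ h => ⟨h.1.imp SimpleGraph.Adj.symm SimpleGraph.Adj.symm,
    fun ⟨w, h1, h2⟩ => h.2.1 ⟨w, h2, h1⟩, fun ⟨w, h1, h2⟩ => h.2.2 ⟨w, h2, h1⟩⟩⟩
  loopless := ⟨fun _ h => h.1.elim (HR.loopless.irrefl _) (HB.loopless.irrefl _)⟩

omit [Fintype ι] [Fintype V] in
lemma biteGraph_cliqueFree (HR HB : SimpleGraph V) (r b : ι → V) :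
    (biteGraph HR HB r b).CliqueFree 3 := by
  intro s hs
  obtain ⟨i, j, l, h1, h2, h3, -⟩ := SimpleGraph.is3Clique_iff.1 hs
  obtain ⟨a1, a2, a3⟩ := h1
  obtain ⟨b1, b2, b3⟩ := h2
  obtain ⟨c1, c2, c3⟩ := h3
  rcases a1 with a1 | a1 <;> rcases b1 with b1 | b1
  · exact c2 ⟨r i, a1, b1⟩
  · rcases c1 with c1 | c1
    · exact b2 ⟨r j, a1.symm, c1⟩
    · exact a3 ⟨b l, b1.symm, c1.symm⟩
  · rcases c1 with c1 | c1
    · exact a2 ⟨r l, b1.symm, c1.symm⟩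
    · exact b3 ⟨b j, a1.symm, c1⟩
  · exact c3 ⟨b i, a1, b1⟩

/-- Every colour class of `c` in `I` has at most `z` elements and at most `D` images under `b`. -/
def ClassBound {L : ℕ} (b : ι → V) (I : Finset ι) (z D : ℕ) (c : ι → Option (Fin L)) : Prop :=
  ∀ l, #{i ∈ I | c i = some l} ≤ z ∧ #(({i ∈ I | c i = some l} : Finset ι).image b) ≤ D

/-- Every set of `k` indices has a colouring with small classes and few closed pairs. -/
def Colourable (H : SimpleGraph V) (b : ι → V) (k L z D M : ℕ) : Prop :=
  ∀ I : Finset ι, #I = k → ∃ c : ι → Option (Fin L),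
    ClassBound b I z D c ∧ #(closedPairs H b I c) ≤ M

lemma colourable_of_bounds {H : SimpleGraph V} {b : ι → V} {k F C L D M : ℕ} {h C₁ u σ t : ℝ}
    (hh : 0 ≤ h) (hC₁ : 0 ≤ C₁) (hu : 0 ≤ u) (hσ : 0 ≤ σ) (ht : 0 ≤ t)
    (hF : ∀ v, #{i | b i = v} ≤ F) (hD : ∀ w, #{v | H.Adj w v} ≤ D)
    (hC : CodegreeBound H C) (hheavy : HeavyBound H k h C₁) (hlink : LinkBound H k u σ)
    (hL : (k : ℝ) + L ^ 2 * (C * F) < L * t)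
    (hM : 2 * (t * C₁ * k) + h ^ 2 * (2 * F * k + u * (k + F * σ) ^ 2) + k * F +
      2 * (L ^ 2 * (C * F) * k) ≤ M) :
    Colourable H b k L (D * F) D M := by
  intro I hI
  obtain ⟨c, hc, hcl⟩ := exists_colouring hC hF I hI.le hL
  refine ⟨c, fun l => ?_, ?_⟩
  · rcases hc l with hl | ⟨w, hw⟩
    · have : ({i ∈ I | c i = some l} : Finset ι) = ∅ := filter_eq_empty_iff.2 hl
      simp [this]
    · have himg : ({i ∈ I | c i = some l} : Finset ι).image b ⊆ ({v | H.Adj w v} : Finset V) := by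
        intro v hv
        obtain ⟨i, hi, rfl⟩ := mem_image.1 hv
        obtain ⟨hi1, hi2⟩ := mem_filter.1 hi
        exact mem_filter.2 ⟨mem_univ _, hw i hi1 hi2⟩
      have h2 := (card_le_card himg).trans (hD w)
      refine ⟨?_, h2⟩
      refine (card_le_mul_card_image (f := b) _ F fun v _ => (card_le_card ?_).trans (hF v)).trans ?_
      · intro i hi
        exact mem_filter.2 ⟨mem_univ _, (mem_filter.1 hi).2⟩
      · rw [mul_comm]
        exact Nat.mul_le_mul_right _ h2
  · have h1 := card_lightPairs_le H b I hI.le hF hh hC₁ hu hσ ht hheavy hlink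
    have h2 : (#(closedPairs H b I c) : ℝ) ≤
        #(lightPairs H b I t) + k * F + 2 * (L ^ 2 * (C * F) * k) := by exact_mod_cast hcl
    have h3 : (#(closedPairs H b I c) : ℝ) ≤ M := by linarith
    exact_mod_cast h3

/-- A colouring of `I` with few closed pairs, whenever there is one. -/
noncomputable def goodColouring (L z D M : ℕ) (H : SimpleGraph V) (b : ι → V) (I : Finset ι) :
    ι → Option (Fin L) :=
  if h : ∃ c : ι → Option (Fin L), ClassBound b I z D c ∧ #(closedPairs H b I c) ≤ M
  then h.choose else fun _ => none

lemma goodColouring_spec {L z D M k : ℕ} {H : SimpleGraph V} {b : ι → V}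
    (h : Colourable H b k L z D M) {I : Finset ι} (hI : #I = k) :
    ClassBound b I z D (goodColouring L z D M H b I) ∧
      #(closedPairs H b I (goodColouring L z D M H b I)) ≤ M := by
  have := h I hI
  rw [goodColouring, dif_pos this]
  exact this.choose_spec

/-- The images under `r` of a set of pairs of indices. -/
noncomputable def imagePairs (r : ι → V) (X : Finset (ι × ι)) : Finset (Sym2 V) :=
  X.image fun p => s(r p.1, r p.2)

/-- The pairs of `I` that are not monochromatic and have distinct images under `r`. -/
noncomputable def openPairs {L : ℕ} (r : ι → V) (I : Finset ι) (c : ι → Option (Fin L)) :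
    Finset (ι × ι) :=
  {p ∈ I ×ˢ I | r p.1 ≠ r p.2 ∧ ¬ SameColour c p.1 p.2}

omit [Fintype ι] [Fintype V] in
lemma sq_card_image_le {L : ℕ} (r : ι → V) (I : Finset ι) (c : ι → Option (Fin L)) :
    #(I.image r) ^ 2 ≤ #(I.image r) + ∑ l, #{i ∈ I | c i = some l} ^ 2 +
      2 * #(imagePairs r (openPairs r I c)) := by
  obtain ⟨T, hTI, hTinj, hT⟩ : ∃ T ⊆ I, Set.InjOn r T ∧ T.image r = I.image r := by
    obtain ⟨T, hT1, hT2, hT3⟩ := Finset.exists_subset_injOn_image_eq_of_surjOn (s := I)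
      (t := I.image r) (f := r) (by intro y hy; simpa using hy)
    exact ⟨T, hT1, hT2, hT3⟩
  have hcard : #T = #(I.image r) := by rw [← hT, card_image_of_injOn hTinj]
  set X : Finset (ι × ι) := {p ∈ T.offDiag | ¬ SameColour c p.1 p.2} with hX
  have h1 : #T.offDiag ≤ #X + ∑ l, #{i ∈ I | c i = some l} ^ 2 := by
    rw [← card_filter_add_card_filter_not (s := T.offDiag)
      (fun p => ¬ SameColour c p.1 p.2)]
    refine Nat.add_le_add_left ?_ _
    have : ({p ∈ T.offDiag | ¬ ¬ SameColour c p.1 p.2} : Finset (ι × ι)) ⊆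
        univ.biUnion fun l => ({i ∈ I | c i = some l} : Finset ι) ×ˢ
          ({i ∈ I | c i = some l} : Finset ι) := by
      rintro ⟨i, j⟩ hp
      obtain ⟨hp1, hp2⟩ := mem_filter.1 hp
      obtain ⟨hi, hj, -⟩ := mem_offDiag.1 hp1
      obtain ⟨hc, hn⟩ := not_not.1 hp2
      obtain ⟨l, hl⟩ := Option.ne_none_iff_exists'.1 hn
      simp only [mem_biUnion, mem_univ, true_and, mem_product, mem_filter]
      exact ⟨l, ⟨hTI hi, hl⟩, hTI hj, hc ▸ hl⟩
    refine (card_le_card this).trans (card_biUnion_le.trans (le_of_eq ?_))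
    simp [sq]
  have h2 : #X ≤ 2 * #(imagePairs r (openPairs r I c)) := by
    have hinj : Set.InjOn (fun p : ι × ι => (r p.1, r p.2)) X := by
      rintro ⟨i, j⟩ hp ⟨i', j'⟩ hp' heq
      have a1 := mem_offDiag.1 (mem_filter.1 hp).1
      have a2 := mem_offDiag.1 (mem_filter.1 hp').1
      simp only [Prod.mk.injEq] at heq
      exact Prod.ext (hTinj a1.1 a2.1 heq.1) (hTinj a1.2.1 a2.2.1 heq.2)
    rw [← card_image_of_injOn hinj]
    refine (card_le_two_mul_card_image_mk _).trans (Nat.mul_le_mul_left _ (card_le_card ?_))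
    rw [image_image]
    refine image_subset_image fun p hp => ?_
    obtain ⟨hp1, hp2⟩ := mem_filter.1 hp
    obtain ⟨hi, hj, hne⟩ := mem_offDiag.1 hp1
    exact mem_filter.2 ⟨mem_product.2 ⟨hTI hi, hTI hj⟩, fun h => hne (hTinj hi hj h), hp2⟩
  rw [offDiag_card, hcard] at h1
  have := Nat.le_mul_self #(I.image r)
  rw [sq]
  omega

omit [Fintype ι] [Fintype V] in
lemma card_image_add_sum_le {L z D : ℕ} {b : ι → V} {I : Finset ι} {c : ι → Option (Fin L)}
    (hc : ClassBound b I z D c) :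
    #(I.image b) + ∑ l, #{i ∈ I | c i = some l} ≤ #I + L * D := by
  have h1 : I = ({i ∈ I | c i = none} : Finset ι) ∪
      univ.biUnion fun l => ({i ∈ I | c i = some l} : Finset ι) := by
    ext i
    simp only [mem_union, mem_filter, mem_biUnion, mem_univ, true_and]
    rcases c i with _ | l <;> simp
  have h2 : #(I.image b) ≤ #{i ∈ I | c i = none} + L * D := by
    conv_lhs => rw [h1]
    rw [image_union, biUnion_image]
    refine (card_union_le _ _).trans (Nat.add_le_add card_image_le ?_)
    refine (card_biUnion_le_card_mul _ _ D fun l _ => (hc l).2).trans ?_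
    simp
  have h3 : #I = #{i ∈ I | c i = none} + ∑ l, #{i ∈ I | c i = some l} := by
    rw [card_eq_sum_card_fiberwise (f := c) (t := univ) (by simp), Fintype.sum_option]
  omega

omit [Fintype ι] in
/-- The red edges of `openPairs` inside an independent set all lie in triangles or are closed
in blue. -/
lemma card_filter_imagePairs_le {κ : Type*} {HR HB : SimpleGraph V} {r b : ι → V}
    {k J₃ J₄ L : ℕ} {I : Finset ι} {c : ι → Option (Fin L)} {v₀ : κ} {g : Sym2 V → κ}
    (hHR : HR = edgeGraph v₀ g) (hI : #I = k)
    (hclosed : ∀ i ∈ I, ∀ j ∈ I, HR.Adj (r i) (r j) →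
      (∃ w, HR.Adj w (r i) ∧ HR.Adj w (r j)) ∨ ∃ w, HB.Adj w (b i) ∧ HB.Adj w (b j))
    (htri : TriBound HR k J₃)
    (hJ : #{e ∈ imagePairs r (closedPairs HB b I c) | g e = v₀} ≤ J₄) :
    #{e ∈ imagePairs r (openPairs r I c) | g e = v₀} ≤ J₃ + J₄ := by
  have hsub : ({e ∈ imagePairs r (openPairs r I c) | g e = v₀} : Finset (Sym2 V)) ⊆
      triEdges HR (I.image r) ∪ {e ∈ imagePairs r (closedPairs HB b I c) | g e = v₀} := by
    intro e he
    obtain ⟨he1, he2⟩ := mem_filter.1 he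
    obtain ⟨⟨i, j⟩, hp, rfl⟩ := mem_image.1 he1
    obtain ⟨hp1, hne, hcol⟩ := mem_filter.1 hp
    obtain ⟨hi, hj⟩ := mem_product.1 hp1
    have hadj : HR.Adj (r i) (r j) := by rw [hHR]; exact ⟨hne, he2⟩
    rcases hclosed i hi j hj hadj with ⟨w, hw1, hw2⟩ | hw
    · exact mem_union_left _ (mem_filter.2 ⟨mem_univ _, r i, mem_image_of_mem _ hi, r j,
        mem_image_of_mem _ hj, w, rfl, hadj, hw1, hw2⟩)
    · exact mem_union_right _ (mem_filter.2 ⟨mem_image_of_mem _ (mem_filter.2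
        ⟨mem_product.2 ⟨hi, hj⟩, hcol, Or.inr hw⟩), he2⟩)
  refine (card_le_card hsub).trans ((card_union_le _ _).trans (Nat.add_le_add ?_ hJ))
  exact htri _ (card_image_le.trans hI.le)

end twoBites

section avg
variable {Ω Ω' : Type*} [Fintype Ω] [Fintype Ω']

lemma pr_swap (A : Ω × Ω' → Prop) : pr A = pr fun p : Ω' × Ω => A p.swap := by
  unfold pr avg
  congr 1
  · exact (Fintype.sum_equiv (Equiv.prodComm Ω' Ω) _ _ fun _ => rfl).symm
  · simp [mul_comm]

lemma pr_and_le {A : Ω → Prop} {E : Ω × Ω' → Prop} {c : ℝ}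
    (h : ∀ ω, A ω → pr (fun ω' => E (ω, ω')) ≤ c) :
    pr (fun p : Ω × Ω' => A p.1 ∧ E p) ≤ pr A * c := by
  classical
  unfold pr
  rw [avg_prod, ← avg_mul_const]
  refine avg_mono fun ω => ?_
  by_cases hA : A ω
  · simpa [hA, pr] using h ω hA
  · simp [hA, avg]

end avg

section twoBites
open scoped Classical
variable {ι V κ : Type*} [Fintype ι] [Fintype V] [Fintype κ]

lemma pr_exists_imagePairs_le [Nonempty κ] (v₀ : κ) (r : ι → V)
    (X : Finset ι → Finset (ι × ι)) (k M : ℕ) {x J : ℝ} (hx : 1 ≤ x) :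
    pr (fun g : Sym2 V → κ => ∃ I, #I = k ∧ #(X I) ≤ M ∧
      J < #{e ∈ imagePairs r (X I) | g e = v₀}) ≤
      (Fintype.card ι).choose k * Real.exp (x * M / Fintype.card κ - J * Real.log x) := by
  have h1 : pr (fun g : Sym2 V → κ => ∃ I, #I = k ∧ #(X I) ≤ M ∧
      J < #{e ∈ imagePairs r (X I) | g e = v₀}) ≤
      pr (fun g : Sym2 V → κ => ∃ I ∈ powersetCard k (univ : Finset ι), #(X I) ≤ M ∧
      J ≤ #{e ∈ imagePairs r (X I) | g e = v₀}) :=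
    pr_mono fun g ⟨I, hI, h, hJ⟩ => ⟨I, by simp [hI], h, hJ.le⟩
  refine h1.trans ((pr_exists_le _ _).trans ((sum_le_card_nsmul _ _
    (Real.exp (x * M / Fintype.card κ - J * Real.log x)) fun I _ => ?_).trans ?_))
  · by_cases hM : #(X I) ≤ M
    · refine (pr_mono fun g h => h.2).trans ((pr_upper_tail _ v₀ hx).trans ?_)
      have h2 : (#(imagePairs r (X I)) : ℝ) ≤ M := by
        exact_mod_cast card_image_le.trans hM
      rw [Real.exp_le_exp]
      have h3 : (x - 1) * #(imagePairs r (X I)) ≤ x * M := by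
        have : (0 : ℝ) ≤ #(imagePairs r (X I)) := by positivity
        nlinarith
      gcongr
    · refine le_trans (le_of_eq ?_) (Real.exp_pos _).le
      simp [pr, avg, hM]
  · rw [card_powersetCard, card_univ, nsmul_eq_mul]

/-- The open pairs of `I` for some admissible colourings span few edges of both colours. -/
def Sparse (L z D : ℕ) (J : ℝ) (v₀ : κ) (I : Finset ι)
    (ω : ((ι → V) × (ι → V)) × ((Sym2 V → κ) × (Sym2 V → κ))) : Prop :=
  ∃ c c' : ι → Option (Fin L), ClassBound ω.1.2 I z D c ∧ ClassBound ω.1.1 I z D c' ∧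
    (#{e ∈ imagePairs ω.1.1 (openPairs ω.1.1 I c) | ω.2.1 e = v₀} : ℝ) ≤ J ∧
    (#{e ∈ imagePairs ω.1.2 (openPairs ω.1.2 I c') | ω.2.2 e = v₀} : ℝ) ≤ J

omit [Fintype ι] [Fintype V] in
lemma classBound_congr {L z D : ℕ} {b : ι → V} {I : Finset ι} {c c' : ι → Option (Fin L)}
    (h : ∀ i ∈ I, c i = c' i) (hc : ClassBound b I z D c) : ClassBound b I z D c' := by
  intro l
  have : ({i ∈ I | c i = some l} : Finset ι) = {i ∈ I | c' i = some l} :=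
    filter_congr fun i hi => by rw [h i hi]
  rw [← this]
  exact hc l

omit [Fintype ι] [Fintype V] in
lemma openPairs_congr {L : ℕ} {r : ι → V} {I : Finset ι} {c c' : ι → Option (Fin L)}
    (h : ∀ i ∈ I, c i = c' i) : openPairs r I c = openPairs r I c' := by
  refine filter_congr fun p hp => ?_
  obtain ⟨h1, h2⟩ := mem_product.1 hp
  rw [SameColour, SameColour, h _ h1, h _ h2]

/-- The colourings that are trivial outside `I`. -/
noncomputable def colourings (L : ℕ) (I : Finset ι) : Finset (ι → Option (Fin L)) :=
  Fintype.piFinset fun i => if i ∈ I then univ else {none}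

lemma card_colourings (L : ℕ) (I : Finset ι) : #(colourings L I) = (L + 1) ^ #I := by
  rw [colourings, Fintype.card_piFinset]
  have : ∀ i, #(if i ∈ I then (univ : Finset (Option (Fin L))) else {none}) =
      if i ∈ I then L + 1 else 1 := by
    intro i; split_ifs <;> simp
  rw [prod_congr rfl fun i _ => this i, prod_ite_mem, univ_inter, prod_const]

lemma exists_mem_colourings {L : ℕ} (I : Finset ι) (c : ι → Option (Fin L)) :
    ∃ c' ∈ colourings L I, ∀ i ∈ I, c i = c' i := by
  refine ⟨fun i => if i ∈ I then c i else none, Fintype.mem_piFinset.2 fun i => ?_, fun i hi => ?_⟩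
  · by_cases hi : i ∈ I <;> simp [hi]
  · simp [hi]

lemma pr_sparse_le [Nonempty κ] [Nonempty V] (v₀ : κ) {k L z D : ℕ} {J x B : ℝ} (hx0 : 0 < x)
    (hx1 : x ≤ 1) {I : Finset ι} (hI : #I = k)
    (hB : ∀ a y s s' Q Q' N N' : ℕ, a ≤ k → y ≤ k → y + s ≤ k + L * D → a + s' ≤ k + L * D →
      Q ≤ z * s → Q ≤ s ^ 2 → Q' ≤ z * s' → Q' ≤ s' ^ 2 →
      a ^ 2 ≤ a + Q + 2 * N → y ^ 2 ≤ y + Q' + 2 * N' →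
      Real.exp (2 * k) * ((k : ℝ) / Fintype.card V) ^ ((k - a) + (k - y)) * (L + 1) ^ (2 * k) *
        Real.exp (2 * J * Real.log x⁻¹ - (1 - x) * (N + N') / Fintype.card κ) ≤ B) :
    pr (Sparse (V := V) (κ := κ) L z D J v₀ I) ≤ (k + 1) ^ 2 * B := by
  set R : Finset (ℕ × ℕ) := range (k + 1) ×ˢ range (k + 1) with hR
  have h1 : pr (Sparse (V := V) (κ := κ) L z D J v₀ I) ≤
      pr (fun ω => ∃ p ∈ R, (#(I.image ω.1.1) = p.1 ∧ #(I.image ω.1.2) = p.2) ∧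
        Sparse (V := V) (κ := κ) L z D J v₀ I ω) := by
    refine pr_mono fun ω hω => ⟨(#(I.image ω.1.1), #(I.image ω.1.2)), ?_, ⟨rfl, rfl⟩, hω⟩
    simp only [hR, mem_product, mem_range, Nat.lt_succ_iff]
    exact ⟨card_image_le.trans hI.le, card_image_le.trans hI.le⟩
  refine h1.trans ((pr_exists_le _ _).trans ((sum_le_card_nsmul _ _ B fun p hp => ?_).trans ?_))
  swap
  · rw [hR, card_product, card_range, nsmul_eq_mul]
    push_cast
    rw [sq]
  obtain ⟨a, y⟩ := p
  simp only [hR, mem_product, mem_range, Nat.lt_succ_iff] at hp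
  obtain ⟨ha, hy⟩ := hp
  simp only
  set Z : ℝ := Real.exp (2 * k) * ((k : ℝ) / Fintype.card V) ^ ((k - a) + (k - y)) with hZ
  have hV : (0 : ℝ) < Fintype.card V := by exact_mod_cast Fintype.card_pos
  have hAB : pr (fun p : (ι → V) × (ι → V) => #(I.image p.1) = a ∧ #(I.image p.2) = y) ≤ Z := by
    rw [pr_and_prod (fun f : ι → V => #(I.image f) = a) (fun f : ι → V => #(I.image f) = y)]
    have e1 := pr_card_image_eq_le (V := V) I (hI.symm ▸ ha)
    have e2 := pr_card_image_eq_le (V := V) I (hI.symm ▸ hy)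
    rw [hI] at e1 e2
    calc _ ≤ _ := mul_le_mul e1 e2 (pr_nonneg _) (by positivity)
      _ = Z := by rw [hZ, pow_add, two_mul, Real.exp_add]; ring
  by_cases hne : ∃ (r b : ι → V) (c c' : ι → Option (Fin L)),
      (#(I.image r) = a ∧ #(I.image b) = y) ∧ ClassBound b I z D c ∧ ClassBound r I z D c'
  swap
  · have h0 : pr (fun ω : ((ι → V) × (ι → V)) × ((Sym2 V → κ) × (Sym2 V → κ)) =>
        (#(I.image ω.1.1) = a ∧ #(I.image ω.1.2) = y) ∧
        Sparse (V := V) (κ := κ) L z D J v₀ I ω) ≤ 0 := by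
      refine (pr_mono (B := fun _ => False) ?_).trans ?_
      · rintro ω ⟨h, c, c', hc, hc', -⟩
        exact hne ⟨ω.1.1, ω.1.2, c, c', h, hc, hc'⟩
      · simp [pr, avg]
    refine h0.trans (le_trans ?_ (hB 0 0 0 0 0 0 0 0 (by simp) (by simp) (by simp) (by simp)
      (by simp) (by simp) (by simp) (by simp) (by simp) (by simp)))
    positivity
  have key : ∀ (r b : ι → V) (c c' : ι → Option (Fin L)), #(I.image r) = a → #(I.image b) = y →
      ClassBound b I z D c → ClassBound r I z D c' →
      Z * (L + 1) ^ (2 * k) * pr (fun g : (Sym2 V → κ) × (Sym2 V → κ) =>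
        (#{e ∈ imagePairs r (openPairs r I c) | g.1 e = v₀} : ℝ) ≤ J ∧
        (#{e ∈ imagePairs b (openPairs b I c') | g.2 e = v₀} : ℝ) ≤ J) ≤ B := by
    intro r b c c' hr hb hc hc'
    have e1 := sq_card_image_le r I c
    have e2 := sq_card_image_le b I c'
    have e3 := card_image_add_sum_le hc
    have e4 := card_image_add_sum_le hc'
    rw [hr] at e1 e4
    rw [hb] at e2 e3
    rw [hI] at e3 e4
    have hQ1 : ∀ c'' : ι → Option (Fin L), (∀ l, #{i ∈ I | c'' i = some l} ≤ z) →
        ∑ l, #{i ∈ I | c'' i = some l} ^ 2 ≤ z * ∑ l, #{i ∈ I | c'' i = some l} := by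
      intro c'' h
      rw [mul_sum]
      refine sum_le_sum fun l _ => ?_
      rw [sq]; exact Nat.mul_le_mul_right _ (h l)
    have hQ2 : ∀ c'' : ι → Option (Fin L),
        ∑ l, #{i ∈ I | c'' i = some l} ^ 2 ≤ (∑ l, #{i ∈ I | c'' i = some l}) ^ 2 := by
      intro c''
      exact sum_sq_le_sq_sum_of_nonneg (fun l _ => Nat.zero_le _)
    refine le_trans ?_ (hB a y _ _ _ _ _ _ ha hy e3 e4 (hQ1 c fun l => (hc l).1) (hQ2 c)
      (hQ1 c' fun l => (hc' l).1) (hQ2 c') e1 e2)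
    refine mul_le_mul_of_nonneg_left ?_ (by positivity)
    rw [pr_and_prod (fun g : Sym2 V → κ =>
        (#{e ∈ imagePairs r (openPairs r I c) | g e = v₀} : ℝ) ≤ J)
      (fun g : Sym2 V → κ => (#{e ∈ imagePairs b (openPairs b I c') | g e = v₀} : ℝ) ≤ J)]
    have f1 := pr_lower_tail (imagePairs r (openPairs r I c)) v₀ (t := J) hx0 hx1
    have f2 := pr_lower_tail (imagePairs b (openPairs b I c')) v₀ (t := J) hx0 hx1
    refine (mul_le_mul f1 f2 (pr_nonneg _) (Real.exp_pos _).le).trans (le_of_eq ?_)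
    rw [← Real.exp_add]
    congr 1
    ring
  set W : ℝ := Z * (L + 1) ^ (2 * k) with hW
  have hk : (0 : ℝ) ≤ (k : ℝ) / Fintype.card V := by positivity
  have hB0 : 0 ≤ B := by
    obtain ⟨r, b, c, c', ⟨h1, h2⟩, h3, h4⟩ := hne
    refine le_trans ?_ (key r b c c' h1 h2 h3 h4)
    have := pr_nonneg (fun g : (Sym2 V → κ) × (Sym2 V → κ) =>
        (#{e ∈ imagePairs r (openPairs r I c) | g.1 e = v₀} : ℝ) ≤ J ∧
        (#{e ∈ imagePairs b (openPairs b I c') | g.2 e = v₀} : ℝ) ≤ J)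
    positivity
  rcases (show 0 ≤ Z by positivity).eq_or_lt with hZ0 | hZ0
  · refine (pr_mono (B := fun ω : ((ι → V) × (ι → V)) × ((Sym2 V → κ) × (Sym2 V → κ)) =>
      #(I.image ω.1.1) = a ∧ #(I.image ω.1.2) = y) fun ω h => h.1).trans ?_
    refine (pr_fst_le (fun p : (ι → V) × (ι → V) =>
      #(I.image p.1) = a ∧ #(I.image p.2) = y)).trans (hAB.trans ?_)
    rw [← hZ0]; exact hB0
  have hcond : ∀ p : (ι → V) × (ι → V), (#(I.image p.1) = a ∧ #(I.image p.2) = y) →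
      pr (fun g : (Sym2 V → κ) × (Sym2 V → κ) =>
        Sparse (V := V) (κ := κ) L z D J v₀ I (p, g)) ≤ B / Z := by
    rintro ⟨r, b⟩ ⟨hr, hb⟩
    simp only at hr hb
    set S : Finset ((ι → Option (Fin L)) × (ι → Option (Fin L))) :=
      colourings L I ×ˢ colourings L I with hS
    have g1 : pr (fun g : (Sym2 V → κ) × (Sym2 V → κ) =>
        Sparse (V := V) (κ := κ) L z D J v₀ I ((r, b), g)) ≤
        pr (fun g : (Sym2 V → κ) × (Sym2 V → κ) => ∃ p ∈ S,
          (ClassBound b I z D p.1 ∧ ClassBound r I z D p.2) ∧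
          (#{e ∈ imagePairs r (openPairs r I p.1) | g.1 e = v₀} : ℝ) ≤ J ∧
          (#{e ∈ imagePairs b (openPairs b I p.2) | g.2 e = v₀} : ℝ) ≤ J) := by
      refine pr_mono ?_
      rintro g ⟨c, c', hc, hc', h1, h2⟩
      obtain ⟨d, hd, hcd⟩ := exists_mem_colourings I c
      obtain ⟨d', hd', hcd'⟩ := exists_mem_colourings I c'
      simp only [openPairs_congr hcd] at h1
      simp only [openPairs_congr hcd'] at h2
      exact ⟨(d, d'), mem_product.2 ⟨hd, hd'⟩,
        ⟨classBound_congr hcd hc, classBound_congr hcd' hc'⟩, h1, h2⟩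
    refine g1.trans ((pr_exists_le _ _).trans ((sum_le_card_nsmul _ _ (B / W) fun p _ => ?_).trans ?_))
    · by_cases hp : ClassBound b I z D p.1 ∧ ClassBound r I z D p.2
      · refine (pr_mono fun g h => h.2).trans ?_
        rw [le_div_iff₀ (by positivity), mul_comm]
        exact key r b p.1 p.2 hr hb hp.1 hp.2
      · refine le_trans (le_of_eq ?_) (show 0 ≤ B / W by positivity)
        simp [pr, avg, hp]
    · rw [hS, card_product, card_colourings, hI, nsmul_eq_mul, hW]
      push_cast
      rw [two_mul k, pow_add]
      apply le_of_eq
      field_simp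
  refine (pr_and_le (A := fun p : (ι → V) × (ι → V) => #(I.image p.1) = a ∧ #(I.image p.2) = y)
    hcond).trans ?_
  calc _ ≤ Z * (B / Z) := by gcongr
    _ = B := by field_simp

end twoBites

section twoBites
open scoped Classical
variable {ι V κ : Type*} [Fintype ι] [Fintype V] [Fintype κ]

/-- The conjunction of the pseudorandomness properties of a single graph. -/
structure Regular (H : SimpleGraph V) (k D C J : ℕ) (h C₁ u σ : ℝ) : Prop where
  degree : ∀ w, #{v | H.Adj w v} ≤ D
  codegree : CodegreeBound H C
  heavy : HeavyBound H k h C₁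
  link : LinkBound H k u σ
  tri : TriBound H k J

lemma exists_graph_of_bounds [Nonempty V] [Nonempty κ] (v₀ : κ) {k D F C L M J₃ J₄ : ℕ}
    {h C₁ u σ t x x' B : ℝ} (hh : 0 ≤ h) (hC₁ : 0 ≤ C₁) (hu : 0 ≤ u) (hσ : 0 ≤ σ) (ht : 0 ≤ t)
    (hx : 1 ≤ x) (hx0 : 0 < x') (hx1 : x' ≤ 1)
    (hL : (k : ℝ) + L ^ 2 * (C * F) < L * t)
    (hM : 2 * (t * C₁ * k) + h ^ 2 * (2 * F * k + u * (k + F * σ) ^ 2) + k * F +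
      2 * (L ^ 2 * (C * F) * k) ≤ M)
    (hfiber : pr (fun b : ι → V => ¬ ∀ v, #{i | b i = v} ≤ F) ≤ 1 / 20)
    (hreg : pr (fun g : Sym2 V → κ => ¬ Regular (edgeGraph v₀ g) k D C J₃ h C₁ u σ) ≤ 1 / 4)
    (hclosed : (Fintype.card ι).choose k *
      Real.exp (x * M / Fintype.card κ - J₄ * Real.log x) ≤ 1 / 20)
    (hB : ∀ a y s s' Q Q' N N' : ℕ, a ≤ k → y ≤ k → y + s ≤ k + L * D → a + s' ≤ k + L * D →
      Q ≤ (D * F) * s → Q ≤ s ^ 2 → Q' ≤ (D * F) * s' → Q' ≤ s' ^ 2 →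
      a ^ 2 ≤ a + Q + 2 * N → y ^ 2 ≤ y + Q' + 2 * N' →
      Real.exp (2 * k) * ((k : ℝ) / Fintype.card V) ^ ((k - a) + (k - y)) * (L + 1) ^ (2 * k) *
        Real.exp (2 * (J₃ + J₄ : ℕ) * Real.log x'⁻¹ - (1 - x') * (N + N') / Fintype.card κ) ≤ B)
    (hB' : (Fintype.card ι).choose k * ((k + 1) ^ 2 * B) ≤ 1 / 20) :
    ∃ G : SimpleGraph ι, G.CliqueFree 3 ∧
      ∀ I : Finset ι, (I : Set ι).Pairwise (fun u v => ¬ G.Adj u v) → #I < k := by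
  set E₁ : ((ι → V) × (ι → V)) × ((Sym2 V → κ) × (Sym2 V → κ)) → Prop :=
    fun ω => ¬ ∀ v, #{i | ω.1.1 i = v} ≤ F with hE₁
  set E₂ : ((ι → V) × (ι → V)) × ((Sym2 V → κ) × (Sym2 V → κ)) → Prop :=
    fun ω => ¬ ∀ v, #{i | ω.1.2 i = v} ≤ F with hE₂
  set E₃ : ((ι → V) × (ι → V)) × ((Sym2 V → κ) × (Sym2 V → κ)) → Prop :=
    fun ω => ¬ Regular (edgeGraph v₀ ω.2.1) k D C J₃ h C₁ u σ with hE₃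
  set E₄ : ((ι → V) × (ι → V)) × ((Sym2 V → κ) × (Sym2 V → κ)) → Prop :=
    fun ω => ¬ Regular (edgeGraph v₀ ω.2.2) k D C J₃ h C₁ u σ with hE₄
  set col : (Sym2 V → κ) → (ι → V) → Finset ι → ι → Option (Fin L) := fun g b I =>
    goodColouring L (D * F) D M (edgeGraph v₀ g) b I with hcol
  set X : (Sym2 V → κ) → (ι → V) → Finset ι → Finset (ι × ι) := fun g b I =>
    closedPairs (edgeGraph v₀ g) b I (col g b I) with hX
  set E₅ : ((ι → V) × (ι → V)) × ((Sym2 V → κ) × (Sym2 V → κ)) → Prop :=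
    fun ω => ∃ I, #I = k ∧ #(X ω.2.2 ω.1.2 I) ≤ M ∧
      (J₄ : ℝ) < #{e ∈ imagePairs ω.1.1 (X ω.2.2 ω.1.2 I) | ω.2.1 e = v₀} with hE₅
  set E₆ : ((ι → V) × (ι → V)) × ((Sym2 V → κ) × (Sym2 V → κ)) → Prop :=
    fun ω => ∃ I, #I = k ∧ #(X ω.2.1 ω.1.1 I) ≤ M ∧
      (J₄ : ℝ) < #{e ∈ imagePairs ω.1.2 (X ω.2.1 ω.1.1 I) | ω.2.2 e = v₀} with hE₆
  set E₇ : ((ι → V) × (ι → V)) × ((Sym2 V → κ) × (Sym2 V → κ)) → Prop :=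
    fun ω => ∃ I ∈ powersetCard k (univ : Finset ι), Sparse L (D * F) D (J₃ + J₄ : ℕ) v₀ I ω with hE₇
  have p₁ : pr E₁ ≤ 1 / 20 :=
    ((pr_fst_le fun p : (ι → V) × (ι → V) => ¬ ∀ v, #{i | p.1 i = v} ≤ F).trans
      (pr_fst_le fun b : ι → V => ¬ ∀ v, #{i | b i = v} ≤ F)).trans hfiber
  have p₂ : pr E₂ ≤ 1 / 20 :=
    ((pr_fst_le fun p : (ι → V) × (ι → V) => ¬ ∀ v, #{i | p.2 i = v} ≤ F).trans
      (pr_snd_le fun b : ι → V => ¬ ∀ v, #{i | b i = v} ≤ F)).trans hfiber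
  have p₃ : pr E₃ ≤ 1 / 4 :=
    ((pr_snd_le fun p : (Sym2 V → κ) × (Sym2 V → κ) =>
      ¬ Regular (edgeGraph v₀ p.1) k D C J₃ h C₁ u σ).trans
      (pr_fst_le fun g : Sym2 V → κ => ¬ Regular (edgeGraph v₀ g) k D C J₃ h C₁ u σ)).trans hreg
  have p₄ : pr E₄ ≤ 1 / 4 :=
    ((pr_snd_le fun p : (Sym2 V → κ) × (Sym2 V → κ) =>
      ¬ Regular (edgeGraph v₀ p.2) k D C J₃ h C₁ u σ).trans
      (pr_snd_le fun g : Sym2 V → κ => ¬ Regular (edgeGraph v₀ g) k D C J₃ h C₁ u σ)).trans hreg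
  have p₅ : pr E₅ ≤ 1 / 20 := by
    refine pr_prod_le (by norm_num) fun f => ?_
    rw [pr_swap]
    refine pr_prod_le (by norm_num) fun g => ?_
    exact (pr_exists_imagePairs_le v₀ f.1 (X g f.2) k M hx).trans hclosed
  have p₆ : pr E₆ ≤ 1 / 20 := by
    refine pr_prod_le (by norm_num) fun f => ?_
    refine pr_prod_le (by norm_num) fun g => ?_
    exact (pr_exists_imagePairs_le v₀ f.2 (X g f.1) k M hx).trans hclosed
  have p₇ : pr E₇ ≤ 1 / 20 := by
    refine (pr_exists_le _ _).trans ((sum_le_card_nsmul _ _ ((k + 1) ^ 2 * B) fun I hI => ?_).trans ?_)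
    · exact pr_sparse_le v₀ hx0 hx1 (mem_powersetCard.1 hI).2 hB
    · rw [card_powersetCard, card_univ, nsmul_eq_mul]; exact hB'
  have hall : pr (fun ω => E₁ ω ∨ E₂ ω ∨ E₃ ω ∨ E₄ ω ∨ E₅ ω ∨ E₆ ω ∨ E₇ ω) < 1 := by
    have q₁ := pr_or_le E₁ (fun ω => E₂ ω ∨ E₃ ω ∨ E₄ ω ∨ E₅ ω ∨ E₆ ω ∨ E₇ ω)
    have q₂ := pr_or_le E₂ (fun ω => E₃ ω ∨ E₄ ω ∨ E₅ ω ∨ E₆ ω ∨ E₇ ω)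
    have q₃ := pr_or_le E₃ (fun ω => E₄ ω ∨ E₅ ω ∨ E₆ ω ∨ E₇ ω)
    have q₄ := pr_or_le E₄ (fun ω => E₅ ω ∨ E₆ ω ∨ E₇ ω)
    have q₅ := pr_or_le E₅ (fun ω => E₆ ω ∨ E₇ ω)
    have q₆ := pr_or_le E₆ E₇
    linarith
  obtain ⟨⟨⟨r, b⟩, gR, gB⟩, hω⟩ := exists_not_of_pr_lt_one hall
  push Not at hω
  simp only [hE₃, hE₄, hE₅, hE₆, hE₇, not_not] at hω
  push Not at hω
  obtain ⟨hr, hb, hR, hBl, h5, h6, h7⟩ := hω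
  have colR := colourable_of_bounds hh hC₁ hu hσ ht hr hR.degree hR.codegree hR.heavy hR.link hL hM
  have colB := colourable_of_bounds hh hC₁ hu hσ ht hb hBl.degree hBl.codegree hBl.heavy hBl.link
    hL hM
  refine ⟨biteGraph (edgeGraph v₀ gR) (edgeGraph v₀ gB) r b, biteGraph_cliqueFree _ _ _ _, ?_⟩
  intro I' hI'
  by_contra! hk
  obtain ⟨I, hII', hI⟩ := exists_subset_card_eq hk
  have hind : ∀ i ∈ I, ∀ j ∈ I,
      ¬ (biteGraph (edgeGraph v₀ gR) (edgeGraph v₀ gB) r b).Adj i j := by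
    intro i hi j hj hadj
    exact hI' (hII' hi) (hII' hj) hadj.ne hadj
  obtain ⟨cR1, cR2⟩ := goodColouring_spec colR hI
  obtain ⟨cB1, cB2⟩ := goodColouring_spec colB hI
  refine h7 I (by simp [hI]) ⟨col gB b I, col gR r I, cB1, cR1, ?_, ?_⟩
  · refine Nat.cast_le.2 (card_filter_imagePairs_le rfl hI (HB := edgeGraph v₀ gB) (b := b) ?_
      hR.tri (by exact_mod_cast h5 I hI cB2))
    intro i hi j hj hadj
    by_contra! hcl
    exact hind i hi j hj ⟨Or.inl hadj, fun ⟨w, hw1, hw2⟩ => hcl.1 w hw1 hw2,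
      fun ⟨w, hw1, hw2⟩ => hcl.2 w hw1 hw2⟩
  · refine Nat.cast_le.2 (card_filter_imagePairs_le rfl hI (HB := edgeGraph v₀ gR) (b := r) ?_
      hBl.tri (by exact_mod_cast h6 I hI cR2))
    intro i hi j hj hadj
    by_contra! hcl
    exact hind i hi j hj ⟨Or.inr hadj, fun ⟨w, hw1, hw2⟩ => hcl.2 w hw1 hw2,
      fun ⟨w, hw1, hw2⟩ => hcl.1 w hw1 hw2⟩

lemma pr_not_regular_le [Nonempty V] [Nonempty κ] (v₀ : κ) {k D C J t : ℕ}
    {h C₁ u σ x x' Y β : ℝ} (hC₁ : 0 ≤ C₁) (hu : 0 < u) (hσ : 0 < σ) (hY : 0 ≤ Y)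
    (hx : 1 ≤ x) (hx' : 1 ≤ x') (hkm : k ≤ Fintype.card V) (hJ : t * (3 * (1 + 2 * C)) ≤ J)
    (hdeg : Fintype.card V * Real.exp ((x - 1) * Fintype.card V / Fintype.card κ -
      D * Real.log x) ≤ 1 / 20)
    (hcodeg : (Fintype.card V : ℝ) ^ 2 *
      ((Fintype.card V : ℝ) / (Fintype.card κ : ℝ) ^ 2) ^ (C + 1) ≤ 1 / 20)
    (hk : x' * k ≤ Fintype.card κ * (h * Real.log x' / 8))
    (hβ₁ : Real.exp (-(C₁ * Real.log x' / 4)) ≤ β) (hβ₂ : Real.exp (-(h * Real.log x' / 8)) ≤ β)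
    (hβm : 6 * (β * Fintype.card V) ≤ 1 / 20)
    (hm : Real.exp 1 * Fintype.card V ≤ u * (Fintype.card κ : ℝ) ^ 2 * Real.exp (-Y))
    (hβ₃ : Real.exp (-(Y * u * σ)) ≤ β)
    (htri : (Fintype.card V : ℝ) ^ k * (Real.exp 1 * (k ^ 2 * Fintype.card V : ℕ) / t *
      (1 / (Fintype.card κ : ℝ)) ^ 3) ^ t ≤ 1 / 20) :
    pr (fun g : Sym2 V → κ => ¬ Regular (edgeGraph v₀ g) k D C J h C₁ u σ) ≤ 1 / 4 := by
  have hβm' : β * Fintype.card V ≤ 1 := by linarith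
  have p₁ := (pr_exists_lt_degree_le (V := V) v₀ (D := D) hx).trans hdeg
  have p₂ := (pr_not_codegreeBound_le (V := V) v₀ C).trans hcodeg
  have p₃ := (pr_not_heavyBound_le (V := V) v₀ k hC₁ hx' hk hβ₁ hβ₂ hβm').trans hβm
  have p₄ := (pr_not_linkBound_le (V := V) v₀ k hu hσ hY hm hβ₃ hβm').trans hβm
  have p₅ := (pr_codegreeBound_and_not_triBound_le (V := V) v₀ hkm hJ).trans htri
  set E₁ : (Sym2 V → κ) → Prop := fun g => ∃ w, (D : ℝ) < #{v | (edgeGraph v₀ g).Adj w v}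
  set E₂ : (Sym2 V → κ) → Prop := fun g => ¬ CodegreeBound (edgeGraph v₀ g) C
  set E₃ : (Sym2 V → κ) → Prop := fun g => ¬ HeavyBound (edgeGraph v₀ g) k h C₁
  set E₄ : (Sym2 V → κ) → Prop := fun g => ¬ LinkBound (edgeGraph v₀ g) k u σ
  set E₅ : (Sym2 V → κ) → Prop := fun g => CodegreeBound (edgeGraph v₀ g) C ∧
    ¬ TriBound (edgeGraph v₀ g) k J
  have h1 : pr (fun g : Sym2 V → κ => ¬ Regular (edgeGraph v₀ g) k D C J h C₁ u σ) ≤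
      pr fun g => E₁ g ∨ E₂ g ∨ E₃ g ∨ E₄ g ∨ E₅ g := by
    refine pr_mono fun g hg => ?_
    by_contra! hE
    obtain ⟨h1, h2, h3, h4, h5⟩ := hE
    have h2' := not_not.1 h2
    refine hg ⟨fun w => ?_, h2', not_not.1 h3, not_not.1 h4, ?_⟩
    · by_contra! hw
      exact h1 ⟨w, by exact_mod_cast hw⟩
    · by_contra htr
      exact h5 ⟨h2', htr⟩
  have q₁ := pr_or_le E₁ (fun ω => E₂ ω ∨ E₃ ω ∨ E₄ ω ∨ E₅ ω)
  have q₂ := pr_or_le E₂ (fun ω => E₃ ω ∨ E₄ ω ∨ E₅ ω)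
  have q₃ := pr_or_le E₃ (fun ω => E₄ ω ∨ E₅ ω)
  have q₄ := pr_or_le E₄ E₅
  linarith

end twoBites

section numerics

lemma sub_one_le_of_overlap {ε θ τ x y S T : ℝ} (hε0 : 0 ≤ ε) (hε1 : ε ≤ 1) (hθ0 : 0 ≤ θ)
    (hθ1 : θ ≤ 1 / 2) (hθε : 1 - 2 * θ ≤ ε) (hτ0 : 0 ≤ τ) (hτ1 : τ ≤ 1)
    (hx0 : 0 ≤ x) (hx1 : x ≤ 1) (hy0 : 0 ≤ y) (hy1 : y ≤ 1)
    (hS₁ : S ≤ θ * (1 - x + τ)) (hS₂ : S ≤ (1 - x + τ) ^ 2)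
    (hT₁ : T ≤ θ * (1 - y + τ)) (hT₂ : T ≤ (1 - y + τ) ^ 2) :
    x + y - 1 ≤ (1 + ε / 2) / 2 * max 0 (x ^ 2 + y ^ 2 - S - T) -
      ((1 - 2 * θ) ^ 2 / 32 - 5 * τ) := by
  set E := x ^ 2 + y ^ 2 - S - T with hE
  have hEm : E ≤ max 0 E := le_max_right _ _
  have hE0 : 0 ≤ max 0 E := le_max_left _ _
  have near : ∀ z U : ℝ, 0 ≤ z → U ≤ (1 - z + τ) ^ 2 → -(3 * τ) ≤ (1 - z) ^ 2 - U := by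
    intro z U hz hU
    have h1 := mul_nonneg hτ0 hz
    have h2 := mul_nonneg hτ0 (sub_nonneg.2 hτ1)
    linarith
  have hx' := near x S hx0 hS₂
  have hy' := near y T hy0 hT₂
  have far : ∀ z U : ℝ, z ≤ 1 → U ≤ θ * (1 - z + τ) → (1 - 2 * θ) / 4 ≤ 1 - z - θ →
      (1 - 2 * θ) ^ 2 / 16 - τ ≤ (1 - z) ^ 2 - U := by
    intro z U hz hU hz'
    have h1 := mul_nonneg (sub_nonneg.2 hz') (by linarith : 0 ≤ 1 - z)
    have h2 := mul_nonneg (by linarith : (0 : ℝ) ≤ (1 - 2 * θ) / 4)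
        (by linarith : 0 ≤ 1 - z - (1 - 2 * θ) / 4)
    have h3 := mul_nonneg hτ0 (by linarith : (0 : ℝ) ≤ 1 / 2 - θ)
    linarith
  have hEeq : E = 2 * (x + y - 1) + ((1 - x) ^ 2 - S) + ((1 - y) ^ 2 - T) := by rw [hE]; ring
  have hεE := mul_nonneg hε0 hE0
  by_cases h1 : (1 - 2 * θ) / 4 ≤ 1 - x - θ
  · have := far x S hx1 hS₁ h1
    linarith
  by_cases h2 : (1 - 2 * θ) / 4 ≤ 1 - y - θ
  · have := far y T hy1 hT₁ h2
    linarith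
  push Not at h1 h2
  have h3 : (1 - 2 * θ) / 2 ≤ x + y - 1 := by linarith
  have h4 := mul_nonneg (by linarith : (0 : ℝ) ≤ 1 - 2 * θ) (sub_nonneg.2 hθε)
  have h5 : (1 + ε / 2) / 2 * (2 * (x + y - 1) - 6 * τ) ≤ (1 + ε / 2) / 2 * max 0 E :=
    mul_le_mul_of_nonneg_left (by linarith) (by linarith)
  have h6 := mul_nonneg hε0 (sub_nonneg.2 h3)
  have h7 := mul_nonneg hτ0 (sub_nonneg.2 hε1)
  have h8 := sq_nonneg (1 - 2 * θ)
  linarith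

set_option maxHeartbeats 800000 in
lemma exp_bound_of_overlap {k m q L D F J a y s s' Q Q' N N' : ℕ} {ε θ δ τ lam l c : ℝ}
    (hε0 : 0 ≤ ε) (hε1 : ε ≤ 1) (hθ1 : θ ≤ 1 / 2) (hθε : 1 - 2 * θ ≤ ε)
    (hτ1 : τ ≤ 1) (hc : c = (1 - 2 * θ) ^ 2 / 32) (hk0 : 0 < k) (hm0 : 0 < m) (hq0 : 0 < q)
    (hl : 0 ≤ l) (hlam : 0 ≤ lam)
    (hDF : (D * F : ℝ) ≤ θ * k) (hLD : (L * D : ℝ) ≤ τ * k)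
    (hkq : (1 + ε / 2) / 2 * l ≤ (1 - lam) * k / q)
    (hkm : Real.log (k / m) ≤ -((1 / 2 - 2 * δ) * l)) (hδ : 0 ≤ δ)
    (hsmall : 5 / 2 * τ * (k * l) + 4 * δ * (k * l) + 2 * k * (1 + Real.log (L + 1)) +
      2 * J * Real.log lam⁻¹ + k / q ≤ c / 4 * (k * l))
    (ha : a ≤ k) (hy : y ≤ k) (hs : y + s ≤ k + L * D) (hs' : a + s' ≤ k + L * D)
    (hQ₁ : Q ≤ D * F * s) (hQ₂ : Q ≤ s ^ 2) (hQ₁' : Q' ≤ D * F * s') (hQ₂' : Q' ≤ s' ^ 2)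
    (hN : a ^ 2 ≤ a + Q + 2 * N) (hN' : y ^ 2 ≤ y + Q' + 2 * N') :
    Real.exp (2 * k) * ((k : ℝ) / m) ^ ((k - a) + (k - y)) * (L + 1) ^ (2 * k) *
      Real.exp (2 * (J : ℝ) * Real.log lam⁻¹ - (1 - lam) * (N + N') / q) ≤
      Real.exp (-((1 / 2 + c / 4) * (k * l))) := by
  have hkR : (0 : ℝ) < k := by exact_mod_cast hk0
  have hmR : (0 : ℝ) < m := by exact_mod_cast hm0
  have hqR : (0 : ℝ) < q := by exact_mod_cast hq0
  have hτ0 : 0 ≤ τ := by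
    by_contra! h
    have : (0 : ℝ) ≤ L * D := by positivity
    nlinarith
  have hθ0 : 0 ≤ θ := by
    by_contra! h
    have : (0 : ℝ) ≤ D * F := by positivity
    nlinarith
  have haR : (a : ℝ) ≤ k := by exact_mod_cast ha
  have hyR : (y : ℝ) ≤ k := by exact_mod_cast hy
  have hsR : (y : ℝ) + s ≤ k + L * D := by exact_mod_cast hs
  have hsR' : (a : ℝ) + s' ≤ k + L * D := by exact_mod_cast hs'
  have hQR₁ : (Q : ℝ) ≤ D * F * s := by exact_mod_cast hQ₁
  have hQR₂ : (Q : ℝ) ≤ s ^ 2 := by exact_mod_cast hQ₂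
  have hQR₁' : (Q' : ℝ) ≤ D * F * s' := by exact_mod_cast hQ₁'
  have hQR₂' : (Q' : ℝ) ≤ s' ^ 2 := by exact_mod_cast hQ₂'
  have hNR : (a : ℝ) ^ 2 ≤ a + Q + 2 * N := by exact_mod_cast hN
  have hNR' : (y : ℝ) ^ 2 ≤ y + Q' + 2 * N' := by exact_mod_cast hN'
  have hs0 : (0 : ℝ) ≤ s := by positivity
  have hs0' : (0 : ℝ) ≤ s' := by positivity
  have aux : ∀ z w R : ℝ, 0 ≤ w → z + w ≤ k + L * D → R ≤ D * F * w → R ≤ w ^ 2 →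
      R / k ^ 2 ≤ θ * (1 - z / k + τ) ∧ R / k ^ 2 ≤ (1 - z / k + τ) ^ 2 := by
    intro z w R hw hzw hR₁ hR₂
    have hwk : w / k ≤ 1 - z / k + τ := by
      rw [div_le_iff₀ hkR]
      have : z / k * k = z := by field_simp
      linarith
    have hwk0 : 0 ≤ w / k := by positivity
    constructor
    · calc R / k ^ 2 ≤ (θ * k) * w / k ^ 2 := by
            gcongr; exact hR₁.trans (mul_le_mul_of_nonneg_right hDF hw)
        _ = θ * (w / k) := by field_simp
        _ ≤ _ := by gcongr
    · calc R / k ^ 2 ≤ w ^ 2 / k ^ 2 := by gcongr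
        _ = (w / k) ^ 2 := by ring
        _ ≤ _ := by gcongr
  obtain ⟨hS₁, hS₂⟩ := aux y s Q hs0 hsR hQR₁ hQR₂
  obtain ⟨hT₁, hT₂⟩ := aux a s' Q' hs0' hsR' hQR₁' hQR₂'
  have hmain := sub_one_le_of_overlap (x := y / k) (y := a / k) hε0 hε1 hθ0 hθ1 hθε hτ0 hτ1
    (by positivity) (div_le_one_of_le₀ hyR hkR.le) (by positivity)
    (div_le_one_of_le₀ haR hkR.le) hS₁ hS₂ hT₁ hT₂
  set E := max 0 (((y : ℝ) / k) ^ 2 + ((a : ℝ) / k) ^ 2 - Q / k ^ 2 - Q' / k ^ 2) with hEdef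
  have hE : (k : ℝ) ^ 2 * E ≤ 2 * (N + N') + 2 * k := by
    rw [hEdef, mul_max_of_nonneg _ _ (by positivity)]
    refine max_le (by simp; positivity) ?_
    have : (k : ℝ) ^ 2 * (((y : ℝ) / k) ^ 2 + ((a : ℝ) / k) ^ 2 - Q / k ^ 2 - Q' / k ^ 2) =
      y ^ 2 + a ^ 2 - Q - Q' := by field_simp
    rw [this]
    linarith
  have hE0 : 0 ≤ E := le_max_left _ _
  have h1lam : 0 ≤ 1 - lam := by
    by_contra! h
    have h1 : 0 ≤ (1 + ε / 2) / 2 * l := by positivity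
    have h2 : (1 - lam) * k / q < 0 := div_neg_of_neg_of_pos (by nlinarith) hqR
    linarith
  have hgain : (1 + ε / 2) / 2 * l * (k * E) / 2 - k / q ≤ (1 - lam) * (N + N') / q := by
    have h1 : (1 - lam) * ((k : ℝ) ^ 2 * E / 2 - k) / q ≤ (1 - lam) * (N + N') / q := by
      gcongr; linarith
    have h2 : (1 - lam) * ((k : ℝ) ^ 2 * E / 2 - k) / q =
        ((1 - lam) * k / q) * (k * E) / 2 - (1 - lam) * (k / q) := by ring
    have h3 : (1 + ε / 2) / 2 * l * (k * E) / 2 ≤ ((1 - lam) * k / q) * (k * E) / 2 := by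
      gcongr
    have h4 : (1 - lam) * (k / q : ℝ) ≤ k / q :=
      mul_le_of_le_one_left (by positivity) (by linarith)
    linarith
  have hpow : ((k : ℝ) / m) ^ ((k - a) + (k - y)) =
      Real.exp (((k - a) + (k - y) : ℝ) * Real.log (k / m)) := by
    rw [← Real.rpow_natCast, Real.rpow_def_of_pos (by positivity)]
    push_cast [Nat.cast_sub ha, Nat.cast_sub hy]
    rw [mul_comm]
  have hpowL : ((L : ℝ) + 1) ^ (2 * k) = Real.exp (2 * k * Real.log (L + 1)) := by
    rw [← Real.rpow_natCast, Real.rpow_def_of_pos (by positivity)]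
    push_cast
    rw [mul_comm]
  rw [hpow, hpowL, ← Real.exp_add, ← Real.exp_add, ← Real.exp_add, Real.exp_le_exp]
  have hlogs : ((k - a) + (k - y) : ℝ) * Real.log (k / m) ≤
      ((k - a) + (k - y) : ℝ) * -((1 / 2 - 2 * δ) * l) :=
    mul_le_mul_of_nonneg_left hkm (by linarith)
  have hlogs' : ((k - a) + (k - y) : ℝ) * -((1 / 2 - 2 * δ) * l) ≤
      k * l * ((y / k + a / k - 1) / 2 - 1 / 2) + 4 * δ * (k * l) := by
    have h1 : k * l * ((y / k + a / k - 1) / 2 - 1 / 2) =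
        -(((k - a) + (k - y)) * l / 2) := by field_simp; ring
    rw [h1]
    have : 0 ≤ δ * l * (a + y) := by positivity
    linarith
  have hkl : 0 ≤ k * l := by positivity
  have hmain' := mul_le_mul_of_nonneg_left hmain hkl
  rw [← hc] at hmain'
  linarith

end numerics

open Filter

/-- The choice of the sizes `k` (independent set), `m` (base graph) and `q` (inverse edge density)
in terms of `n`, with `l = log n`, `g` a small power of `n` and `K = √(n log n)`. -/
structure Scale (ε δ A : ℝ) (n k m q : ℕ) (g l K : ℝ) : Prop where
  A_le : A ≤ l
  A_mul_le : A * l ≤ g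
  exp_l : Real.exp l = n
  exp_g : Real.exp (δ / 20 * l) = g
  pow_le : g ^ 200 ≤ n
  K_pos : 0 < K
  K_sq : K ^ 2 = n * l
  le_k : (1 + ε) * K ≤ k
  k_le : k ≤ 3 * K
  le_m : n / g ^ 20 ≤ m
  m_le : m ≤ 2 * n / g ^ 20
  le_q : 2 * n / K ≤ q
  q_le : q ≤ (1 + ε / 10) * (2 * n / K)

lemma eventually_mul_log_le (A : ℝ) {s : ℝ} (hs : 0 < s) :
    ∀ᶠ n : ℕ in atTop, A * Real.log n ≤ (n : ℝ) ^ s := by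
  have h := ((isLittleO_log_rpow_atTop hs).const_mul_left A).bound (c := 1) one_pos
  filter_upwards [tendsto_natCast_atTop_atTop.eventually h, eventually_ge_atTop 1] with n hn h1
  rw [one_mul, Real.norm_of_nonneg (by positivity : 0 ≤ (n : ℝ) ^ s)] at hn
  exact (le_abs_self _).trans hn

lemma eventually_scale {ε δ : ℝ} (hε0 : 0 < ε) (hε1 : ε ≤ 1) (hδ0 : 0 < δ) (hδ1 : δ ≤ 1 / 10)
    (A : ℝ) : ∀ᶠ n : ℕ in atTop, ∃ (m q : ℕ) (g : ℝ),
      Scale ε δ A n ⌈(1 + ε) * Real.sqrt (n * Real.log n)⌉₊ m q g (Real.log n)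
        (Real.sqrt (n * Real.log n)) := by
  have hlog : Tendsto (fun n : ℕ => Real.log n) atTop atTop :=
    Real.tendsto_log_atTop.comp tendsto_natCast_atTop_atTop
  filter_upwards [hlog.eventually_ge_atTop A, hlog.eventually_ge_atTop 1, eventually_ge_atTop 1,
    eventually_mul_log_le A (s := δ / 20) (by positivity),
    eventually_mul_log_le (25 / ε ^ 2) one_pos] with n hA hl hn hAg hlin
  set l := Real.log n
  set K := Real.sqrt (n * l)
  have hnR : (1 : ℝ) ≤ n := by exact_mod_cast hn
  have hexp : Real.exp l = n := Real.exp_log (by positivity)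
  have hKsq : K ^ 2 = n * l := Real.sq_sqrt (by positivity)
  have hK1 : 1 ≤ K := Real.one_le_sqrt.2 (by nlinarith)
  have hgpow : Real.exp (δ / 20 * l) ^ 200 ≤ n := by
    rw [← Real.exp_nat_mul, ← hexp, Real.exp_le_exp]
    push_cast
    nlinarith
  have hg1 : 1 ≤ Real.exp (δ / 20 * l) := Real.one_le_exp (by positivity)
  have hKn : K ≤ ε / 5 * n := by
    refine le_of_sq_le_sq ?_ (by positivity)
    rw [Real.rpow_one] at hlin
    have h1 : l ≤ ε ^ 2 / 25 * n := by
      calc l = ε ^ 2 / 25 * (25 / ε ^ 2 * l) := by field_simp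
        _ ≤ _ := by gcongr
    rw [hKsq]
    nlinarith
  refine ⟨⌈n / Real.exp (δ / 20 * l) ^ 20⌉₊, ⌈2 * n / K⌉₊, Real.exp (δ / 20 * l),
    ⟨hA, ?_, hexp, rfl, hgpow, by positivity, hKsq, Nat.le_ceil _, ?_, Nat.le_ceil _, ?_,
      Nat.le_ceil _, ?_⟩⟩
  · refine hAg.trans_eq ?_
    rw [Real.rpow_def_of_pos (by positivity), mul_comm]
  · have := (Nat.ceil_lt_add_one (by positivity : 0 ≤ (1 + ε) * K)).le
    nlinarith
  · refine (Nat.ceil_lt_add_one (by positivity)).le.trans ?_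
    have h1 : Real.exp (δ / 20 * l) ^ 20 ≤ n :=
      (pow_le_pow_right₀ hg1 (by norm_num)).trans hgpow
    have h2 : 1 ≤ n / Real.exp (δ / 20 * l) ^ 20 := (one_le_div (by positivity)).2 h1
    rw [mul_div_assoc]
    linarith
  · refine (Nat.ceil_lt_add_one (by positivity)).le.trans ?_
    have h2 : 1 ≤ ε / 10 * (2 * n / K) := by
      rw [← mul_div_assoc, one_le_div (by positivity)]
      linarith
    linarith

namespace Scale
variable {ε δ A : ℝ} {n k m q : ℕ} {g l K : ℝ}

lemma g_pos (S : Scale ε δ A n k m q g l K) : 0 < g := S.exp_g ▸ Real.exp_pos _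

lemma n_pos (S : Scale ε δ A n k m q g l K) : (0 : ℝ) < n := S.exp_l ▸ Real.exp_pos _

lemma m_pos (S : Scale ε δ A n k m q g l K) : (0 : ℝ) < m := by
  have := S.n_pos; have := S.g_pos
  exact lt_of_lt_of_le (by positivity) S.le_m

lemma q_pos (S : Scale ε δ A n k m q g l K) : (0 : ℝ) < q := by
  have := S.n_pos; have := S.K_pos
  exact lt_of_lt_of_le (by positivity) S.le_q

lemma k_pos (S : Scale ε δ A n k m q g l K) (hε : 0 < ε) : (0 : ℝ) < k := by
  have := S.K_pos
  exact lt_of_lt_of_le (by positivity) S.le_k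

lemma K_le_k (S : Scale ε δ A n k m q g l K) (hε : 0 < ε) : K ≤ k := by
  have := S.K_pos; have := S.le_k
  nlinarith

lemma l_ge (S : Scale ε δ A n k m q g l K) (hA : 100 ≤ A) : 100 ≤ l := hA.trans S.A_le

lemma l_le_g (S : Scale ε δ A n k m q g l K) (hA : 100 ≤ A) : 100 * l ≤ g :=
  (mul_le_mul_of_nonneg_right hA (by linarith [S.l_ge hA])).trans S.A_mul_le

lemma g_ge (S : Scale ε δ A n k m q g l K) (hA : 100 ≤ A) : 10000 ≤ g := by
  linarith [S.l_ge hA, S.l_le_g hA]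

lemma A_le_g (S : Scale ε δ A n k m q g l K) (hA : 100 ≤ A) : A ≤ g := by
  nlinarith [S.l_ge hA, S.A_mul_le]

lemma pow_g_le (S : Scale ε δ A n k m q g l K) (hA : 100 ≤ A) {i j : ℕ} (h : i ≤ j) :
    g ^ i ≤ g ^ j := pow_le_pow_right₀ (by linarith [S.g_ge hA]) h

lemma le_m_mul (S : Scale ε δ A n k m q g l K) : n ≤ m * g ^ 20 :=
  (div_le_iff₀ (pow_pos S.g_pos _)).1 S.le_m

lemma m_mul_le (S : Scale ε δ A n k m q g l K) : m * g ^ 20 ≤ 2 * n :=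
  (le_div_iff₀ (pow_pos S.g_pos _)).1 S.m_le

lemma le_q_mul (S : Scale ε δ A n k m q g l K) : 2 * n ≤ q * K :=
  (div_le_iff₀ S.K_pos).1 S.le_q

lemma q_mul_le (S : Scale ε δ A n k m q g l K) : q * K ≤ (1 + ε / 10) * (2 * n) := by
  refine (le_div_iff₀ S.K_pos).1 (S.q_le.trans_eq ?_)
  ring

lemma pow_le_K (S : Scale ε δ A n k m q g l K) (hA : 100 ≤ A) : g ^ 100 ≤ K := by
  refine le_of_sq_le_sq ?_ S.K_pos.le
  rw [S.K_sq, ← pow_mul]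
  exact S.pow_le.trans (le_mul_of_one_le_right S.n_pos.le (by linarith [S.l_ge hA]))

lemma K_mul_pow_le (S : Scale ε δ A n k m q g l K) (hA : 100 ≤ A) : K * g ^ 99 ≤ n := by
  have hg := S.g_pos
  have hn := S.n_pos
  refine le_of_sq_le_sq ?_ hn.le
  have h1 : l ≤ g := by linarith [S.l_le_g hA, S.l_ge hA]
  calc (K * g ^ 99) ^ 2 = n * (l * g ^ 198) := by rw [mul_pow, S.K_sq]; ring
    _ ≤ n * (g * g ^ 198) := by gcongr
    _ = n * g ^ 199 := by ring
    _ ≤ n * n := by gcongr; exact (S.pow_g_le hA (by norm_num)).trans S.pow_le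
    _ = n ^ 2 := by ring

lemma k_div_q_le (S : Scale ε δ A n k m q g l K) : (k : ℝ) / q ≤ 3 / 2 * l := by
  have hK := S.K_pos
  have hn := S.n_pos
  calc (k : ℝ) / q ≤ 3 * K / (2 * n / K) := div_le_div₀ (by positivity) S.k_le (by positivity) S.le_q
    _ = 3 / 2 * (K ^ 2 / n) := by field_simp
    _ = _ := by rw [S.K_sq]; field_simp

lemma le_k_div_q (S : Scale ε δ A n k m q g l K) (hε0 : 0 < ε) (hε1 : ε ≤ 1) (hA : 100 ≤ A) :
    (1 + ε / 2) / 2 * l ≤ (1 - ε / 4 / (1 + ε)) * k / q := by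
  have hK := S.K_pos
  have hn := S.n_pos
  have hq := S.q_pos
  have hl := S.l_ge hA
  have h1 : (1 - ε / 4 / (1 + ε)) * ((1 + ε) * K) ≤ (1 - ε / 4 / (1 + ε)) * k := by
    refine mul_le_mul_of_nonneg_left S.le_k ?_
    rw [sub_nonneg, div_le_one (by positivity)]
    linarith
  have h2 : (1 - ε / 4 / (1 + ε)) * ((1 + ε) * K) = (1 + 3 * ε / 4) * K := by field_simp; ring
  rw [le_div_iff₀ hq]
  refine le_trans ?_ (h2.symm.trans_le h1)
  refine le_of_mul_le_mul_right ?_ hK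
  calc (1 + ε / 2) / 2 * l * q * K = (1 + ε / 2) / 2 * l * (q * K) := by ring
    _ ≤ (1 + ε / 2) / 2 * l * ((1 + ε / 10) * (2 * n)) :=
        mul_le_mul_of_nonneg_left S.q_mul_le (by positivity)
    _ = (1 + ε / 2) * (1 + ε / 10) * (n * l) := by ring
    _ ≤ (1 + 3 * ε / 4) * (n * l) := by
        gcongr
        nlinarith
    _ = (1 + 3 * ε / 4) * K * K := by rw [← S.K_sq]; ring

lemma m_mul_le_q_sq (S : Scale ε δ A n k m q g l K) (hA : 100 ≤ A) :
    3 * m * g ^ 15 ≤ (q : ℝ) ^ 2 := by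
  have hK := S.K_pos
  have hn := S.n_pos
  have hg := S.g_ge hA
  have hl := S.l_ge hA
  have h1 : (2 * n : ℝ) ^ 2 ≤ (q * K) ^ 2 :=
    pow_le_pow_left₀ (by positivity) S.le_q_mul 2
  rw [mul_pow (q : ℝ), S.K_sq] at h1
  have h2 : 4 * (n : ℝ) ≤ q ^ 2 * l := by nlinarith
  have h3 : 3 * m * g ^ 15 * g ^ 5 ≤ 6 * n := by linarith [S.m_mul_le]
  have h4 : 2 * l ≤ g ^ 5 := by
    have := S.pow_g_le hA (i := 1) (j := 5) (by norm_num)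
    have := S.l_le_g hA
    linarith
  have h5 : 3 * m * g ^ 15 * (2 * l) ≤ 3 * m * g ^ 15 * g ^ 5 := by gcongr
  refine le_of_mul_le_mul_right (a := 4 * l) ?_ (by positivity)
  nlinarith

lemma m_div_q_le (S : Scale ε δ A n k m q g l K) : (m : ℝ) / q ≤ K / g ^ 20 := by
  have hK := S.K_pos
  have hn := S.n_pos
  have hg := S.g_pos
  rw [div_le_div_iff₀ S.q_pos (by positivity)]
  linarith [S.m_mul_le, S.le_q_mul]

lemma le_m_div_q (S : Scale ε δ A n k m q g l K) (hε1 : ε ≤ 1) (hA : 100 ≤ A) :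
    g ^ 70 ≤ (m : ℝ) / q := by
  have hK := S.K_pos
  have hn := S.n_pos
  have hg := S.g_ge hA
  rw [le_div_iff₀ S.q_pos]
  refine le_of_mul_le_mul_right (a := g ^ 20 * K) ?_ (by positivity)
  have h1 : 3 * g ^ 90 ≤ K := by
    have := S.pow_le_K hA
    have h2 := S.pow_g_le hA (i := 1) (j := 10) (by norm_num)
    have h3 : 3 * g ^ 90 ≤ g ^ 10 * g ^ 90 := by gcongr; linarith
    linarith
  calc g ^ 70 * q * (g ^ 20 * K) = g ^ 90 * (q * K) := by ring
    _ ≤ g ^ 90 * (3 * n) :=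
        mul_le_mul_of_nonneg_left (by nlinarith [S.q_mul_le]) (by positivity)
    _ = 3 * g ^ 90 * n := by ring
    _ ≤ K * (m * g ^ 20) := mul_le_mul h1 S.le_m_mul hn.le hK.le
    _ = _ := by ring

lemma n_div_m_le (S : Scale ε δ A n k m q g l K) : (n : ℝ) / m ≤ g ^ 20 := by
  rw [div_le_iff₀ S.m_pos]; linarith [S.le_m_mul]

lemma le_n_div_m (S : Scale ε δ A n k m q g l K) : g ^ 20 / 2 ≤ (n : ℝ) / m := by
  rw [div_le_div_iff₀ two_pos S.m_pos]; linarith [S.m_mul_le]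

lemma m_le_n (S : Scale ε δ A n k m q g l K) (hA : 100 ≤ A) : (m : ℝ) ≤ n := by
  have h1 := S.m_mul_le
  have h2 := S.pow_g_le hA (i := 1) (j := 20) (by norm_num)
  have h3 := S.g_ge hA
  have h4 := S.m_pos
  nlinarith

lemma k_le_m (S : Scale ε δ A n k m q g l K) (hA : 100 ≤ A) : (k : ℝ) ≤ m := by
  have hg := S.g_ge hA
  have hK := S.K_pos
  refine le_of_mul_le_mul_right (a := g ^ 20) (le_trans ?_ S.le_m_mul) (by positivity)
  calc k * g ^ 20 ≤ 3 * K * g ^ 20 := by gcongr; exact S.k_le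
    _ = K * (3 * g ^ 20) := by ring
    _ ≤ K * (g * g ^ 20) := by gcongr; linarith
    _ = K * g ^ 21 := by ring
    _ ≤ K * g ^ 99 := by gcongr K * ?_; exact S.pow_g_le hA (by norm_num)
    _ ≤ n := S.K_mul_pow_le hA

lemma log_k_div_m_le (S : Scale ε δ A n k m q g l K) (hε : 0 < ε) (hA : 100 ≤ A) :
    Real.log (k / m) ≤ -((1 / 2 - 2 * δ) * l) := by
  have hg := S.g_ge hA
  have hn := S.n_pos
  have hm := S.m_pos
  have hk := S.k_pos hε
  have hK := S.K_pos
  have h1 : ((k : ℝ) / m) ^ 2 ≤ Real.exp (4 * δ * l - l) := by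
    have h2 : Real.exp (4 * δ * l) = g ^ 80 := by
      rw [← S.exp_g, ← Real.exp_nat_mul]; congr 1; push_cast; ring
    rw [Real.exp_sub, h2, S.exp_l, div_pow, div_le_div_iff₀ (by positivity) hn]
    have h3 : (n : ℝ) ^ 2 ≤ (m * g ^ 20) ^ 2 := by gcongr; exact S.le_m_mul
    have h4 : (k : ℝ) ^ 2 ≤ 9 * (n * l) := by
      rw [← S.K_sq]
      calc (k : ℝ) ^ 2 ≤ (3 * K) ^ 2 := by gcongr; exact S.k_le
        _ = _ := by ring
    have h5 : 9 * l ≤ g ^ 40 := by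
      have := S.pow_g_le hA (i := 1) (j := 40) (by norm_num)
      linarith [S.l_le_g hA, S.l_ge hA]
    calc (k : ℝ) ^ 2 * n ≤ 9 * (n * l) * n := by gcongr
      _ = 9 * l * n ^ 2 := by ring
      _ ≤ g ^ 40 * (m * g ^ 20) ^ 2 := by gcongr
      _ = _ := by ring
  have h6 := (Real.log_le_iff_le_exp (by positivity)).2 h1
  rw [Real.log_pow] at h6
  push_cast at h6
  linarith

lemma choose_le (S : Scale ε δ A n k m q g l K) (hε : 0 < ε) (hA : 100 ≤ A) :
    (n.choose k : ℝ) ≤ Real.exp (k * l / 2) := by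
  have hn := S.n_pos
  have hk := S.k_pos hε
  have hK := S.K_pos
  have hl := S.l_ge hA
  have h1 : (Real.exp 1 * n / k) ^ 2 ≤ n := by
    have h2 : (n : ℝ) * l ≤ k ^ 2 := by
      rw [← S.K_sq]; gcongr; exact S.K_le_k hε
    have h3 : Real.exp 1 ^ 2 ≤ l := by nlinarith [Real.exp_one_lt_d9, Real.exp_pos 1]
    rw [div_pow, mul_pow, div_le_iff₀ (by positivity)]
    calc Real.exp 1 ^ 2 * (n : ℝ) ^ 2 ≤ l * n ^ 2 := by gcongr
      _ = n * (n * l) := by ring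
      _ ≤ _ := by gcongr
  have h2 : Real.exp 1 * n / k ≤ Real.exp (l / 2) := by
    refine le_of_sq_le_sq ?_ (Real.exp_pos _).le
    rw [← Real.exp_nat_mul]
    refine h1.trans_eq (S.exp_l.symm.trans ?_)
    push_cast
    ring_nf
  calc (n.choose k : ℝ) ≤ (Real.exp 1 * n / k) ^ k := choose_le_exp_mul_div_pow n k
    _ ≤ Real.exp (l / 2) ^ k := by gcongr
    _ = _ := by rw [← Real.exp_nat_mul]; ring_nf

end Scale

lemma deviation_pos {x : ℝ} (hx : 1 < x) : 0 < x * Real.log x - (x - 1) := by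
  have h := Real.one_sub_inv_le_log_of_pos (by positivity : 0 < x)
  have h2 := Real.log_lt_sub_one_of_pos (x := x⁻¹) (by positivity) (by simp [hx.ne'])
  rw [Real.log_inv] at h2
  have h3 : x * (-Real.log x) < x * (x⁻¹ - 1) := by gcongr
  rw [mul_sub, mul_inv_cancel₀ (by positivity)] at h3
  linarith

lemma exp_neg_le_one_div_twenty {l : ℝ} (hl : 20 ≤ l) : Real.exp (-l) ≤ 1 / 20 := by
  rw [Real.exp_neg, one_div]
  have := Real.add_one_le_exp l
  gcongr
  linarith

namespace Scale
variable {ε δ A : ℝ} {n k m q : ℕ} {g l K : ℝ}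

lemma log_g (S : Scale ε δ A n k m q g l K) : Real.log g = δ / 20 * l := by
  rw [← S.exp_g, Real.log_exp]

lemma g_pow (S : Scale ε δ A n k m q g l K) (i : ℕ) : g ^ i = Real.exp (i * (δ / 20 * l)) := by
  rw [← S.exp_g, ← Real.exp_nat_mul]

lemma pow_mul_g_le_k (S : Scale ε δ A n k m q g l K) (hε : 0 < ε) (hA : 100 ≤ A) {i : ℕ}
    (hi : i ≤ 99) : g ^ i * g ≤ k := by
  rw [← pow_succ]
  exact (S.pow_g_le hA (by omega)).trans ((S.pow_le_K hA).trans (S.K_le_k hε))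

lemma fiber_bound (S : Scale ε δ A n k m q g l K) (hA : 100 ≤ A) {x : ℝ} (hx : 1 < x)
    (hAx : 4 / (x * Real.log x - (x - 1)) ≤ A) :
    m * Real.exp ((x - 1) * n / m - x * (n / m) * Real.log x) ≤ 1 / 20 := by
  have hm := S.m_pos
  have hl := S.l_ge hA
  have hg := S.g_ge hA
  have hψ := deviation_pos hx
  set ψ := x * Real.log x - (x - 1) with hψdef
  have h1 : (x - 1) * n / m - x * (n / m) * Real.log x = -(ψ * (n / m)) := by rw [hψdef]; ring
  have h2 : 2 * l ≤ ψ * (n / m) := by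
    have h3 : 4 / ψ * l ≤ g :=
      (mul_le_mul_of_nonneg_right hAx (by linarith)).trans S.A_mul_le
    have h4 := S.le_n_div_m
    have h5 := S.pow_g_le hA (i := 1) (j := 20) (by norm_num)
    calc 2 * l = ψ * (4 / ψ * l / 2) := by field_simp; ring
      _ ≤ ψ * (n / m) := mul_le_mul_of_nonneg_left (by linarith) hψ.le
  calc m * Real.exp ((x - 1) * n / m - x * (n / m) * Real.log x)
      ≤ Real.exp l * Real.exp (-(2 * l)) := by
        rw [h1, S.exp_l]; gcongr; exact_mod_cast S.m_le_n hA
    _ = Real.exp (-l) := by rw [← Real.exp_add]; ring_nf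
    _ ≤ _ := exp_neg_le_one_div_twenty (by linarith)

lemma degree_bound (S : Scale ε δ A n k m q g l K) (hε1 : ε ≤ 1) (hA : 100 ≤ A) {x : ℝ}
    (hx : 1 < x) (hx2 : x ≤ 2) (hAx : 4 / (x * Real.log x - (x - 1)) ≤ A) :
    m * Real.exp ((x - 1) * m / q - ⌊x * (m / q : ℝ)⌋₊ * Real.log x) ≤ 1 / 20 := by
  have hm := S.m_pos
  have hl := S.l_ge hA
  have hg := S.g_ge hA
  have hψ := deviation_pos hx
  set ψ := x * Real.log x - (x - 1) with hψdef
  have hlogx : Real.log x ≤ 1 := by linarith [Real.log_le_sub_one_of_pos (by positivity : 0 < x)]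
  have hlogx0 : 0 ≤ Real.log x := Real.log_nonneg hx.le
  have h0 := (Nat.lt_floor_add_one (x * (m / q : ℝ))).le
  have h1 : (x - 1) * m / q - ⌊x * (m / q : ℝ)⌋₊ * Real.log x ≤ -(ψ * (m / q)) + 1 := by
    have h2 : (x * (m / q : ℝ) - 1) * Real.log x ≤ ⌊x * (m / q : ℝ)⌋₊ * Real.log x :=
      mul_le_mul_of_nonneg_right (by linarith) hlogx0
    have h3 : (x - 1) * m / q = (x - 1) * (m / q) := by ring
    rw [hψdef, h3]
    linarith
  have h2 : 4 * l ≤ ψ * (m / q) := by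
    have h3 : 4 / ψ * l ≤ g :=
      (mul_le_mul_of_nonneg_right hAx (by linarith)).trans S.A_mul_le
    have h4 := S.le_m_div_q hε1 hA
    have h5 := S.pow_g_le hA (i := 1) (j := 70) (by norm_num)
    calc 4 * l = ψ * (4 / ψ * l) := by field_simp
      _ ≤ ψ * (m / q) := mul_le_mul_of_nonneg_left (by linarith) hψ.le
  calc m * Real.exp ((x - 1) * m / q - ⌊x * (m / q : ℝ)⌋₊ * Real.log x)
      ≤ Real.exp l * Real.exp (-(2 * l)) := by
        rw [S.exp_l]; gcongr
        · exact_mod_cast S.m_le_n hA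
        · linarith
    _ = Real.exp (-l) := by rw [← Real.exp_add]; ring_nf
    _ ≤ _ := exp_neg_le_one_div_twenty (by linarith)

lemma codegree_bound (S : Scale ε δ A n k m q g l K) (hA : 100 ≤ A) {C : ℕ}
    (hC : 4 ≤ δ * C) (hδ : 0 < δ) : (m : ℝ) ^ 2 * ((m : ℝ) / (q : ℝ) ^ 2) ^ (C + 1) ≤ 1 / 20 := by
  have hm := S.m_pos
  have hq := S.q_pos
  have hl := S.l_ge hA
  have hg := S.g_ge hA
  have h1 : (m : ℝ) / (q : ℝ) ^ 2 ≤ (g ^ 15)⁻¹ := by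
    rw [div_le_iff₀ (by positivity), inv_mul_eq_div, le_div_iff₀ (by positivity)]
    have := S.m_mul_le_q_sq hA
    have h2 : 0 ≤ m * g ^ 15 := by positivity
    linarith
  calc (m : ℝ) ^ 2 * ((m : ℝ) / (q : ℝ) ^ 2) ^ (C + 1)
      ≤ Real.exp l ^ 2 * ((g ^ 15)⁻¹) ^ (C + 1) := by
        rw [S.exp_l]; gcongr; exact_mod_cast S.m_le_n hA
    _ = Real.exp (2 * l + -(((15 * (C + 1) : ℕ) : ℝ) * (δ / 20 * l))) := by
        rw [inv_pow, ← pow_mul, S.g_pow, ← Real.exp_neg, ← Real.exp_nat_mul, ← Real.exp_add]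
        norm_num
    _ ≤ Real.exp (-l) := by
        rw [Real.exp_le_exp]
        push_cast
        have h1 := mul_le_mul_of_nonneg_right hC (by linarith : 0 ≤ l)
        have h2 : 0 ≤ δ * l := by positivity
        linarith
    _ ≤ _ := exp_neg_le_one_div_twenty (by linarith)

lemma heavy_bound (S : Scale ε δ A n k m q g l K) (hA : 100 ≤ A) (hδ : 0 < δ)
    (hAδ : 400 / δ ≤ A) : g * k ≤ q * (g ^ 2 * Real.log g / 8) := by
  have hq := S.q_pos
  have hl := S.l_ge hA
  have hg := S.g_ge hA
  have h1 := (div_le_iff₀ S.q_pos).1 S.k_div_q_le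
  have h2 : 400 ≤ g * δ := (div_le_iff₀ hδ).1 (hAδ.trans (S.A_le_g hA))
  rw [S.log_g]
  calc g * k ≤ g * (3 / 2 * l * q) := by gcongr
    _ = 240 * (g * l * q / 160) := by ring
    _ ≤ g * δ * (g * l * q / 160) := by gcongr; linarith
    _ = _ := by ring

lemma heavy_tail (S : Scale ε δ A n k m q g l K) (hA : 100 ≤ A) (hδ : 0 < δ)
    (hAδ : 400 / δ ≤ A) : Real.exp (-(g ^ 2 * Real.log g / 8)) ≤ Real.exp (-(2 * l)) := by
  have hl := S.l_ge hA
  have hg := S.g_ge hA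
  have h2 : 400 ≤ g * δ := (div_le_iff₀ hδ).1 (hAδ.trans (S.A_le_g hA))
  rw [S.log_g, Real.exp_le_exp, neg_le_neg_iff]
  have h3 : 320 * l ≤ g * δ * g * l := by gcongr; nlinarith
  linarith

lemma six_mul_exp_le (S : Scale ε δ A n k m q g l K) (hA : 100 ≤ A) :
    6 * (Real.exp (-(2 * l)) * m) ≤ 1 / 20 := by
  have hl := S.l_ge hA
  calc 6 * (Real.exp (-(2 * l)) * m) ≤ 6 * (Real.exp (-(2 * l)) * Real.exp l) := by
        rw [S.exp_l]; gcongr; exact_mod_cast S.m_le_n hA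
    _ = 6 * Real.exp (-(l / 2)) * Real.exp (-(l / 2)) := by
        rw [mul_assoc 6, ← Real.exp_add, ← Real.exp_add]; ring_nf
    _ ≤ 6 * (1 / 20) * (1 / 20) := by
        have := exp_neg_le_one_div_twenty (l := l / 2) (by linarith)
        gcongr
    _ ≤ _ := by norm_num

lemma link_bound (S : Scale ε δ A n k m q g l K) (hA : 100 ≤ A) :
    Real.exp 1 * m ≤ (g ^ 10)⁻¹ * (q : ℝ) ^ 2 * Real.exp (-(δ / 4 * l)) := by
  have hg := S.g_pos
  have h1 : Real.exp (-(δ / 4 * l)) = (g ^ 5)⁻¹ := by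
    rw [S.g_pow, ← Real.exp_neg]; push_cast; ring_nf
  have h2 : (g ^ 10)⁻¹ * (q : ℝ) ^ 2 * (g ^ 5)⁻¹ = (q : ℝ) ^ 2 / g ^ 15 := by field_simp
  rw [h1, h2, le_div_iff₀ (by positivity)]
  refine le_trans ?_ (S.m_mul_le_q_sq hA)
  gcongr
  linarith [Real.exp_one_lt_d9]

lemma link_tail (S : Scale ε δ A n k m q g l K) (hA : 100 ≤ A) (hδ : 0 < δ)
    (hAδ : 400 / δ ≤ A) :
    Real.exp (-(δ / 4 * l * (g ^ 10)⁻¹ * g ^ 20)) ≤ Real.exp (-(2 * l)) := by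
  have hl := S.l_ge hA
  have hg := S.g_ge hA
  have h2 : 400 ≤ δ * g := by
    rw [mul_comm]; exact (div_le_iff₀ hδ).1 (hAδ.trans (S.A_le_g hA))
  have h1 : δ / 4 * l * (g ^ 10)⁻¹ * g ^ 20 = δ * g ^ 10 * l / 4 := by field_simp
  have h3 := S.pow_g_le hA (i := 1) (j := 10) (by norm_num)
  have h4 : 400 * l ≤ δ * g ^ 10 * l := by
    gcongr
    refine h2.trans ?_
    gcongr
    linarith
  rw [Real.exp_le_exp, neg_le_neg_iff, h1]
  linarith

lemma triangle_bound (S : Scale ε δ A n k m q g l K) (hε : 0 < ε) (hA : 100 ≤ A) (hδ : 0 < δ)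
    (hδ1 : δ ≤ 1) {t : ℕ} (ht : 4 / δ * k ≤ t) :
    (m : ℝ) ^ k * (Real.exp 1 * (k ^ 2 * m : ℕ) / t * (1 / (q : ℝ)) ^ 3) ^ t ≤ 1 / 20 := by
  have hm := S.m_pos
  have hq := S.q_pos
  have hk := S.k_pos hε
  have hl := S.l_ge hA
  have hg := S.g_ge hA
  have hkt : (k : ℝ) ≤ t := by
    refine le_trans ?_ ht
    have : 1 ≤ 4 / δ := by rw [le_div_iff₀ hδ]; linarith
    nlinarith
  have ht0 : (0 : ℝ) < t := hk.trans_le hkt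
  have h1 : Real.exp 1 * (k ^ 2 * m : ℕ) / t * (1 / (q : ℝ)) ^ 3 ≤ (g ^ 14)⁻¹ := by
    calc Real.exp 1 * (k ^ 2 * m : ℕ) / t * (1 / (q : ℝ)) ^ 3
        = Real.exp 1 * (k / t) * (k / q) * (m / q ^ 2) := by push_cast; field_simp
      _ ≤ 3 * 1 * (3 / 2 * l) * (1 / (3 * g ^ 15)) := by
          refine mul_le_mul (mul_le_mul (mul_le_mul ?_ ?_ (by positivity) (by norm_num))
            S.k_div_q_le (by positivity) (by norm_num)) ?_ (by positivity) (by positivity)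
          · linarith [Real.exp_one_lt_d9]
          · exact div_le_one_of_le₀ hkt ht0.le
          · rw [div_le_div_iff₀ (by positivity) (by positivity)]
            linarith [S.m_mul_le_q_sq hA]
      _ = 3 / 2 * l / g * (g ^ 14)⁻¹ := by field_simp
      _ ≤ 1 * (g ^ 14)⁻¹ := by
          gcongr
          rw [div_le_one (by positivity)]
          linarith [S.l_le_g hA]
      _ = _ := one_mul _
  calc (m : ℝ) ^ k * (Real.exp 1 * (k ^ 2 * m : ℕ) / t * (1 / (q : ℝ)) ^ 3) ^ t
      ≤ Real.exp l ^ k * ((g ^ 14)⁻¹) ^ t := by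
        rw [S.exp_l]; gcongr; exact_mod_cast S.m_le_n hA
    _ = Real.exp (k * l + -(((14 * t : ℕ) : ℝ) * (δ / 20 * l))) := by
        rw [inv_pow, ← pow_mul, S.g_pow, ← Real.exp_neg, ← Real.exp_nat_mul, ← Real.exp_add]
    _ ≤ Real.exp (-l) := by
        rw [Real.exp_le_exp]
        push_cast
        have h1 : 4 * k ≤ δ * t := by
          calc 4 * (k : ℝ) = δ * (4 / δ * k) := by field_simp
            _ ≤ _ := by gcongr
        have h2 := mul_le_mul_of_nonneg_right h1 (by linarith : 0 ≤ l)
        have h3 : (2 : ℝ) ≤ k := by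
          have := S.pow_mul_g_le_k hε hA (i := 0) (by norm_num)
          linarith
        have h4 := mul_le_mul_of_nonneg_right h3 (by linarith : 0 ≤ l)
        linarith
    _ ≤ _ := exp_neg_le_one_div_twenty (by linarith)

lemma floor_n_div_m_le (S : Scale ε δ A n k m q g l K) {x : ℝ} (hx0 : 0 ≤ x) (hx2 : x ≤ 2) :
    (⌊x * (n / m : ℝ)⌋₊ : ℝ) ≤ 2 * g ^ 20 := by
  have hg := S.g_pos
  refine (Nat.floor_le (by positivity)).trans ?_
  gcongr
  exact S.n_div_m_le

lemma floor_m_div_q_le (S : Scale ε δ A n k m q g l K) {x : ℝ} (hx0 : 0 ≤ x) (hx2 : x ≤ 2) :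
    (⌊x * (m / q : ℝ)⌋₊ : ℝ) ≤ 2 * (K / g ^ 20) := by
  have hg := S.g_pos
  exact (Nat.floor_le (by positivity)).trans
    (mul_le_mul hx2 S.m_div_q_le (by positivity) two_pos.le)

lemma floor_mul_floor_le (S : Scale ε δ A n k m q g l K) (hε0 : 0 < ε) (hε1 : ε ≤ 1) :
    (⌊(1 + ε / 8) * (m / q : ℝ)⌋₊ * ⌊(1 + ε / 8) * (n / m : ℝ)⌋₊ : ℝ) ≤
      (1 + ε / 2) / (2 * (1 + ε)) * k := by
  have hm := S.m_pos
  have hq := S.q_pos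
  have hK := S.K_pos
  calc (⌊(1 + ε / 8) * (m / q : ℝ)⌋₊ * ⌊(1 + ε / 8) * (n / m : ℝ)⌋₊ : ℝ)
      ≤ ((1 + ε / 8) * (m / q)) * ((1 + ε / 8) * (n / m)) := by
        gcongr <;> exact Nat.floor_le (by positivity)
    _ = (1 + ε / 8) ^ 2 * (n / q) := by field_simp
    _ ≤ (1 + ε / 2) * (K / 2) := by
        refine mul_le_mul (by nlinarith) ?_ (by positivity) (by positivity)
        rw [div_le_div_iff₀ hq two_pos]
        linarith [S.le_q_mul]
    _ = (1 + ε / 2) / (2 * (1 + ε)) * ((1 + ε) * K) := by field_simp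
    _ ≤ _ := by gcongr; exact S.le_k

end Scale

namespace Scale
variable {ε δ A : ℝ} {n k m q : ℕ} {g l K : ℝ}

lemma hundred_mul_l_le_k (S : Scale ε δ A n k m q g l K) (hε : 0 < ε) (hA : 100 ≤ A) :
    100 * l ≤ k := by
  have h1 := S.pow_mul_g_le_k hε hA (i := 0) (by norm_num)
  linarith [S.l_le_g hA]

lemma cover_bound (S : Scale ε δ A n k m q g l K) (hε : 0 < ε) (hA : 100 ≤ A) {F C L : ℕ}
    {t : ℝ} (hF : (F : ℝ) ≤ 2 * g ^ 20) (hLt : 2 ≤ L * t) (hAL : 2 * L ^ 2 * C ≤ A) :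
    (k : ℝ) + L ^ 2 * (C * F) < L * (t * k) := by
  have hk := S.k_pos hε
  have hg := S.g_ge hA
  have h1 : (L : ℝ) ^ 2 * (C * F) ≤ A * g ^ 20 := by
    calc (L : ℝ) ^ 2 * (C * F) ≤ L ^ 2 * (C * (2 * g ^ 20)) := by gcongr
      _ = 2 * L ^ 2 * C * g ^ 20 := by ring
      _ ≤ _ := by gcongr
  have h2 : A * g ^ 20 < g ^ 21 * g := by
    have h3 := S.A_le_g hA
    calc A * g ^ 20 ≤ g * g ^ 20 := by gcongr
      _ = g ^ 21 * 1 := by ring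
      _ < g ^ 21 * g := by gcongr; linarith
  have h3 := S.pow_mul_g_le_k hε hA (i := 21) (by norm_num)
  have h4 := mul_le_mul_of_nonneg_right hLt hk.le
  linarith

lemma uncovered_bound (S : Scale ε δ A n k m q g l K) (hε : 0 < ε) (hA : 100 ≤ A) {F C L : ℕ}
    {t C₁ c : ℝ} (hF : (F : ℝ) ≤ 2 * g ^ 20) (hc : 0 < c) (ht : 4 * (t * C₁) ≤ c)
    (hAL : 2 * (10 + 4 * L ^ 2 * C) / c ≤ A) :
    2 * (t * k * C₁ * k) + (g ^ 2) ^ 2 * (2 * F * k + (g ^ 10)⁻¹ * (k + F * g ^ 20) ^ 2) + k * F +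
      2 * (L ^ 2 * (C * F) * k) ≤ c * k ^ 2 := by
  have hk := S.k_pos hε
  have hg := S.g_ge hA
  have hgk : ∀ i ≤ 99, g ^ i * g ≤ k := fun i hi => S.pow_mul_g_le_k hε hA hi
  have hgi : ∀ i ≤ 98, g * g ^ i ≤ k := fun i hi => by
    rw [mul_comm]; exact hgk i (by omega)
  have hF0 : (0 : ℝ) ≤ F := by positivity
  have hgk' : ∀ i ≤ 98, g ^ i * k ≤ k ^ 2 / g := by
    intro i hi
    rw [le_div_iff₀ (by positivity)]
    nlinarith [hgi i hi]
  have e1 : (g ^ 2) ^ 2 * (2 * F * k) ≤ 4 * (k ^ 2 / g) := by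
    calc (g ^ 2) ^ 2 * (2 * F * k) ≤ (g ^ 2) ^ 2 * (2 * (2 * g ^ 20) * k) := by gcongr
      _ = 4 * (g ^ 24 * k) := by ring
      _ ≤ _ := by gcongr; exact hgk' 24 (by norm_num)
  have e2 : (g ^ 2) ^ 2 * ((g ^ 10)⁻¹ * (k + F * g ^ 20) ^ 2) ≤ 4 * (k ^ 2 / g) := by
    have h1 : F * g ^ 20 ≤ k := by
      calc F * g ^ 20 ≤ 2 * g ^ 20 * g ^ 20 := by gcongr
        _ ≤ g * g ^ 20 * g ^ 20 := by gcongr; linarith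
        _ = g ^ 40 * g := by ring
        _ ≤ k := hgk 40 (by norm_num)
    calc (g ^ 2) ^ 2 * ((g ^ 10)⁻¹ * (k + F * g ^ 20) ^ 2)
        ≤ (g ^ 2) ^ 2 * ((g ^ 10)⁻¹ * (k + k) ^ 2) := by gcongr
      _ = 4 * (k ^ 2 / g ^ 6) := by field_simp; ring
      _ ≤ 4 * (k ^ 2 / g ^ 1) := by gcongr 4 * (k ^ 2 / ?_); exact S.pow_g_le hA (by norm_num)
      _ = _ := by rw [pow_one]
  have e3 : k * F ≤ 2 * (k ^ 2 / g) := by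
    calc k * F ≤ k * (2 * g ^ 20) := by gcongr
      _ = 2 * (g ^ 20 * k) := by ring
      _ ≤ _ := by gcongr; exact hgk' 20 (by norm_num)
  have e4 : 2 * (L ^ 2 * (C * F) * k) ≤ 4 * L ^ 2 * C * (k ^ 2 / g) := by
    calc 2 * (L ^ 2 * (C * F) * k) ≤ 2 * (L ^ 2 * (C * (2 * g ^ 20)) * k) := by gcongr
      _ = 4 * L ^ 2 * C * (g ^ 20 * k) := by ring
      _ ≤ _ := by gcongr; exact hgk' 20 (by norm_num)
  have e5 : (10 + 4 * L ^ 2 * C) * (k ^ 2 / g) ≤ c / 2 * k ^ 2 := by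
    have h1 : 2 * (10 + 4 * L ^ 2 * C) ≤ g * c := (div_le_iff₀ hc).1 (hAL.trans (S.A_le_g hA))
    rw [← mul_div_assoc, div_le_iff₀ (by positivity)]
    calc (10 + 4 * L ^ 2 * C) * (k : ℝ) ^ 2 ≤ (g * c / 2) * k ^ 2 := by gcongr; linarith
      _ = _ := by ring
  have e6 : 4 * (t * C₁) * k ^ 2 ≤ c * k ^ 2 := by gcongr
  linarith

lemma one_le_mul_k (S : Scale ε δ A n k m q g l K) (hε : 0 < ε) (hA : 100 ≤ A) {c : ℝ}
    (hc : 0 < c) (hAc : 1 / c ≤ A) : 1 ≤ c * k := by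
  have hg := S.g_ge hA
  have h1 : 1 ≤ g * c := (div_le_iff₀ hc).1 (hAc.trans (S.A_le_g hA))
  have h2 := S.pow_mul_g_le_k hε hA (i := 0) (by norm_num)
  rw [pow_zero, one_mul] at h2
  nlinarith

lemma closed_bound (S : Scale ε δ A n k m q g l K) (hε : 0 < ε) (hA : 100 ≤ A) {c η x : ℝ}
    (hη : 0 < η) (hx : x = Real.exp (1 / η)) (hc : c = 1 / (12 * x)) (hAc : 1 / c ≤ A) :
    (n.choose k : ℝ) * Real.exp (x * ⌈c * k ^ 2⌉₊ / q - ⌈η * (k * l)⌉₊ * Real.log x) ≤ 1 / 20 := by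
  have hk := S.k_pos hε
  have hq := S.q_pos
  have hl := S.l_ge hA
  have hkl := S.hundred_mul_l_le_k hε hA
  have hx0 : 0 < x := hx ▸ Real.exp_pos _
  have hc0 : 0 < c := by rw [hc]; positivity
  have hM : (⌈c * k ^ 2⌉₊ : ℝ) ≤ 2 * (c * k ^ 2) := by
    have h1 := (Nat.ceil_lt_add_one (by positivity : 0 ≤ c * (k : ℝ) ^ 2)).le
    have h2 := S.one_le_mul_k hε hA hc0 hAc
    nlinarith
  have h1 : x * ⌈c * k ^ 2⌉₊ / q ≤ k * l / 4 := by
    calc x * ⌈c * k ^ 2⌉₊ / q ≤ x * (2 * (c * k ^ 2)) / q := by gcongr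
      _ = k / 6 * (k / q) := by rw [hc]; field_simp; norm_num
      _ ≤ k / 6 * (3 / 2 * l) := mul_le_mul_of_nonneg_left S.k_div_q_le (by positivity)
      _ = _ := by ring
  have h2 : k * l ≤ ⌈η * (k * l)⌉₊ * Real.log x := by
    rw [hx, Real.log_exp, mul_one_div, le_div_iff₀ hη, mul_comm]
    exact Nat.le_ceil _
  calc (n.choose k : ℝ) * Real.exp (x * ⌈c * k ^ 2⌉₊ / q - ⌈η * (k * l)⌉₊ * Real.log x)
      ≤ Real.exp (k * l / 2) * Real.exp (k * l / 4 - k * l) := by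
        gcongr; exact S.choose_le hε hA
    _ = Real.exp (-(k * l / 4)) := by rw [← Real.exp_add]; ring_nf
    _ ≤ _ := exp_neg_le_one_div_twenty (by nlinarith)

lemma union_bound (S : Scale ε δ A n k m q g l K) (hε : 0 < ε) (hA : 100 ≤ A) {c : ℝ}
    (hc : 0 < c) (hAc : 16 / c ≤ A) :
    (n.choose k : ℝ) * (((k : ℝ) + 1) ^ 2 * Real.exp (-((1 / 2 + c / 4) * (k * l)))) ≤ 1 / 20 := by
  have hk := S.k_pos hε
  have hl := S.l_ge hA
  have hkl := S.hundred_mul_l_le_k hε hA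
  have h1 : 16 ≤ l * c := (div_le_iff₀ hc).1 (hAc.trans S.A_le)
  have h2 : ((k : ℝ) + 1) ^ 2 ≤ Real.exp (2 * k) := by
    rw [two_mul, Real.exp_add, ← sq]
    gcongr
    exact Real.add_one_le_exp _
  calc (n.choose k : ℝ) * (((k : ℝ) + 1) ^ 2 * Real.exp (-((1 / 2 + c / 4) * (k * l))))
      ≤ Real.exp (k * l / 2) * (Real.exp (2 * k) * Real.exp (-((1 / 2 + c / 4) * (k * l)))) := by
        gcongr; exact S.choose_le hε hA
    _ = Real.exp (2 * k - l * c / 4 * k) := by rw [← Real.exp_add, ← Real.exp_add]; ring_nf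
    _ ≤ Real.exp (-k) := by
        rw [Real.exp_le_exp]; nlinarith
    _ ≤ _ := exp_neg_le_one_div_twenty (by linarith)

lemma error_bound (S : Scale ε δ A n k m q g l K) (hε : 0 < ε) (hA : 100 ≤ A) {c τ η Λ B : ℝ}
    {L t C : ℕ} (hc : 0 < c) (hΛ : 0 ≤ Λ) (hη : η = c / (40 * (Λ + 1))) (hτ : τ = c / 100)
    (hδ : δ ≤ c / 100) (ht : (t : ℝ) ≤ B * k)
    (hAc : 100 * (2 * (1 + Real.log (L + 1)) + 2 * (B * (3 * (1 + 2 * C))) * Λ + 2 * Λ + 2) / c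
      ≤ A) :
    5 / 2 * τ * (k * l) + 4 * δ * (k * l) + 2 * k * (1 + Real.log (L + 1)) +
      2 * (t * (3 * (1 + 2 * C)) + ⌈η * (k * l)⌉₊ : ℕ) * Λ + k / q ≤ c / 4 * (k * l) := by
  have hk := S.k_pos hε
  have hl := S.l_ge hA
  have hkl := S.hundred_mul_l_le_k hε hA
  have hη0 : 0 < η := by rw [hη]; positivity
  have h1 : 100 * (2 * (1 + Real.log (L + 1)) + 2 * (B * (3 * (1 + 2 * C))) * Λ + 2 * Λ + 2) ≤
      l * c := (div_le_iff₀ hc).1 (hAc.trans S.A_le)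
  have h2 := mul_le_mul_of_nonneg_right h1 hk.le
  have h3 := (Nat.ceil_lt_add_one (by positivity : 0 ≤ η * (k * l))).le
  have h4 : η * (k * l) * Λ ≤ c / 40 * (k * l) := by
    have h5 : η * Λ ≤ c / 40 := by
      rw [hη, div_mul_eq_mul_div, div_le_div_iff₀ (by positivity) (by norm_num)]
      nlinarith
    calc η * (k * l) * Λ = η * Λ * (k * l) := by ring
      _ ≤ _ := by gcongr
  have h5 : (t : ℝ) * (3 * (1 + 2 * C)) * Λ ≤ B * k * (3 * (1 + 2 * C)) * Λ := by gcongr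
  have h6 : δ * (k * l) ≤ c / 100 * (k * l) := by gcongr
  have h7 : (⌈η * (k * l)⌉₊ : ℝ) * Λ ≤ (η * (k * l) + 1) * Λ := by gcongr
  have h8 : Λ ≤ k * Λ := le_mul_of_one_le_left hΛ (by linarith)
  have h9 : (k : ℝ) / q ≤ k := S.k_div_q_le.trans (by linarith)
  have h10 : 0 ≤ c * (k * l) := by positivity
  push_cast
  rw [hτ]
  linarith

end Scale

section fiber
open scoped Classical

lemma pr_not_fiber_le {ι V : Type*} [Fintype ι] [Fintype V] [Nonempty V] {F : ℕ}
    {x y : ℝ} (hx : 1 ≤ x) (hy : y < F + 1) : pr (fun b : ι → V => ¬ ∀ v, #{i | b i = v} ≤ F) ≤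
      Fintype.card V * Real.exp ((x - 1) * Fintype.card ι / Fintype.card V - y * Real.log x) := by
  refine (pr_mono fun b hb => ?_).trans (pr_exists_lt_fiber_le (F := y) hx)
  push Not at hb
  obtain ⟨v, hv⟩ := hb
  exact ⟨v, hy.trans_le (by exact_mod_cast hv)⟩

end fiber

set_option maxHeartbeats 1000000 in
lemma Scale.exists_graph {ε δ A g K l c θ η c' x C₁ t : ℝ} {n k m q C L : ℕ}
    (S : Scale ε δ A n k m q g l K) (hε0 : 0 < ε) (hε1 : ε ≤ 1)
    (hθ : θ = (1 + ε / 2) / (2 * (1 + ε))) (hc : c = (1 - 2 * θ) ^ 2 / 32)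
    (hδ : δ = c / 100) (hη : η = c / (40 * (Real.log (ε / 4 / (1 + ε))⁻¹ + 1)))
    (hx : x = Real.exp (1 / η)) (hc' : c' = 1 / (12 * x)) (hC₁ : C₁ = 160 / δ)
    (ht : t = c' / (4 * C₁)) (hL : 2 / t ≤ L) (hC : 4 / δ ≤ C) (hA : 100 ≤ A)
    (hA₁ : 4 / ((1 + ε / 8) * Real.log (1 + ε / 8) - ((1 + ε / 8) - 1)) ≤ A)
    (hA₂ : 400 / δ ≤ A) (hA₃ : 2 * L ^ 2 * C ≤ A)
    (hA₄ : 2 * (10 + 4 * L ^ 2 * C) / c' ≤ A) (hA₅ : 16 / c ≤ A)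
    (hA₆ : 100 * (2 * (1 + Real.log (L + 1)) + 2 * ((4 / δ + 1) * (3 * (1 + 2 * C))) *
      Real.log (ε / 4 / (1 + ε))⁻¹ + 2 * Real.log (ε / 4 / (1 + ε))⁻¹ + 2) / c ≤ A)
    (hA₇ : 200 * L / c ≤ A) :
    ∃ G : SimpleGraph (Fin n), G.CliqueFree 3 ∧
      ∀ I : Finset (Fin n), (I : Set (Fin n)).Pairwise (fun u v => ¬ G.Adj u v) → #I < k := by
  have hm := S.m_pos
  have hq := S.q_pos
  have hn := S.n_pos
  have hk := S.k_pos hε0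
  have hK := S.K_pos
  have hg := S.g_ge hA
  have hl := S.l_ge hA
  have hkl := S.hundred_mul_l_le_k hε0 hA
  have hlam0 : 0 < ε / 4 / (1 + ε) := by positivity
  have hlam1 : ε / 4 / (1 + ε) ≤ 1 := by rw [div_le_one (by positivity)]; linarith
  have hΛ : 0 ≤ Real.log (ε / 4 / (1 + ε))⁻¹ :=
    Real.log_nonneg ((one_le_inv₀ hlam0).2 hlam1)
  have hθgap : 1 - 2 * θ = ε / 2 / (1 + ε) := by rw [hθ]; field_simp; ring
  have hθ0 : 0 < 1 - 2 * θ := by rw [hθgap]; positivity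
  have hθε : 1 - 2 * θ ≤ ε := by
    rw [hθgap, div_le_iff₀ (by positivity)]; nlinarith
  have hc0 : 0 < c := by rw [hc]; positivity
  have hc1 : c ≤ 1 := by rw [hc]; nlinarith
  have hδ0 : 0 < δ := by rw [hδ]; positivity
  have hη0 : 0 < η := by rw [hη]; positivity
  have hx0 : 0 < x := by rw [hx]; positivity
  have hx1 : 1 ≤ x := by rw [hx]; exact Real.one_le_exp (by positivity)
  have hc'0 : 0 < c' := by rw [hc']; positivity
  have hC₁0 : 0 < C₁ := by rw [hC₁]; positivity
  have ht0 : 0 < t := by rw [ht]; positivity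
  have hm' : 0 < m := by exact_mod_cast hm
  have hq' : 0 < q := by exact_mod_cast hq
  have hk' : 0 < k := by exact_mod_cast hk
  have : Nonempty (Fin m) := ⟨⟨0, hm'⟩⟩
  have : Nonempty (Fin q) := ⟨⟨0, hq'⟩⟩
  have hF := S.floor_n_div_m_le (x := 1 + ε / 8) (by positivity) (by linarith)
  have hD := S.floor_m_div_q_le (x := 1 + ε / 8) (by positivity) (by linarith)
  have hDF := S.floor_mul_floor_le hε0 hε1
  have hF' := Nat.lt_floor_add_one ((1 + ε / 8) * (n / m : ℝ))
  have hD' := S.degree_bound hε1 hA (x := 1 + ε / 8) (by linarith) (by linarith) hA₁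
  set F := ⌊(1 + ε / 8) * (n / m : ℝ)⌋₊ with hFdef
  set D := ⌊(1 + ε / 8) * (m / q : ℝ)⌋₊ with hDdef
  set T := ⌈4 / δ * k⌉₊ with hTdef
  have hT : 4 / δ * k ≤ T := Nat.le_ceil _
  have hT' : (T : ℝ) ≤ (4 / δ + 1) * k := by
    have := (Nat.ceil_lt_add_one (by positivity : 0 ≤ 4 / δ * (k : ℝ))).le
    linarith
  have hLD : (L * D : ℝ) ≤ c / 100 * k := by
    have h1 : 200 * L ≤ g ^ 20 * c := by
      refine (div_le_iff₀ hc0).1 ((hA₇.trans (S.A_le_g hA)).trans ?_)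
      have := S.pow_g_le hA (i := 1) (j := 20) (by norm_num)
      linarith
    calc (L * D : ℝ) ≤ L * (2 * (K / g ^ 20)) := by gcongr
      _ = 200 * L * (K / 100 / g ^ 20) := by ring
      _ ≤ g ^ 20 * c * (K / 100 / g ^ 20) := by gcongr
      _ = c / 100 * K := by field_simp
      _ ≤ _ := by gcongr; exact S.K_le_k hε0
  have hlogg := S.log_g
  clear_value F D T
  refine exists_graph_of_bounds (V := Fin m) (κ := Fin q) ⟨0, hq'⟩ (k := k) (D := D) (F := F)
    (C := C) (L := L) (M := ⌈c' * k ^ 2⌉₊) (J₃ := T * (3 * (1 + 2 * C)))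
    (J₄ := ⌈η * (k * l)⌉₊) (h := g ^ 2) (C₁ := C₁) (u := (g ^ 10)⁻¹) (σ := g ^ 20) (t := t * k)
    (x := x) (x' := ε / 4 / (1 + ε)) (B := Real.exp (-((1 / 2 + c / 4) * (k * l))))
    (by positivity) hC₁0.le (by positivity) (by positivity) (by positivity) hx1 hlam0 hlam1
    (S.cover_bound hε0 hA hF ((div_le_iff₀ ht0).1 hL) hA₃) ?_ ?_ ?_ ?_ ?_ ?_
  · refine (S.uncovered_bound hε0 hA hF hc'0 ?_ hA₄).trans (Nat.le_ceil _)
    rw [ht]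
    exact le_of_eq (by field_simp)
  · refine (pr_not_fiber_le (ι := Fin n) (V := Fin m) (x := 1 + ε / 8)
      (y := (1 + ε / 8) * (n / m)) (by linarith) hF').trans ?_
    simp only [Fintype.card_fin]
    exact S.fiber_bound hA (by linarith) hA₁
  · refine pr_not_regular_le (x := 1 + ε / 8) (x' := g) (Y := δ / 4 * l)
      (β := Real.exp (-(2 * l))) (t := T) _ hC₁0.le (by positivity) (by positivity) (by positivity)
      (by linarith) (by linarith) ?_ le_rfl ?_ ?_ ?_ ?_ ?_ ?_ ?_ ?_ ?_
    · rw [Fintype.card_fin]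
      exact_mod_cast S.k_le_m hA
    · simp only [Fintype.card_fin]
      exact hD'
    · simp only [Fintype.card_fin]
      exact S.codegree_bound hA (by rw [mul_comm]; exact (div_le_iff₀ hδ0).1 hC) hδ0
    · simp only [Fintype.card_fin]
      exact S.heavy_bound hA hδ0 hA₂
    · rw [hlogg, hC₁]
      exact (congrArg Real.exp (by field_simp; norm_num)).le
    · exact S.heavy_tail hA hδ0 hA₂
    · simp only [Fintype.card_fin]
      exact S.six_mul_exp_le hA
    · simp only [Fintype.card_fin]
      exact S.link_bound hA
    · exact S.link_tail hA hδ0 hA₂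
    · simp only [Fintype.card_fin]
      exact S.triangle_bound hε0 hA hδ0 (by linarith) hT
  · simp only [Fintype.card_fin]
    refine S.closed_bound hε0 hA hη0 hx hc' (le_trans ?_ hA₄)
    gcongr
    have : (0 : ℝ) ≤ 4 * L ^ 2 * C := by positivity
    linarith
  · intro a y s s' Q Q' N N' ha hy hs hs' h₁ h₂ h₁' h₂' hN hN'
    simp only [Fintype.card_fin]
    refine exp_bound_of_overlap (ε := ε) (θ := θ) (δ := δ) (τ := c / 100) hε0.le hε1 (by linarith)
      hθε (by linarith) hc hk' hm' hq' (by linarith) hlam0.le (by rw [hθ]; exact hDF) hLD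
      (S.le_k_div_q hε0 hε1 hA) (S.log_k_div_m_le hε0 hA) hδ0.le ?_ ha hy hs hs' h₁ h₂ h₁' h₂'
      hN hN'
    exact S.error_bound hε0 hA hc0 hΛ hη rfl hδ.le hT' hA₆
  · simp only [Fintype.card_fin]
    exact S.union_bound hε0 hA hc0 hA₅

lemma eventually_exists_graph {ε : ℝ} (hε0 : 0 < ε) (hε1 : ε ≤ 1) :
    ∀ᶠ n : ℕ in atTop, ∃ G : SimpleGraph (Fin n), G.CliqueFree 3 ∧
      ∀ I : Finset (Fin n), (I : Set (Fin n)).Pairwise (fun u v => ¬ G.Adj u v) →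
        #I < ⌈(1 + ε) * Real.sqrt (n * Real.log n)⌉₊ := by
  obtain ⟨θ, hθ⟩ : ∃ θ, θ = (1 + ε / 2) / (2 * (1 + ε)) := ⟨_, rfl⟩
  obtain ⟨c, hc⟩ : ∃ c, c = (1 - 2 * θ) ^ 2 / 32 := ⟨_, rfl⟩
  obtain ⟨δ, hδ⟩ : ∃ δ, δ = c / 100 := ⟨_, rfl⟩
  obtain ⟨η, hη⟩ : ∃ η, η = c / (40 * (Real.log (ε / 4 / (1 + ε))⁻¹ + 1)) := ⟨_, rfl⟩
  obtain ⟨x, hx⟩ : ∃ x, x = Real.exp (1 / η) := ⟨_, rfl⟩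
  obtain ⟨c', hc'⟩ : ∃ c', c' = 1 / (12 * x) := ⟨_, rfl⟩
  obtain ⟨C₁, hC₁⟩ : ∃ C₁, C₁ = 160 / δ := ⟨_, rfl⟩
  obtain ⟨t, ht⟩ : ∃ t, t = c' / (4 * C₁) := ⟨_, rfl⟩
  obtain ⟨L, hL⟩ := exists_nat_ge (2 / t)
  obtain ⟨C, hC⟩ := exists_nat_ge (4 / δ)
  obtain ⟨A, ⟨⟨⟨⟨⟨⟨⟨hA, hA₁⟩, hA₂⟩, hA₃⟩, hA₄⟩, hA₅⟩, hA₆⟩, hA₇⟩⟩ := (((((((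
    (eventually_ge_atTop (100 : ℝ)).and
    (eventually_ge_atTop
      (4 / ((1 + ε / 8) * Real.log (1 + ε / 8) - ((1 + ε / 8) - 1))))).and
    (eventually_ge_atTop (400 / δ))).and
    (eventually_ge_atTop (2 * (L : ℝ) ^ 2 * C))).and
    (eventually_ge_atTop (2 * (10 + 4 * (L : ℝ) ^ 2 * C) / c'))).and
    (eventually_ge_atTop (16 / c))).and
    (eventually_ge_atTop (100 * (2 * (1 + Real.log (L + 1)) +
      2 * ((4 / δ + 1) * (3 * (1 + 2 * C))) * Real.log (ε / 4 / (1 + ε))⁻¹ +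
      2 * Real.log (ε / 4 / (1 + ε))⁻¹ + 2) / c))).and
    (eventually_ge_atTop (200 * L / c))).exists
  have hθgap : 1 - 2 * θ = ε / 2 / (1 + ε) := by rw [hθ]; field_simp; ring
  have hθ0 : 0 < 1 - 2 * θ := by rw [hθgap]; positivity
  have hθ1 : 1 - 2 * θ ≤ 1 := by rw [hθgap, div_le_one (by positivity)]; linarith
  have hδ0 : 0 < δ := by rw [hδ, hc]; positivity
  have hδ1 : δ ≤ 1 / 10 := by rw [hδ, hc]; nlinarith
  filter_upwards [eventually_scale hε0 hε1 hδ0 hδ1 A] with n ⟨m, q, g, S⟩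
  exact S.exists_graph hε0 hε1 hθ hc hδ hη hx hc' hC₁ ht hL hC hA hA₁ hA₂ hA₃ hA₄ hA₅ hA₆ hA₇

end TwoBites

/-- **Main theorem.** For every real `ε > 0` there exists `n₀ = n₀(ε)` such that for every
integer `n ≥ n₀` there exists a triangle-free simple graph `G` on `n` vertices with
independence number `α(G) < (1+ε)·√(n·log n)` (i.e. every independent set of `G` has
size `< (1+ε)·√(n·log n)`). -/
theorem exists_triangle_free_small_independence (ε : ℝ) (hε : 0 < ε) :
    ∃ n₀ : ℕ, ∀ n : ℕ, n₀ ≤ n →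
      ∃ G : SimpleGraph (Fin n), G.CliqueFree 3 ∧
        ∀ s : Finset (Fin n), (↑s : Set (Fin n)).Pairwise (fun u v => ¬ G.Adj u v) →
          (s.card : ℝ) < (1 + ε) * Real.sqrt (n * Real.log n) := by
  obtain ⟨n₀, h⟩ := Filter.eventually_atTop.1
    (TwoBites.eventually_exists_graph (lt_min hε one_pos) (min_le_right ε 1))
  refine ⟨n₀, fun n hn => ?_⟩
  obtain ⟨G, hG, hI⟩ := h n hn
  refine ⟨G, hG, fun s hs => (Nat.lt_ceil.1 (hI s hs)).trans_le ?_⟩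
  gcongr
  exact min_le_left ε 1
end

section
/- Let k ≥ 3 and let m be a positive integer such that every simple graph on m vertices contains a triangle or an independent set of size k−1 (i.e., m ≥ R(3,k−1)). Then every 2-coloring (red/blue) of all 3-element subsets of a set of m+1 elements contains a red copy of S₄^{(3)} or a blue copy of S_k^{(3)}. In particular, R(S₄^{(3)}, S_k^{(3)}) ≤ R(3,k−1) + 1. -/
namespace HypergraphRamsey

/-- A red copy of `S₄⁽³⁾` in a red/blue coloring (`true` = red) of the 3-element subsets:
four distinct vertices `a,b,c,d` with `{a,b,c}`, `{a,b,d}`, `{a,c,d}` all red. -/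
def hasRedS4 {V : Type*} [DecidableEq V] (col : Finset V → Bool) : Prop :=
  ∃ a b c d : V, a ≠ b ∧ a ≠ c ∧ a ≠ d ∧ b ≠ c ∧ b ≠ d ∧ c ≠ d ∧
    col {a, b, c} = true ∧ col {a, b, d} = true ∧ col {a, c, d} = true

/-- A blue copy of `S_k⁽³⁾` in a red/blue coloring (`false` = blue) of the 3-element subsets:
a center `v` and `k−1` further vertices such that every triple consisting of `v` and two of
the other vertices is blue. -/
def hasBlueSk {V : Type*} [DecidableEq V] (k : ℕ) (col : Finset V → Bool) : Prop :=
  ∃ v : V, ∃ s : Finset V, v ∉ s ∧ s.card = k - 1 ∧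
    ∀ i ∈ s, ∀ j ∈ s, i ≠ j → col {v, i, j} = false

/-- The red link of `v`, pulled back along `f`: distinct `i`, `j` are adjacent when the triple
`{v, f i, f j}` is red. -/
def redLink {V W : Type*} [DecidableEq V] (col : Finset V → Bool) (v : V) (f : W → V) :
    SimpleGraph W where
  Adj i j := i ≠ j ∧ col {v, f i, f j} = true
  symm := ⟨fun i j h => ⟨h.1.symm, by rw [Finset.pair_comm]; exact h.2⟩⟩
  loopless := ⟨fun _ h => h.1 rfl⟩

/-- **Upper bound `R(S₄⁽³⁾, S_k⁽³⁾) ≤ R(3,k−1) + 1`.** Let `k ≥ 3` and let `m` be a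
positive integer such that every simple graph on `m` vertices contains a triangle or an
independent set of size `k−1` (i.e. `m ≥ R(3,k−1)`). Then every red/blue coloring of the
3-element subsets of a set of `m+1` elements contains a red copy of `S₄⁽³⁾` or a blue copy
of `S_k⁽³⁾`. -/
theorem star_ramsey_upper (k m : ℕ) (hk : 3 ≤ k) (hm : 0 < m)
    (hram : ∀ G : SimpleGraph (Fin m), ¬ G.CliqueFree 3 ∨
      ∃ s : Finset (Fin m), s.card = k - 1 ∧
        (↑s : Set (Fin m)).Pairwise (fun u v => ¬ G.Adj u v)) :
    ∀ col : Finset (Fin (m + 1)) → Bool, hasRedS4 col ∨ hasBlueSk k col := by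
  intro col
  have hsucc := Fin.succ_injective m
  rcases hram (redLink col 0 Fin.succ) with hG | ⟨s, hcard, hs⟩
  · left
    simp only [SimpleGraph.CliqueFree, not_forall, not_not] at hG
    obtain ⟨t, ht⟩ := hG
    obtain ⟨a, b, c, hab, hac, hbc, -⟩ := SimpleGraph.is3Clique_iff.1 ht
    exact ⟨0, a.succ, b.succ, c.succ, (Fin.succ_ne_zero a).symm, (Fin.succ_ne_zero b).symm,
      (Fin.succ_ne_zero c).symm, hsucc.ne hab.1, hsucc.ne hac.1, hsucc.ne hbc.1,
      hab.2, hac.2, hbc.2⟩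
  · right
    refine ⟨0, s.map ⟨Fin.succ, hsucc⟩, by simp, by simpa using hcard, ?_⟩
    simp only [Finset.mem_map, Function.Embedding.coeFn_mk]
    rintro _ ⟨i, hi, rfl⟩ _ ⟨j, hj, rfl⟩ hij
    have hne : i ≠ j := fun h => hij (congrArg Fin.succ h)
    exact Bool.eq_false_iff.2 fun h => hs hi hj hne ⟨hne, h⟩

end HypergraphRamsey
end
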